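/- Let χ be a Dirichlet character modulo q. Then ∫_T^{2T} |L(1/2+it, χ)|⁴ dt = C(χ)·T(log T)⁴ + O_q(T(log T)³), where C(χ) = (1/(2π²))·(φ(q)/q)²·∏_{p | q}(1 − 2/(p+1)), the product running over the primes p dividing q and φ denoting Euler's totient function. -/

import Mathlib

open Complex Filter MeasureTheory Finset HurwitzZeta
open scoped ArithmeticFunction Real Classical

noncomputable section

/-- The finite set of primes `p ≤ X`. -/
def primesUpTo (X : ℝ) : Finset ℕ :=
  (Finset.range (Nat.floor X + 1)).filter (fun p => p.Prime ∧ (p : ℝ) ≤ X)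

/-- The finite set of naturals `n ≤ X`. -/
def natsUpTo (X : ℝ) : Finset ℕ :=
  (Finset.range (Nat.floor X + 1)).filter (fun n => (n : ℝ) ≤ X)

/-- Truncated Euler product `P_X(s,χ)`, defined via the primitive character `χ*` inducing `χ`:
`P_X(s,χ) = ∏_{p ∣ q} (1 - χ*(p) p^{-s}) · exp(∑_{n ≤ X} χ*(n) Λ(n) / (n^s log n))`. -/
def PX {q : ℕ} (X : ℝ) (χ : DirichletCharacter ℂ q) (s : ℂ) : ℂ :=
  (∏ p ∈ q.primeFactors, (1 - χ.primitiveCharacter ((p : ℕ) : ZMod χ.conductor) * (p : ℂ) ^ (-s))) *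
    Complex.exp (∑ n ∈ natsUpTo X,
      χ.primitiveCharacter ((n : ℕ) : ZMod χ.conductor) * (Λ n : ℂ) / ((n : ℂ) ^ s * (Real.log n : ℂ)))

/-- `𝓟_X^ℓ(s) = ∏_χ P_X(s,χ)^{ℓ_χ}`. -/
def PXl {q : ℕ} (X : ℝ) (ℓ : DirichletCharacter ℂ q → ℕ) (s : ℂ) : ℂ :=
  ∏ χ : DirichletCharacter ℂ q, (PX X χ s) ^ (ℓ χ)

/-- A Dirichlet character as an arithmetic function. -/
def chiArith {q : ℕ} (χ : DirichletCharacter ℂ q) : ArithmeticFunction ℂ :=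
  ⟨fun n => if n = 0 then 0 else χ ((n : ℕ) : ZMod q), by simp⟩

/-- `d_ℓ`, the coefficients of the Dirichlet series of `𝓛^ℓ(s) = ∏_χ L(s,χ)^{ℓ_χ}`,
i.e. the Dirichlet convolution product `∏_χ χ^{*ℓ_χ}`. -/
def dcoef {q : ℕ} (ℓ : DirichletCharacter ℂ q → ℕ) : ArithmeticFunction ℂ :=
  ∏ χ : DirichletCharacter ℂ q, (chiArith χ) ^ (ℓ χ)

/-- `P*_X(s,χ) = ∏_{p ≤ X}(1 − χ(p)p^{−s})^{−1} · ∏_{√X < p ≤ X}(1 + χ(p)²/(2p^{2s}))^{−1}`. -/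
def PstarX {q : ℕ} (X : ℝ) (χ : DirichletCharacter ℂ q) (s : ℂ) : ℂ :=
  ((primesUpTo X).prod (fun p : ℕ => (1 - χ ((p : ℕ) : ZMod q) * (p : ℂ) ^ (-s))⁻¹)) *
    ((primesUpTo X).filter (fun p : ℕ => Real.sqrt X < (p : ℝ))).prod
      (fun p : ℕ => (1 + χ ((p : ℕ) : ZMod q) ^ 2 / (2 * (p : ℂ) ^ (2 * s)))⁻¹)

/-- `𝓟*_X^ℓ(s) = ∏_χ P*_X(s,χ)^{ℓ_χ}`. -/
def PstarXl {q : ℕ} (X : ℝ) (ℓ : DirichletCharacter ℂ q → ℕ) (s : ℂ) : ℂ :=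
  ∏ χ : DirichletCharacter ℂ q, (PstarX X χ s) ^ (ℓ χ)

/-- `Q_X(s,χ) = ∏_{p ≤ √X}(1 − χ(p)p^{−s}) · ∏_{√X < p ≤ X}(1 − χ(p)p^{−s} + χ(p)²/(2p^{2s}))`. -/
def QX {q : ℕ} (X : ℝ) (χ : DirichletCharacter ℂ q) (s : ℂ) : ℂ :=
  (((primesUpTo X).filter (fun p : ℕ => (p : ℝ) ≤ Real.sqrt X)).prod
      (fun p : ℕ => 1 - χ ((p : ℕ) : ZMod q) * (p : ℂ) ^ (-s))) *
    ((primesUpTo X).filter (fun p : ℕ => Real.sqrt X < (p : ℝ))).prod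
      (fun p : ℕ => 1 - χ ((p : ℕ) : ZMod q) * (p : ℂ) ^ (-s)
        + χ ((p : ℕ) : ZMod q) ^ 2 / (2 * (p : ℂ) ^ (2 * s)))

/-- `𝓠_X^ℓ(s) = ∏_χ Q_X(s,χ)^{ℓ_χ}`. -/
def QXl {q : ℕ} (X : ℝ) (ℓ : DirichletCharacter ℂ q → ℕ) (s : ℂ) : ℂ :=
  ∏ χ : DirichletCharacter ℂ q, (QX X χ s) ^ (ℓ χ)

/-- `𝓛^ℓ(s) = ∏_χ L(s,χ)^{ℓ_χ}`. -/
def Ll {q : ℕ} [NeZero q] (ℓ : DirichletCharacter ℂ q → ℕ) (s : ℂ) : ℂ :=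
  ∏ χ : DirichletCharacter ℂ q, (DirichletCharacter.LFunction χ s) ^ (ℓ χ)

/-- GRH for the Dirichlet L-functions modulo `q`: every zero `ρ` of `L(s,χ)` with
`0 < Re ρ < 1` satisfies `Re ρ = 1/2`. -/
def GRHmod (q : ℕ) [NeZero q] : Prop :=
  ∀ χ : DirichletCharacter ℂ q, ∀ ρ : ℂ,
    DirichletCharacter.LFunction χ ρ = 0 → 0 < ρ.re → ρ.re < 1 → ρ.re = 1 / 2

end

/-! ### Divisor sums -/

/-- The divisor function as a real number. -/
noncomputable def divisorCount (n : ℕ) : ℝ := (n.divisors.card : ℝ)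

lemma divisorCount_nonneg (n : ℕ) : 0 ≤ divisorCount n := Nat.cast_nonneg _

lemma divisorCount_eq_sum (n : ℕ) :
    divisorCount n = ∑ _x ∈ n.divisorsAntidiagonal, (1 : ℝ) := by
  rw [Finset.sum_const, nsmul_eq_mul, mul_one, divisorCount, ← Nat.map_div_right_divisors,
    Finset.card_map]

lemma divisorCount_mono_of_dvd {m n : ℕ} (h : m ∣ n) (hn : n ≠ 0) :
    divisorCount m ≤ divisorCount n := by
  unfold divisorCount
  exact_mod_cast Finset.card_le_card (Nat.divisors_subset_of_dvd hn h)

lemma divisorCount_mul_le (a b : ℕ) : divisorCount (a * b) ≤ divisorCount a * divisorCount b := by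
  unfold divisorCount
  rw [Nat.divisors_mul]
  exact_mod_cast Finset.card_mul_le

/-- Dirichlet's hyperbola rearrangement. -/
lemma sum_Ioc_sum_divisorsAntidiagonal {R : Type*} [AddCommMonoid R] (F : ℕ → ℕ → R) (N : ℕ) :
    ∑ n ∈ Ioc 0 N, ∑ x ∈ n.divisorsAntidiagonal, F x.1 x.2
      = ∑ a ∈ Ioc 0 N, ∑ b ∈ Ioc 0 (N / a), F a b := by
  rw [Finset.sum_sigma', Finset.sum_sigma']
  refine Finset.sum_bij' (fun x _ => ⟨x.2.1, x.2.2⟩) (fun x _ => ⟨x.1 * x.2, (x.1, x.2)⟩) ?_ ?_ ?_ ?_ ?_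
  · rintro ⟨n, a, b⟩ h
    simp only [Finset.mem_sigma, Finset.mem_Ioc, Nat.mem_divisorsAntidiagonal] at h ⊢
    obtain ⟨⟨h0, hN⟩, hab, -⟩ := h
    have ha : 0 < a := Nat.pos_of_ne_zero (by rintro rfl; simp at hab; omega)
    have hb : 0 < b := Nat.pos_of_ne_zero (by rintro rfl; simp at hab; omega)
    refine ⟨⟨ha, ?_⟩, hb, ?_⟩
    · nlinarith
    · rw [Nat.le_div_iff_mul_le ha]; nlinarith
  · rintro ⟨a, b⟩ h
    simp only [Finset.mem_sigma, Finset.mem_Ioc, Nat.mem_divisorsAntidiagonal] at h ⊢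
    obtain ⟨⟨ha, -⟩, hb, hbN⟩ := h
    rw [Nat.le_div_iff_mul_le ha] at hbN
    refine ⟨⟨Nat.mul_pos ha hb, by nlinarith⟩, trivial, (Nat.mul_pos ha hb).ne'⟩
  · rintro ⟨n, a, b⟩ h
    simp only [Finset.mem_sigma, Finset.mem_Ioc, Nat.mem_divisorsAntidiagonal] at h
    obtain ⟨-, rfl, -⟩ := h
    rfl
  · rintro ⟨a, b⟩ h
    rfl
  · rintro ⟨n, a, b⟩ h
    rfl

lemma sum_inv_le_one_add_log (N : ℕ) : ∑ n ∈ Ioc 0 N, (1 / (n : ℝ)) ≤ 1 + Real.log N := by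
  have h := harmonic_le_one_add_log N
  rw [harmonic_eq_sum_Icc] at h
  push_cast at h
  rw [show Ioc 0 N = Icc 1 N by ext; simp; omega]
  simpa [one_div] using h

lemma one_le_one_add_log (N : ℕ) : 1 ≤ 1 + Real.log N := by
  have := Real.log_natCast_nonneg N
  linarith

lemma sum_inv_sqrt_le (N : ℕ) : ∑ n ∈ Ioc 0 N, (1 / √(n : ℝ)) ≤ 2 * √(N : ℝ) := by
  induction N with
  | zero => simp
  | succ k ih =>
    rw [← Finset.insert_Ioc_right_eq_Ioc_add_one (by omega), Finset.sum_insert (by simp)]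
    have h1 : 0 < √((k + 1 : ℕ) : ℝ) := Real.sqrt_pos.2 (by positivity)
    have h2 : √(k : ℝ) ^ 2 = k := Real.sq_sqrt (by positivity)
    have h3 : √((k + 1 : ℕ) : ℝ) ^ 2 = k + 1 := by rw [Real.sq_sqrt (by positivity)]; push_cast; ring
    have h4 : 1 / √((k + 1 : ℕ) : ℝ) ≤ 2 * √((k + 1 : ℕ) : ℝ) - 2 * √(k : ℝ) := by
      rw [div_le_iff₀ h1]
      nlinarith [sq_nonneg (√((k + 1 : ℕ) : ℝ) - √(k : ℝ))]
    linarith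

lemma log_natDiv_le (N a : ℕ) : Real.log ((N / a : ℕ) : ℝ) ≤ Real.log N := by
  rcases Nat.eq_zero_or_pos (N / a) with h | h
  · rw [h]; simpa using Real.log_natCast_nonneg N
  · exact Real.log_le_log (by exact_mod_cast h) (by exact_mod_cast Nat.div_le_self N a)

lemma sum_divisorCount_le (N : ℕ) :
    ∑ n ∈ Ioc 0 N, divisorCount n ≤ N * (1 + Real.log N) := by
  simp_rw [divisorCount_eq_sum]
  rw [sum_Ioc_sum_divisorsAntidiagonal (fun _ _ => (1 : ℝ))]
  calc _ ≤ ∑ a ∈ Ioc 0 N, (N : ℝ) * (1 / (a : ℝ)) := by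
        refine Finset.sum_le_sum fun a _ => ?_
        simp only [Finset.sum_const, Nat.card_Ioc, nsmul_eq_mul, mul_one, tsub_zero]
        rw [mul_one_div]
        exact Nat.cast_div_le
    _ ≤ _ := by
        rw [← Finset.mul_sum]
        gcongr
        exact sum_inv_le_one_add_log N

lemma sum_divisorCount_div_le (N : ℕ) :
    ∑ n ∈ Ioc 0 N, divisorCount n / n ≤ (1 + Real.log N) ^ 2 := by
  have h0 := one_le_one_add_log N
  have e : ∀ n ∈ Ioc 0 N, divisorCount n / n
      = ∑ x ∈ n.divisorsAntidiagonal, (1 / (x.1 : ℝ)) * (1 / (x.2 : ℝ)) := by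
    intro n hn
    rw [divisorCount_eq_sum, Finset.sum_div]
    refine Finset.sum_congr rfl fun x hx => ?_
    rw [← (Nat.mem_divisorsAntidiagonal.1 hx).1]
    push_cast
    rw [one_div_mul_one_div]
  rw [Finset.sum_congr rfl e,
    sum_Ioc_sum_divisorsAntidiagonal (fun a b => (1 / (a : ℝ)) * (1 / (b : ℝ)))]
  calc _ ≤ ∑ a ∈ Ioc 0 N, (1 / (a : ℝ)) * (1 + Real.log N) := by
        refine Finset.sum_le_sum fun a _ => ?_
        rw [← Finset.mul_sum]
        gcongr
        exact (sum_inv_le_one_add_log _).trans (by gcongr 1 + ?_; exact log_natDiv_le N a)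
    _ ≤ _ := by
        rw [← Finset.sum_mul, sq]
        gcongr
        exact sum_inv_le_one_add_log N

lemma sum_divisorCount_div_sqrt_le (N : ℕ) :
    ∑ n ∈ Ioc 0 N, divisorCount n / √(n : ℝ) ≤ 2 * √(N : ℝ) * (1 + Real.log N) := by
  have e : ∀ n ∈ Ioc 0 N, divisorCount n / √(n : ℝ)
      = ∑ x ∈ n.divisorsAntidiagonal, (1 / √(x.1 : ℝ)) * (1 / √(x.2 : ℝ)) := by
    intro n hn
    rw [divisorCount_eq_sum, Finset.sum_div]
    refine Finset.sum_congr rfl fun x hx => ?_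
    rw [← (Nat.mem_divisorsAntidiagonal.1 hx).1]
    push_cast
    rw [Real.sqrt_mul (by positivity), one_div_mul_one_div]
  rw [Finset.sum_congr rfl e,
    sum_Ioc_sum_divisorsAntidiagonal (fun a b => (1 / √(a : ℝ)) * (1 / √(b : ℝ)))]
  calc _ ≤ ∑ a ∈ Ioc 0 N, (2 * √(N : ℝ)) * (1 / (a : ℝ)) := by
        refine Finset.sum_le_sum fun a ha => ?_
        have ha0 : (0 : ℝ) < a := by exact_mod_cast (Finset.mem_Ioc.1 ha).1
        rw [← Finset.mul_sum]
        calc _ ≤ (1 / √(a : ℝ)) * (2 * √((N / a : ℕ) : ℝ)) := by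
              gcongr; exact sum_inv_sqrt_le _
          _ ≤ (1 / √(a : ℝ)) * (2 * √((N : ℝ) / a)) := by
              gcongr; exact Nat.cast_div_le
          _ = _ := by
              rw [Real.sqrt_div (by positivity)]
              have : √(a : ℝ) * √(a : ℝ) = a := Real.mul_self_sqrt ha0.le
              have h1 : √(a : ℝ) ≠ 0 := (Real.sqrt_pos.2 ha0).ne'
              field_simp
              rw [sq, this, mul_comm]
    _ ≤ _ := by
        rw [← Finset.mul_sum]
        gcongr
        exact sum_inv_le_one_add_log N

lemma sum_divisorCount_sq_le (N : ℕ) :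
    ∑ n ∈ Ioc 0 N, divisorCount n ^ 2 ≤ N * (1 + Real.log N) ^ 3 := by
  have h0 := one_le_one_add_log N
  calc ∑ n ∈ Ioc 0 N, divisorCount n ^ 2
      ≤ ∑ n ∈ Ioc 0 N, ∑ x ∈ n.divisorsAntidiagonal, divisorCount x.1 * divisorCount x.2 := by
        refine Finset.sum_le_sum fun n _ => ?_
        rw [sq]
        nth_rw 1 [divisorCount_eq_sum]
        rw [Finset.sum_mul]
        refine Finset.sum_le_sum fun x hx => ?_
        rw [one_mul, ← (Nat.mem_divisorsAntidiagonal.1 hx).1]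
        exact divisorCount_mul_le _ _
    _ = ∑ a ∈ Ioc 0 N, ∑ b ∈ Ioc 0 (N / a), divisorCount a * divisorCount b :=
        sum_Ioc_sum_divisorsAntidiagonal (fun a b => divisorCount a * divisorCount b) N
    _ ≤ ∑ a ∈ Ioc 0 N, (N * (1 + Real.log N)) * (divisorCount a / a) := by
        refine Finset.sum_le_sum fun a _ => ?_
        rw [← Finset.mul_sum]
        have h1 : ∑ b ∈ Ioc 0 (N / a), divisorCount b ≤ (N / a : ℝ) * (1 + Real.log N) := by
          refine (sum_divisorCount_le _).trans ?_
          have := one_le_one_add_log (N / a)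
          refine mul_le_mul Nat.cast_div_le ?_ (by linarith) (by positivity)
          have := log_natDiv_le N a
          linarith
        calc _ ≤ divisorCount a * ((N / a : ℝ) * (1 + Real.log N)) := by
              gcongr; exact divisorCount_nonneg a
          _ = _ := by ring
    _ ≤ (N * (1 + Real.log N)) * (1 + Real.log N) ^ 2 := by
        rw [← Finset.mul_sum]
        gcongr
        exact sum_divisorCount_div_le N
    _ = _ := by ring

lemma divisorCount_le_two_mul {n N : ℕ} (hn : n ∈ Ioc 0 N) :
    divisorCount n ≤ 2 * ∑ a ∈ Ioc 0 (Nat.sqrt N), if a ∣ n then (1 : ℝ) else 0 := by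
  obtain ⟨hn0, hnN⟩ := Finset.mem_Ioc.1 hn
  rw [Finset.sum_ite, Finset.sum_const_zero, add_zero, Finset.sum_const, nsmul_eq_mul, mul_one]
  set S := (Ioc 0 (Nat.sqrt N)).filter (fun a => a ∣ n)
  have hsub : n.divisors ⊆ S ∪ S.image (fun a => n / a) := by
    intro a ha
    have had := Nat.dvd_of_mem_divisors ha
    obtain ⟨b, hb⟩ := had
    have ha0 : 0 < a := Nat.pos_of_mem_divisors ha
    have hb0 : 0 < b := Nat.pos_of_ne_zero (by rintro rfl; simp at hb; omega)
    by_cases h : a ≤ Nat.sqrt N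
    · exact Finset.mem_union_left _ (by simp [S, h, ha0]; exact ⟨b, hb⟩)
    · refine Finset.mem_union_right _ (Finset.mem_image.2 ⟨b, ?_, ?_⟩)
      · simp only [S, Finset.mem_filter, Finset.mem_Ioc]
        refine ⟨⟨hb0, ?_⟩, ⟨a, by rw [hb, mul_comm]⟩⟩
        by_contra hbs
        push Not at h hbs
        have h1 := Nat.lt_succ_sqrt N
        have : (Nat.sqrt N + 1) * (Nat.sqrt N + 1) ≤ a * b := Nat.mul_le_mul h hbs
        simp only [Nat.succ_eq_add_one] at h1
        omega
      · rw [hb]; exact Nat.mul_div_cancel _ hb0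
  have h1 := (Finset.card_le_card hsub).trans (Finset.card_union_le _ _)
  have h2 : (S.image (fun a => n / a)).card ≤ S.card := Finset.card_image_le
  unfold divisorCount
  exact_mod_cast (by omega : n.divisors.card ≤ 2 * S.card)

lemma card_dvd_dvd_add_le {a b k N : ℕ} (ha : 0 < a) (hb : 0 < b) :
    (((Ioc 0 N).filter (fun m => a ∣ m ∧ b ∣ m + k)).card : ℝ) ≤
      if Nat.gcd a b ∣ k then (N : ℝ) * Nat.gcd a b / (a * b) + 1 else 0 := by
  split_ifs with hk
  · have hl : 0 < Nat.lcm a b := Nat.lcm_pos ha hb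
    have h1 : ((Ioc 0 N).filter (fun m => a ∣ m ∧ b ∣ m + k)).card ≤ N / Nat.lcm a b + 1 := by
      rw [← Finset.card_range (N / Nat.lcm a b + 1)]
      refine Finset.card_le_card_of_injOn (fun m => m / Nat.lcm a b) ?_ ?_
      · intro m hm
        simp only [Finset.coe_filter, Finset.mem_Ioc, Set.mem_ofPred_eq] at hm
        simp only [Finset.coe_range, Set.mem_Iio]
        exact Nat.lt_succ_of_le (Nat.div_le_div_right hm.1.2)
      · intro m hm n hn hmn
        simp only [Finset.coe_filter, Finset.mem_Ioc, Set.mem_ofPred_eq] at hm hn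
        have hmod : m ≡ n [MOD Nat.lcm a b] := by
          have e1 : m ≡ n [MOD a] :=
            ((Nat.modEq_zero_iff_dvd.2 hm.2.1)).trans (Nat.modEq_zero_iff_dvd.2 hn.2.1).symm
          have e2 : m ≡ n [MOD b] := Nat.ModEq.add_right_cancel' k
            ((Nat.modEq_zero_iff_dvd.2 hm.2.2).trans (Nat.modEq_zero_iff_dvd.2 hn.2.2).symm)
          exact Nat.mod_lcm e1 e2
        have h2 : m % Nat.lcm a b = n % Nat.lcm a b := hmod
        simp only at hmn
        rw [← Nat.div_add_mod m (Nat.lcm a b), ← Nat.div_add_mod n (Nat.lcm a b), hmn, h2]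
    have h2 : ((Nat.lcm a b : ℕ) : ℝ) * Nat.gcd a b = a * b := by
      rw [mul_comm]; exact_mod_cast Nat.gcd_mul_lcm a b
    have hg : (0 : ℝ) < Nat.gcd a b := by exact_mod_cast Nat.gcd_pos_of_pos_left b ha
    have h3 : (N : ℝ) * Nat.gcd a b / (a * b) = N / (Nat.lcm a b : ℕ) := by
      rw [← h2]; field_simp
    rw [h3]
    calc _ ≤ (((N / Nat.lcm a b : ℕ) : ℝ)) + 1 := by exact_mod_cast h1
      _ ≤ _ := by gcongr; exact Nat.cast_div_le
  · rw [Finset.filter_eq_empty_iff.2]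
    · simp
    · intro m _ ⟨h1, h2⟩
      exact hk ((Nat.dvd_add_right ((Nat.gcd_dvd_left a b).trans h1)).1
        ((Nat.gcd_dvd_right a b).trans h2))

lemma sum_inv_multiples_le {g N : ℕ} (hg : 0 < g) :
    ∑ k ∈ Ioc 0 N, (if g ∣ k then 1 / (k : ℝ) else 0) ≤ (1 + Real.log N) / g := by
  rw [← Finset.sum_filter]
  calc ∑ k ∈ (Ioc 0 N).filter (fun k => g ∣ k), 1 / (k : ℝ)
      ≤ ∑ k ∈ (Ioc 0 (N / g)).image (fun j => g * j), 1 / (k : ℝ) := by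
        refine Finset.sum_le_sum_of_subset_of_nonneg ?_ (fun _ _ _ => by positivity)
        intro k hk
        simp only [Finset.mem_filter, Finset.mem_Ioc] at hk
        obtain ⟨⟨h0, hN⟩, j, rfl⟩ := hk
        refine Finset.mem_image.2 ⟨j, Finset.mem_Ioc.2 ⟨Nat.pos_of_mul_pos_left h0, ?_⟩, rfl⟩
        rw [Nat.le_div_iff_mul_le hg]; linarith
    _ = ∑ j ∈ Ioc 0 (N / g), (1 / (g : ℝ)) * (1 / (j : ℝ)) := by
        rw [Finset.sum_image (fun x _ y _ h => Nat.eq_of_mul_eq_mul_left hg h)]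
        refine Finset.sum_congr rfl fun j _ => ?_
        push_cast; rw [one_div_mul_one_div]
    _ ≤ (1 / (g : ℝ)) * (1 + Real.log N) := by
        rw [← Finset.mul_sum]
        gcongr
        exact (sum_inv_le_one_add_log _).trans (by gcongr 1 + ?_; exact log_natDiv_le N g)
    _ = _ := by ring

/-- The logarithmically weighted sum of all shifted divisor correlations. -/
lemma sum_shifted_divisorCount_le (N : ℕ) :
    ∑ k ∈ Ioc 0 N, (1 / (k : ℝ)) *
        ∑ m ∈ (Ioc 0 N).filter (fun m => m + k ≤ N), divisorCount m * divisorCount (m + k)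
      ≤ 8 * N * (1 + Real.log N) ^ 3 := by
  set R := Nat.sqrt N with hR
  have hL := one_le_one_add_log N
  have hLR : Real.log R ≤ Real.log N := by
    rcases Nat.eq_zero_or_pos R with h | h
    · rw [h]; simpa using Real.log_natCast_nonneg N
    · exact Real.log_le_log (by exact_mod_cast h) (by exact_mod_cast Nat.sqrt_le_self N)
  have step1 : ∀ k ∈ Ioc 0 N,
      ∑ m ∈ (Ioc 0 N).filter (fun m => m + k ≤ N), divisorCount m * divisorCount (m + k)
      ≤ 4 * ∑ a ∈ Ioc 0 R, ∑ b ∈ Ioc 0 R,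
          (if Nat.gcd a b ∣ k then (N : ℝ) * Nat.gcd a b / (a * b) + 1 else 0) := by
    intro k hk
    calc _ ≤ ∑ m ∈ (Ioc 0 N).filter (fun m => m + k ≤ N),
          (2 * ∑ a ∈ Ioc 0 R, if a ∣ m then (1 : ℝ) else 0) *
          (2 * ∑ b ∈ Ioc 0 R, if b ∣ m + k then (1 : ℝ) else 0) := by
          refine Finset.sum_le_sum fun m hm => ?_
          simp only [Finset.mem_filter, Finset.mem_Ioc] at hm
          refine mul_le_mul (divisorCount_le_two_mul (Finset.mem_Ioc.2 hm.1))
            (divisorCount_le_two_mul (Finset.mem_Ioc.2 ⟨by omega, hm.2⟩))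
            (divisorCount_nonneg _) ?_
          exact mul_nonneg (by norm_num) (Finset.sum_nonneg fun _ _ => by split_ifs <;> norm_num)
      _ ≤ ∑ m ∈ Ioc 0 N,
          (2 * ∑ a ∈ Ioc 0 R, if a ∣ m then (1 : ℝ) else 0) *
          (2 * ∑ b ∈ Ioc 0 R, if b ∣ m + k then (1 : ℝ) else 0) := by
          refine Finset.sum_le_sum_of_subset_of_nonneg (Finset.filter_subset _ _) fun _ _ _ => ?_
          refine mul_nonneg ?_ ?_ <;>
          exact mul_nonneg (by norm_num) (Finset.sum_nonneg fun _ _ => by split_ifs <;> norm_num)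
      _ = 4 * ∑ a ∈ Ioc 0 R, ∑ b ∈ Ioc 0 R,
          ∑ m ∈ Ioc 0 N, (if a ∣ m ∧ b ∣ m + k then (1 : ℝ) else 0) := by
          have : ∀ m ∈ Ioc 0 N, (2 * ∑ a ∈ Ioc 0 R, if a ∣ m then (1 : ℝ) else 0) *
              (2 * ∑ b ∈ Ioc 0 R, if b ∣ m + k then (1 : ℝ) else 0) =
              4 * ∑ a ∈ Ioc 0 R, ∑ b ∈ Ioc 0 R, (if a ∣ m ∧ b ∣ m + k then (1 : ℝ) else 0) := by
            intro m _
            rw [mul_mul_mul_comm, Finset.sum_mul_sum]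
            norm_num only
            congr 1
            refine Finset.sum_congr rfl fun a _ => Finset.sum_congr rfl fun b _ => ?_
            rw [ite_and, ite_mul, one_mul, zero_mul]
          rw [Finset.sum_congr rfl this, ← Finset.mul_sum, Finset.sum_comm]
          congr 1
          exact Finset.sum_congr rfl fun a _ => Finset.sum_comm
      _ ≤ _ := by
          gcongr 4 * ?_
          refine Finset.sum_le_sum fun a ha => Finset.sum_le_sum fun b hb => ?_
          rw [Finset.sum_ite, Finset.sum_const_zero, add_zero, Finset.sum_const, nsmul_eq_mul,
            mul_one]
          exact card_dvd_dvd_add_le (Finset.mem_Ioc.1 ha).1 (Finset.mem_Ioc.1 hb).1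
  calc _ ≤ ∑ k ∈ Ioc 0 N, (1 / (k : ℝ)) * (4 * ∑ a ∈ Ioc 0 R, ∑ b ∈ Ioc 0 R,
          (if Nat.gcd a b ∣ k then (N : ℝ) * Nat.gcd a b / (a * b) + 1 else 0)) := by
        refine Finset.sum_le_sum fun k hk => ?_
        gcongr
        exact step1 k hk
    _ = 4 * ∑ a ∈ Ioc 0 R, ∑ b ∈ Ioc 0 R, ((N : ℝ) * Nat.gcd a b / (a * b) + 1) *
          ∑ k ∈ Ioc 0 N, (if Nat.gcd a b ∣ k then 1 / (k : ℝ) else 0) := by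
        simp_rw [Finset.mul_sum]
        rw [Finset.sum_comm]
        refine Finset.sum_congr rfl fun a _ => ?_
        rw [Finset.sum_comm]
        refine Finset.sum_congr rfl fun b _ => Finset.sum_congr rfl fun k _ => ?_
        split_ifs
        · ring
        · simp
    _ ≤ 4 * ∑ a ∈ Ioc 0 R, ∑ b ∈ Ioc 0 R,
          ((N : ℝ) * ((1 / a) * (1 / b)) + 1) * (1 + Real.log N) := by
        gcongr 4 * ?_
        refine Finset.sum_le_sum fun a ha => Finset.sum_le_sum fun b hb => ?_
        have ha0 := (Finset.mem_Ioc.1 ha).1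
        have hb0 := (Finset.mem_Ioc.1 hb).1
        have hg := Nat.gcd_pos_of_pos_left b ha0
        have hg1 : (1 : ℝ) ≤ Nat.gcd a b := by exact_mod_cast hg
        have ha1 : (0 : ℝ) < a := by exact_mod_cast ha0
        have hb1 : (0 : ℝ) < b := by exact_mod_cast hb0
        calc _ ≤ ((N : ℝ) * Nat.gcd a b / (a * b) + 1) * ((1 + Real.log N) / Nat.gcd a b) := by
              gcongr
              exact sum_inv_multiples_le hg
          _ = ((N : ℝ) * ((1 / a) * (1 / b)) + 1 / Nat.gcd a b) * (1 + Real.log N) := by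
              field_simp
          _ ≤ _ := by
              gcongr
              rw [div_le_one (by linarith)]; exact hg1
    _ = 4 * (((N : ℝ) * ((∑ a ∈ Ioc 0 R, (1 / (a : ℝ))) * ∑ b ∈ Ioc 0 R, (1 / (b : ℝ)))
          + (R : ℝ) * R) * (1 + Real.log N)) := by
        congr 1
        simp_rw [← Finset.sum_mul, Finset.sum_add_distrib, ← Finset.mul_sum]
        rw [← Finset.sum_mul]
        simp
    _ ≤ 4 * (((N : ℝ) * ((1 + Real.log N) * (1 + Real.log N))
          + N * ((1 + Real.log N) * (1 + Real.log N))) * (1 + Real.log N)) := by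
        have h1 : ∑ a ∈ Ioc 0 R, (1 / (a : ℝ)) ≤ 1 + Real.log N :=
          (sum_inv_le_one_add_log R).trans (by linarith)
        have h2 : (R : ℝ) * R ≤ N := by exact_mod_cast Nat.sqrt_le N
        have h0 : 0 ≤ ∑ a ∈ Ioc 0 R, (1 / (a : ℝ)) := Finset.sum_nonneg fun _ _ => by positivity
        have h3 : (R : ℝ) * R ≤ N * ((1 + Real.log N) * (1 + Real.log N)) :=
          h2.trans (le_mul_of_one_le_right (by positivity) (by nlinarith))
        have h4 : (∑ a ∈ Ioc 0 R, (1 / (a : ℝ))) * ∑ b ∈ Ioc 0 R, (1 / (b : ℝ)) ≤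
            (1 + Real.log N) * (1 + Real.log N) := mul_le_mul h1 h1 h0 (by linarith)
        have h5 := mul_le_mul_of_nonneg_left h4 (Nat.cast_nonneg (α := ℝ) N)
        have h6 := mul_le_mul_of_nonneg_right (add_le_add h5 h3)
          (by linarith : 0 ≤ 1 + Real.log N)
        linarith
    _ = _ := by ring

/-- The sum of the products `d(m) d(n) / (n - m)` over pairs `m < n ≤ N`. -/
lemma sum_divisorCount_pair_le (N : ℕ) :
    ∑ n ∈ Ioc 0 N, ∑ m ∈ Ioo 0 n, divisorCount m * divisorCount n / ((n : ℝ) - m)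
      ≤ 8 * N * (1 + Real.log N) ^ 3 := by
  refine le_trans (le_of_eq ?_) (sum_shifted_divisorCount_le N)
  simp_rw [Finset.mul_sum]
  rw [Finset.sum_sigma', Finset.sum_sigma']
  refine Finset.sum_bij' (fun x _ => ⟨x.1 - x.2, x.2⟩) (fun x _ => ⟨x.2 + x.1, x.2⟩) ?_ ?_ ?_ ?_ ?_
  · rintro ⟨n, m⟩ h
    simp only [Finset.mem_sigma, Finset.mem_Ioc, Finset.mem_Ioo, Finset.mem_filter] at h ⊢
    omega
  · rintro ⟨n, m⟩ h
    simp only [Finset.mem_sigma, Finset.mem_Ioc, Finset.mem_Ioo, Finset.mem_filter] at h ⊢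
    omega
  · rintro ⟨n, m⟩ h
    simp only [Finset.mem_sigma, Finset.mem_Ioc, Finset.mem_Ioo] at h
    have : m + (n - m) = n := by omega
    simp [this]
  · rintro ⟨n, m⟩ h
    simp
  · rintro ⟨n, m⟩ h
    simp only [Finset.mem_sigma, Finset.mem_Ioc, Finset.mem_Ioo] at h
    have h1 : m + (n - m) = n := by omega
    simp only
    rw [h1, Nat.cast_sub (by omega)]
    ring

/-- Dyadic summation: a bound for the partial sums of a nonnegative sequence controls the tails of
the associated Dirichlet series. -/
lemma exists_sum_Ioc_mul_rpow_le {e : ℕ → ℝ} (he : ∀ n, 0 ≤ e n) {C : ℝ} {j : ℕ}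
    (hC : ∀ N : ℕ, ∑ n ∈ Ioc 0 N, e n ≤ C * N * (1 + Real.log N) ^ j) {α : ℝ} (hα : 1 < α) :
    ∃ C' : ℝ, 0 ≤ C' ∧ ∀ N K : ℕ, 1 ≤ N →
      ∑ n ∈ Ioc N K, e n * (n : ℝ) ^ (-α) ≤ C' * (N : ℝ) ^ (1 - α) * (1 + Real.log N) ^ j := by
  have hC0 : 0 ≤ C := by
    have := (Finset.sum_nonneg fun n _ => he n).trans (hC 1)
    simpa using this
  set r : ℝ := (2 : ℝ) ^ (1 - α) with hr
  have hr0 : 0 < r := Real.rpow_pos_of_pos two_pos _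
  have hr1 : r < 1 := Real.rpow_lt_one_of_one_lt_of_neg one_lt_two (by linarith)
  have hsum : Summable fun i : ℕ => ((i : ℝ) + 2) ^ j * r ^ i := by
    have h1 : Summable fun i : ℕ => ((i : ℝ)) ^ j * r ^ i :=
      summable_pow_mul_geometric_of_norm_lt_one j (by rwa [Real.norm_of_nonneg hr0.le])
    have h2 := ((summable_nat_add_iff 2).2 h1).mul_left (r ^ 2)⁻¹
    refine h2.congr fun i => ?_
    push_cast
    field_simp
    ring
  set S := ∑' i : ℕ, ((i : ℝ) + 2) ^ j * r ^ i with hS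
  have hS0 : 0 ≤ S := tsum_nonneg fun i => by positivity
  refine ⟨2 * C * S, by positivity, fun N K hN => ?_⟩
  have hN0 : (0 : ℝ) < N := by exact_mod_cast hN
  have hL := one_le_one_add_log N
  have hblock : ∀ i : ℕ, ∑ n ∈ Ioc (2 ^ i * N) (2 ^ (i + 1) * N), e n * (n : ℝ) ^ (-α)
      ≤ 2 * C * (N : ℝ) ^ (1 - α) * (1 + Real.log N) ^ j * (((i : ℝ) + 2) ^ j * r ^ i) := by
    intro i
    have hx0 : (0 : ℝ) < 2 ^ i * N := by positivity
    have hlog : 1 + Real.log ((2 ^ (i + 1) * N : ℕ) : ℝ) ≤ (1 + Real.log N) * ((i : ℝ) + 2) := by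
      push_cast
      rw [Real.log_mul (by positivity) hN0.ne', Real.log_pow]
      have h2 : Real.log 2 ≤ 1 := by linarith [Real.log_two_lt_d9]
      push_cast
      nlinarith [Real.log_natCast_nonneg N, (Nat.cast_nonneg i : (0 : ℝ) ≤ i)]
    calc ∑ n ∈ Ioc (2 ^ i * N) (2 ^ (i + 1) * N), e n * (n : ℝ) ^ (-α)
        ≤ ∑ n ∈ Ioc (2 ^ i * N) (2 ^ (i + 1) * N), e n * (2 ^ i * N : ℝ) ^ (-α) := by
          refine Finset.sum_le_sum fun n hn => mul_le_mul_of_nonneg_left ?_ (he n)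
          refine Real.rpow_le_rpow_of_nonpos hx0 ?_ (by linarith)
          exact_mod_cast (Finset.mem_Ioc.1 hn).1.le
      _ = (∑ n ∈ Ioc (2 ^ i * N) (2 ^ (i + 1) * N), e n) * (2 ^ i * N : ℝ) ^ (-α) := by
          rw [Finset.sum_mul]
      _ ≤ (∑ n ∈ Ioc 0 (2 ^ (i + 1) * N), e n) * (2 ^ i * N : ℝ) ^ (-α) := by
          refine mul_le_mul_of_nonneg_right ?_ (by positivity)
          exact Finset.sum_le_sum_of_subset_of_nonneg
            (Finset.Ioc_subset_Ioc_left (Nat.zero_le _)) fun n _ _ => he n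
      _ ≤ (C * (2 ^ (i + 1) * N : ℕ) * ((1 + Real.log N) * ((i : ℝ) + 2)) ^ j)
            * (2 ^ i * N : ℝ) ^ (-α) := by
          refine mul_le_mul_of_nonneg_right ((hC _).trans ?_) (by positivity)
          have := one_le_one_add_log (2 ^ (i + 1) * N)
          gcongr
      _ = _ := by
          have h1 : (2 ^ i * N : ℝ) ^ (-α) * (2 ^ i * N : ℝ) = (N : ℝ) ^ (1 - α) * r ^ i := by
            rw [← Real.rpow_add_one hx0.ne', show -α + 1 = 1 - α by ring,
              Real.mul_rpow (by positivity) hN0.le, hr, ← Real.rpow_natCast 2 i, ← Real.rpow_mul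
              (by norm_num), ← Real.rpow_natCast, ← Real.rpow_mul (by norm_num)]
            ring_nf
          push_cast
          rw [mul_pow, pow_succ]
          linear_combination (2 * C * ((1 + Real.log N) ^ j * ((i : ℝ) + 2) ^ j)) * h1
  have hdy : ∀ I : ℕ, ∑ n ∈ Ioc N (2 ^ I * N), e n * (n : ℝ) ^ (-α)
      ≤ 2 * C * (N : ℝ) ^ (1 - α) * (1 + Real.log N) ^ j
        * ∑ i ∈ Finset.range I, (((i : ℝ) + 2) ^ j * r ^ i) := by
    intro I
    induction I with
    | zero => simp
    | succ I ih =>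
      rw [Finset.sum_range_succ, mul_add]
      have h1 : N ≤ 2 ^ I * N := Nat.le_mul_of_pos_left _ (by positivity)
      have h2 : 2 ^ I * N ≤ 2 ^ (I + 1) * N := by
        gcongr
        · norm_num
        · omega
      rw [← Finset.sum_Ioc_consecutive _ h1 h2]
      exact add_le_add ih (hblock I)
  have hK : K ≤ 2 ^ K * N :=
    (Nat.lt_two_pow_self).le.trans (Nat.le_mul_of_pos_right _ hN)
  calc ∑ n ∈ Ioc N K, e n * (n : ℝ) ^ (-α)
      ≤ ∑ n ∈ Ioc N (2 ^ K * N), e n * (n : ℝ) ^ (-α) := by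
        refine Finset.sum_le_sum_of_subset_of_nonneg (Finset.Ioc_subset_Ioc_right hK) ?_
        exact fun n _ _ => mul_nonneg (he n) (by positivity)
    _ ≤ _ := hdy K
    _ ≤ 2 * C * (N : ℝ) ^ (1 - α) * (1 + Real.log N) ^ j * S := by
        refine mul_le_mul_of_nonneg_left ?_ (by positivity)
        exact hsum.sum_le_tsum _ fun i _ => by positivity
    _ = _ := by ring

/-! ### A mean value theorem for Dirichlet polynomials -/

lemma norm_integral_cexp_le {r : ℝ} (hr : r ≠ 0) (a b : ℝ) :
    ‖∫ t in a..b, cexp ((t * r : ℝ) * I)‖ ≤ 2 / |r| := by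
  have h1 : (r * I : ℂ) ≠ 0 := mul_ne_zero (by exact_mod_cast hr) I_ne_zero
  have h2 : (fun t : ℝ => cexp ((t * r : ℝ) * I)) = fun t : ℝ => cexp (r * I * t) := by
    ext t; push_cast; ring_nf
  rw [h2, integral_exp_mul_complex h1, norm_div]
  have h3 : ∀ x : ℝ, ‖cexp (r * I * x)‖ = 1 := by
    intro x
    rw [show (r * I * x : ℂ) = ((r * x : ℝ) : ℂ) * I by push_cast; ring, norm_exp_ofReal_mul_I]
  have h4 : ‖(r * I : ℂ)‖ = |r| := by simp
  rw [h4]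
  gcongr
  refine (norm_sub_le _ _).trans ?_
  rw [h3, h3]; norm_num

lemma inv_log_sub_log_le {m n : ℕ} (hm : 0 < m) (hmn : m < n) :
    1 / (Real.log n - Real.log m) ≤ n / ((n : ℝ) - m) := by
  have hm' : (0 : ℝ) < m := by exact_mod_cast hm
  have hmn' : (m : ℝ) < n := by exact_mod_cast hmn
  have hn' : (0 : ℝ) < n := hm'.trans hmn'
  have h := Real.one_sub_inv_le_log_of_pos (div_pos hn' hm')
  rw [Real.log_div hn'.ne' hm'.ne', inv_div] at h
  have h2 : (1 : ℝ) - m / n = (n - m) / n := by field_simp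
  rw [h2] at h
  have h3 : 0 < ((n : ℝ) - m) / n := div_pos (by linarith) hn'
  rw [show (n : ℝ) / (n - m) = 1 / (((n : ℝ) - m) / n) by rw [one_div_div]]
  exact one_div_le_one_div_of_le h3 h

lemma natCast_cpow_neg_mul_I {n : ℕ} (hn : n ≠ 0) (t : ℝ) :
    (n : ℂ) ^ (-(t * I)) = cexp ((-(t * Real.log n) : ℝ) * I) := by
  rw [cpow_def_of_ne_zero (by exact_mod_cast hn), ← natCast_log]
  congr 1; push_cast; ring

/-- The mean value theorem for Dirichlet polynomials, with an explicit off-diagonal term. -/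
lemma abs_integral_norm_sq_dirichletPoly_sub_le (S : Finset ℕ) (hS : ∀ n ∈ S, 0 < n) (c : ℕ → ℂ)
    (a b : ℝ) :
    |(∫ t in a..b, ‖∑ n ∈ S, c n * (n : ℂ) ^ (-(t * I))‖ ^ 2) - (b - a) * ∑ n ∈ S, ‖c n‖ ^ 2|
      ≤ 4 * ∑ n ∈ S, ∑ m ∈ S with m < n, ‖c m‖ * ‖c n‖ * (n / ((n : ℝ) - m)) := by
  have key : ∀ t : ℝ, ((‖∑ n ∈ S, c n * (n : ℂ) ^ (-(t * I))‖ ^ 2 : ℝ) : ℂ)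
      = ∑ n ∈ S, ∑ m ∈ S, (c n * (starRingEnd ℂ) (c m))
          * cexp ((t * (Real.log m - Real.log n) : ℝ) * I) := by
    intro t
    rw [ofReal_pow, ← Complex.mul_conj', map_sum, Finset.sum_mul_sum]
    refine Finset.sum_congr rfl fun n hn => Finset.sum_congr rfl fun m hm => ?_
    rw [natCast_cpow_neg_mul_I (hS n hn).ne', natCast_cpow_neg_mul_I (hS m hm).ne', map_mul,
      ← Complex.exp_conj, mul_mul_mul_comm, ← Complex.exp_add]
    congr 2
    simp only [map_mul, conj_ofReal, conj_I]
    push_cast; ring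
  have hInt : ((∫ t in a..b, ‖∑ n ∈ S, c n * (n : ℂ) ^ (-(t * I))‖ ^ 2 : ℝ) : ℂ)
      = ∑ n ∈ S, ∑ m ∈ S, (c n * (starRingEnd ℂ) (c m))
          * ∫ t in a..b, cexp ((t * (Real.log m - Real.log n) : ℝ) * I) := by
    rw [← intervalIntegral.integral_ofReal]
    simp_rw [key]
    have hcont : ∀ n m : ℕ, Continuous fun t : ℝ => (c n * (starRingEnd ℂ) (c m))
          * cexp ((t * (Real.log m - Real.log n) : ℝ) * I) := by
      intro n m; fun_prop
    rw [intervalIntegral.integral_finsetSum]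
    · refine Finset.sum_congr rfl fun n hn => ?_
      rw [intervalIntegral.integral_finsetSum]
      · refine Finset.sum_congr rfl fun m hm => ?_
        rw [intervalIntegral.integral_const_mul]
      · exact fun m _ => (hcont n m).intervalIntegrable _ _
    · exact fun n _ => (continuous_finsetSum _ fun m _ => hcont n m).intervalIntegrable _ _
  set J : ℕ → ℕ → ℂ := fun n m => (c n * (starRingEnd ℂ) (c m))
          * ∫ t in a..b, cexp ((t * (Real.log m - Real.log n) : ℝ) * I) with hJ
  have hJd : ∀ n, J n n = (((b - a) * ‖c n‖ ^ 2 : ℝ) : ℂ) := by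
    intro n
    simp only [hJ, sub_self, mul_zero, ofReal_zero, zero_mul, Complex.exp_zero,
      intervalIntegral.integral_const, Complex.mul_conj']
    simp; ring
  have hJb : ∀ n m, 0 < m → m < n → ‖J n m‖ ≤ 2 * (‖c m‖ * ‖c n‖ * (n / ((n : ℝ) - m))) ∧
      ‖J m n‖ ≤ 2 * (‖c m‖ * ‖c n‖ * (n / ((n : ℝ) - m))) := by
    intro n m hm hmn
    have hlt : Real.log m < Real.log n := Real.log_lt_log (by exact_mod_cast hm)
      (by exact_mod_cast hmn)
    have hb := inv_log_sub_log_le hm hmn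
    have h1 := norm_integral_cexp_le (r := Real.log m - Real.log n) (by linarith) a b
    have h2 := norm_integral_cexp_le (r := Real.log n - Real.log m) (by linarith) a b
    rw [abs_of_neg (by linarith), neg_sub] at h1
    rw [abs_of_pos (by linarith)] at h2
    have h3 : 2 / (Real.log n - Real.log m) ≤ 2 * (n / ((n : ℝ) - m)) := by
      rw [show 2 / (Real.log n - Real.log m) = 2 * (1 / (Real.log n - Real.log m)) by ring]
      linarith
    simp only [hJ, norm_mul, RCLike.norm_conj]
    constructor
    · calc _ ≤ ‖c n‖ * ‖c m‖ * (2 * (n / ((n : ℝ) - m))) := by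
            gcongr; exact h1.trans h3
        _ = _ := by ring
    · calc _ ≤ ‖c m‖ * ‖c n‖ * (2 * (n / ((n : ℝ) - m))) := by
            gcongr; exact h2.trans h3
        _ = _ := by ring
  have hsplit : ∑ n ∈ S, ∑ m ∈ S, J n m = ∑ n ∈ S, J n n
      + ∑ n ∈ S, ∑ m ∈ S with m < n, (J n m + J m n) := by
    have h1 : ∀ n ∈ S, ∑ m ∈ S, J n m
        = J n n + (∑ m ∈ S with m < n, J n m + ∑ m ∈ S with n < m, J n m) := by
      intro n hn
      rw [Finset.sum_filter, Finset.sum_filter, ← Finset.sum_add_distrib,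
        ← Finset.sum_ite_eq_of_mem S n (fun m => J n m) hn, ← Finset.sum_add_distrib]
      refine Finset.sum_congr rfl fun m _ => ?_
      rcases lt_trichotomy m n with h | h | h
      · simp [h, h.not_gt, h.ne']
      · simp [h]
      · simp [h, h.not_gt, h.ne]
    rw [Finset.sum_congr rfl h1, Finset.sum_add_distrib, Finset.sum_add_distrib]
    congr 1
    simp_rw [Finset.sum_add_distrib]
    congr 1
    simp_rw [Finset.sum_filter]
    rw [Finset.sum_comm]
  have hfin : (((∫ t in a..b, ‖∑ n ∈ S, c n * (n : ℂ) ^ (-(t * I))‖ ^ 2)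
      - (b - a) * ∑ n ∈ S, ‖c n‖ ^ 2 : ℝ) : ℂ)
        = ∑ n ∈ S, ∑ m ∈ S with m < n, (J n m + J m n) := by
    rw [ofReal_sub, hInt, hsplit, Finset.mul_sum, ofReal_sum, Finset.sum_congr rfl fun n _ => hJd n]
    ring
  rw [← Real.norm_eq_abs, ← Complex.norm_real, hfin, Finset.mul_sum]
  refine (norm_sum_le _ _).trans (Finset.sum_le_sum fun n hn => ?_)
  rw [Finset.mul_sum]
  refine (norm_sum_le _ _).trans (Finset.sum_le_sum fun m hm => ?_)
  rw [Finset.mem_filter] at hm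
  obtain ⟨h1, h2⟩ := hJb n m (hS m hm.1) hm.2
  refine (norm_add_le _ _).trans ?_
  linarith

lemma rpow_neg_mul_rpow_neg_mul_div_le {m n : ℕ} (hm : 0 < m) (hmn : m < n) {β : ℝ} (hβ : 0 ≤ β)
    (hβ2 : β ≤ 2) :
    (m : ℝ) ^ (-β) * (n : ℝ) ^ (-β) * (n / ((n : ℝ) - m))
      ≤ 4 * ((n : ℝ) ^ (1 - 2 * β) / ((n : ℝ) - m)) + 2 * ((m : ℝ) ^ (-β) * (n : ℝ) ^ (-β)) := by
  have hm' : (0 : ℝ) < m := by exact_mod_cast hm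
  have hmn' : (0 : ℝ) < (n : ℝ) - m := by
    have : (m : ℝ) < n := by exact_mod_cast hmn
    linarith
  have hn' : (0 : ℝ) < n := by linarith
  rcases lt_or_ge n (2 * m) with h | h
  · have h1 : (m : ℝ) ^ (-β) ≤ 4 * (n : ℝ) ^ (-β) := by
      have h2 : (n / 2 : ℝ) ≤ m := by
        have : (n : ℝ) ≤ 2 * m := by exact_mod_cast h.le
        linarith
      calc (m : ℝ) ^ (-β) ≤ (n / 2 : ℝ) ^ (-β) :=
            Real.rpow_le_rpow_of_nonpos (by positivity) h2 (by linarith)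
        _ = (2 : ℝ) ^ β * (n : ℝ) ^ (-β) := by
            rw [Real.div_rpow hn'.le (by norm_num), Real.rpow_neg (by norm_num : (0 : ℝ) ≤ 2),
              div_inv_eq_mul, mul_comm]
        _ ≤ 4 * (n : ℝ) ^ (-β) := by
            gcongr
            calc (2 : ℝ) ^ β ≤ (2 : ℝ) ^ (2 : ℝ) :=
                  Real.rpow_le_rpow_of_exponent_le (by norm_num) hβ2
              _ = 4 := by norm_num
    have h3 : (n : ℝ) ^ (-β) * (n : ℝ) ^ (-β) * n = (n : ℝ) ^ (1 - 2 * β) := by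
      rw [← Real.rpow_add hn', ← Real.rpow_add_one hn'.ne']
      ring_nf
    calc (m : ℝ) ^ (-β) * (n : ℝ) ^ (-β) * (n / ((n : ℝ) - m))
        ≤ (4 * (n : ℝ) ^ (-β)) * (n : ℝ) ^ (-β) * (n / ((n : ℝ) - m)) := by gcongr
      _ = 4 * ((n : ℝ) ^ (-β) * (n : ℝ) ^ (-β) * n / ((n : ℝ) - m)) := by ring
      _ = 4 * ((n : ℝ) ^ (1 - 2 * β) / ((n : ℝ) - m)) := by rw [h3]
      _ ≤ _ := le_add_of_nonneg_right (by positivity)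
  · have h1 : n / ((n : ℝ) - m) ≤ 2 := by
      rw [div_le_iff₀ hmn']
      have : 2 * (m : ℝ) ≤ n := by exact_mod_cast h
      linarith
    calc (m : ℝ) ^ (-β) * (n : ℝ) ^ (-β) * (n / ((n : ℝ) - m))
        ≤ (m : ℝ) ^ (-β) * (n : ℝ) ^ (-β) * 2 := by gcongr
      _ = 2 * ((m : ℝ) ^ (-β) * (n : ℝ) ^ (-β)) := by ring
      _ ≤ _ := le_add_of_nonneg_left (by positivity)

/-- Off-diagonal terms with weights `n ^ (-β)`. -/
lemma sum_offDiag_le {N K : ℕ} {e : ℕ → ℝ} (he : ∀ n, 0 ≤ e n) {β : ℝ} (hβ : 0 ≤ β) (hβ2 : β ≤ 2) :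
    ∑ n ∈ Ioc N K, ∑ m ∈ Ioc N K with m < n,
        (e m * (m : ℝ) ^ (-β)) * (e n * (n : ℝ) ^ (-β)) * (n / ((n : ℝ) - m))
      ≤ 4 * (∑ n ∈ Ioc N K, (∑ m ∈ Ioo 0 n, e m * e n / ((n : ℝ) - m)) * (n : ℝ) ^ (1 - 2 * β))
        + 2 * (∑ n ∈ Ioc N K, e n * (n : ℝ) ^ (-β)) ^ 2 := by
  have h2 : (∑ n ∈ Ioc N K, e n * (n : ℝ) ^ (-β)) ^ 2
      = ∑ n ∈ Ioc N K, ∑ m ∈ Ioc N K, (e m * (m : ℝ) ^ (-β)) * (e n * (n : ℝ) ^ (-β)) := by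
    rw [sq, Finset.sum_mul_sum, Finset.sum_comm]
  rw [h2, Finset.mul_sum, Finset.mul_sum, ← Finset.sum_add_distrib]
  refine Finset.sum_le_sum fun n hn => ?_
  calc ∑ m ∈ Ioc N K with m < n, (e m * (m : ℝ) ^ (-β)) * (e n * (n : ℝ) ^ (-β))
          * (n / ((n : ℝ) - m))
      ≤ ∑ m ∈ Ioc N K with m < n, (4 * ((e m * e n / ((n : ℝ) - m)) * (n : ℝ) ^ (1 - 2 * β))
          + 2 * ((e m * (m : ℝ) ^ (-β)) * (e n * (n : ℝ) ^ (-β)))) := by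
        refine Finset.sum_le_sum fun m hm => ?_
        rw [Finset.mem_filter, Finset.mem_Ioc] at hm
        have h := rpow_neg_mul_rpow_neg_mul_div_le (by omega : 0 < m) hm.2 hβ hβ2
        have := mul_le_mul_of_nonneg_left h (mul_nonneg (he m) (he n))
        calc _ = e m * e n * ((m : ℝ) ^ (-β) * (n : ℝ) ^ (-β) * (n / ((n : ℝ) - m))) := by ring
          _ ≤ _ := this
          _ = _ := by ring
    _ = 4 * ((∑ m ∈ Ioc N K with m < n, e m * e n / ((n : ℝ) - m)) * (n : ℝ) ^ (1 - 2 * β))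
          + 2 * ∑ m ∈ Ioc N K with m < n, (e m * (m : ℝ) ^ (-β)) * (e n * (n : ℝ) ^ (-β)) := by
        rw [Finset.sum_add_distrib, Finset.sum_mul, Finset.mul_sum, Finset.mul_sum]
    _ ≤ _ := by
        gcongr ?_ + ?_
        · gcongr 4 * (?_ * _)
          refine Finset.sum_le_sum_of_subset_of_nonneg ?_ ?_
          · intro m hm
            rw [Finset.mem_filter, Finset.mem_Ioc] at hm
            rw [Finset.mem_Ioo]; omega
          · intro m hm _
            rw [Finset.mem_Ioo] at hm
            have : (m : ℝ) < n := by exact_mod_cast hm.2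
            exact div_nonneg (mul_nonneg (he m) (he n)) (by linarith)
        · gcongr 2 * ?_
          refine Finset.sum_le_sum_of_subset_of_nonneg (Finset.filter_subset _ _) ?_
          intro m _ _
          have := he m
          have := he n
          positivity

lemma norm_mul_ofReal_rpow (c : ℂ) (n : ℕ) (σ : ℝ) :
    ‖c * (((n : ℝ) ^ σ : ℝ) : ℂ)‖ = ‖c‖ * (n : ℝ) ^ σ := by
  rw [norm_mul, Complex.norm_real, Real.norm_of_nonneg (by positivity)]

lemma sum_pair_mono {K : ℕ} {e e' : ℕ → ℝ} (he : ∀ n, 0 ≤ e n) (h : ∀ n ∈ Ioc 0 K, e n ≤ e' n)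
    {σ : ℝ} {N : ℕ} :
    ∑ n ∈ Ioc N K, ∑ m ∈ Ioc N K with m < n,
        (e m * (m : ℝ) ^ σ) * (e n * (n : ℝ) ^ σ) * (n / ((n : ℝ) - m))
      ≤ ∑ n ∈ Ioc N K, ∑ m ∈ Ioc N K with m < n,
        (e' m * (m : ℝ) ^ σ) * (e' n * (n : ℝ) ^ σ) * (n / ((n : ℝ) - m)) := by
  refine Finset.sum_le_sum fun n hn => Finset.sum_le_sum fun m hm => ?_
  rw [Finset.mem_filter, Finset.mem_Ioc] at hm
  rw [Finset.mem_Ioc] at hn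
  have h1 := h n (Finset.mem_Ioc.2 ⟨by omega, hn.2⟩)
  have h2 := h m (Finset.mem_Ioc.2 ⟨by omega, hm.1.2⟩)
  have h3 := he n
  have h4 := he m
  have : (m : ℝ) < n := by exact_mod_cast hm.2
  have h5 : 0 ≤ n / ((n : ℝ) - m) := div_nonneg (by positivity) (by linarith)
  have h6 : 0 ≤ e' m := h4.trans h2
  have h7 : 0 ≤ e' n := h3.trans h1
  gcongr

/-- Mean value theorem on the critical line for coefficients bounded by the divisor function. -/
lemma exists_abs_integral_norm_sq_half_sub_le (C : ℝ) :
    ∃ C' : ℝ, 0 ≤ C' ∧ ∀ (K : ℕ) (c : ℕ → ℂ), (∀ n ∈ Ioc 0 K, ‖c n‖ ≤ C * divisorCount n) →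
      ∀ a b : ℝ,
      |(∫ t in a..b, ‖∑ n ∈ Ioc 0 K,
          (c n * (((n : ℝ) ^ (-(1 / 2) : ℝ) : ℝ) : ℂ)) * (n : ℂ) ^ (-(t * I))‖ ^ 2)
        - (b - a) * ∑ n ∈ Ioc 0 K, ‖c n‖ ^ 2 / n| ≤ C' * K * (1 + Real.log K) ^ 3 := by
  refine ⟨4 * (C ^ 2 * (4 * 8 + 2 * 4)), by positivity, fun K c hc a b => ?_⟩
  have h := abs_integral_norm_sq_dirichletPoly_sub_le (Ioc 0 K)
    (fun n hn => (Finset.mem_Ioc.1 hn).1) (fun n => c n * (((n : ℝ) ^ (-(1 / 2) : ℝ) : ℝ) : ℂ)) a b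
  simp only [norm_mul_ofReal_rpow] at h
  have hd : ∑ n ∈ Ioc 0 K, (‖c n‖ * (n : ℝ) ^ (-(1 / 2) : ℝ)) ^ 2
      = ∑ n ∈ Ioc 0 K, ‖c n‖ ^ 2 / n := by
    refine Finset.sum_congr rfl fun n _ => ?_
    have h2 : ((n : ℝ) ^ (-(1 / 2) : ℝ)) ^ 2 = (n : ℝ)⁻¹ := by
      rw [← Real.rpow_natCast, ← Real.rpow_mul (by positivity), ← Real.rpow_neg_one]; norm_num
    rw [mul_pow, h2, div_eq_mul_inv]
  rw [hd] at h
  refine h.trans ?_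
  have hL := one_le_one_add_log K
  have h1 := sum_pair_mono (σ := -(1 / 2)) (N := 0) (fun n => norm_nonneg (c n)) hc
  have h2 := sum_offDiag_le (N := 0) (K := K) (e := divisorCount) divisorCount_nonneg
    (β := 1 / 2) (by norm_num) (by norm_num)
  have h3 : ∑ n ∈ Ioc 0 K, (∑ m ∈ Ioo 0 n, divisorCount m * divisorCount n / ((n : ℝ) - m))
      * (n : ℝ) ^ (1 - 2 * (1 / 2 : ℝ)) ≤ 8 * K * (1 + Real.log K) ^ 3 := by
    norm_num
    exact sum_divisorCount_pair_le K
  have h4 : (∑ n ∈ Ioc 0 K, divisorCount n * (n : ℝ) ^ (-(1 / 2) : ℝ)) ^ 2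
      ≤ 4 * K * (1 + Real.log K) ^ 3 := by
    have h5 : ∑ n ∈ Ioc 0 K, divisorCount n * (n : ℝ) ^ (-(1 / 2) : ℝ)
        ≤ 2 * √(K : ℝ) * (1 + Real.log K) := by
      refine le_trans (le_of_eq ?_) (sum_divisorCount_div_sqrt_le K)
      refine Finset.sum_congr rfl fun n _ => ?_
      rw [Real.rpow_neg (by positivity), ← Real.sqrt_eq_rpow, div_eq_mul_inv]
    calc _ ≤ (2 * √(K : ℝ) * (1 + Real.log K)) ^ 2 := by
          gcongr
          exact Finset.sum_nonneg fun n _ => mul_nonneg (divisorCount_nonneg n) (by positivity)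
      _ = 4 * K * (1 + Real.log K) ^ 2 := by
          rw [mul_pow, mul_pow, Real.sq_sqrt (by positivity)]; norm_num
      _ ≤ _ := by gcongr; norm_num
  have h6 : ∑ n ∈ Ioc 0 K, ∑ m ∈ Ioc 0 K with m < n,
      (C * divisorCount m * (m : ℝ) ^ (-(1 / 2) : ℝ)) * (C * divisorCount n * (n : ℝ)
        ^ (-(1 / 2) : ℝ)) * (n / ((n : ℝ) - m))
      = C ^ 2 * ∑ n ∈ Ioc 0 K, ∑ m ∈ Ioc 0 K with m < n,
      (divisorCount m * (m : ℝ) ^ (-(1 / 2) : ℝ)) * (divisorCount n * (n : ℝ)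
        ^ (-(1 / 2) : ℝ)) * (n / ((n : ℝ) - m)) := by
    simp_rw [Finset.mul_sum]
    refine Finset.sum_congr rfl fun n _ => Finset.sum_congr rfl fun m _ => by ring
  rw [h6] at h1
  have h7 : C ^ 2 * ∑ n ∈ Ioc 0 K, ∑ m ∈ Ioc 0 K with m < n,
      (divisorCount m * (m : ℝ) ^ (-(1 / 2) : ℝ)) * (divisorCount n * (n : ℝ)
        ^ (-(1 / 2) : ℝ)) * (n / ((n : ℝ) - m))
      ≤ C ^ 2 * (4 * (8 * K * (1 + Real.log K) ^ 3) + 2 * (4 * K * (1 + Real.log K) ^ 3)) := by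
    gcongr
    linarith
  linarith

/-- Mean square of a Dirichlet polynomial on the line of real part `-1/2`. -/
lemma exists_integral_norm_sq_neg_half_le :
    ∃ C' : ℝ, 0 ≤ C' ∧ ∀ (K : ℕ) (c : ℕ → ℂ), (∀ n ∈ Ioc 0 K, ‖c n‖ ≤ divisorCount n) →
      ∀ a b : ℝ, a ≤ b →
      (∫ t in a..b, ‖∑ n ∈ Ioc 0 K,
          (c n * (((n : ℝ) ^ (1 / 2 : ℝ) : ℝ) : ℂ)) * (n : ℂ) ^ (-(t * I))‖ ^ 2)
        ≤ C' * ((b - a) + K) * (K : ℝ) ^ 2 * (1 + Real.log K) ^ 3 := by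
  refine ⟨1 + 4 * 8, by positivity, fun K c hc a b hab => ?_⟩
  have h := abs_integral_norm_sq_dirichletPoly_sub_le (Ioc 0 K)
    (fun n hn => (Finset.mem_Ioc.1 hn).1) (fun n => c n * (((n : ℝ) ^ (1 / 2 : ℝ) : ℝ) : ℂ)) a b
  simp only [norm_mul_ofReal_rpow] at h
  have hL := one_le_one_add_log K
  have hd : ∑ n ∈ Ioc 0 K, (‖c n‖ * (n : ℝ) ^ (1 / 2 : ℝ)) ^ 2
      ≤ K * (K * (1 + Real.log K) ^ 3) := by
    calc _ ≤ ∑ n ∈ Ioc 0 K, K * divisorCount n ^ 2 := by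
          refine Finset.sum_le_sum fun n hn => ?_
          rw [mul_pow, ← Real.sqrt_eq_rpow, Real.sq_sqrt (by positivity), mul_comm]
          have := hc n hn
          have h2 : (n : ℝ) ≤ K := by exact_mod_cast (Finset.mem_Ioc.1 hn).2
          gcongr
      _ = K * ∑ n ∈ Ioc 0 K, divisorCount n ^ 2 := by rw [Finset.mul_sum]
      _ ≤ _ := by gcongr; exact sum_divisorCount_sq_le K
  have h1 := sum_pair_mono (σ := 1 / 2) (N := 0) (fun n => norm_nonneg (c n)) hc
  have h2 : ∑ n ∈ Ioc 0 K, ∑ m ∈ Ioc 0 K with m < n,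
      (divisorCount m * (m : ℝ) ^ (1 / 2 : ℝ)) * (divisorCount n * (n : ℝ)
        ^ (1 / 2 : ℝ)) * (n / ((n : ℝ) - m))
      ≤ (K : ℝ) ^ 2 * ∑ n ∈ Ioc 0 K, ∑ m ∈ Ioo 0 n, divisorCount m * divisorCount n
        / ((n : ℝ) - m) := by
    simp_rw [Finset.mul_sum]
    refine Finset.sum_le_sum fun n hn => ?_
    have hset : ((Ioc 0 K).filter fun m => m < n) = Ioo 0 n := by
      ext m
      simp only [Finset.mem_filter, Finset.mem_Ioc, Finset.mem_Ioo] at hn ⊢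
      omega
    rw [hset]
    refine Finset.sum_le_sum fun m hm => ?_
    rw [Finset.mem_Ioo] at hm
    rw [Finset.mem_Ioc] at hn
    have hmn : (m : ℝ) < n := by exact_mod_cast hm.2
    have hnK : (n : ℝ) ≤ K := by exact_mod_cast hn.2
    have hw : (m : ℝ) ^ (1 / 2 : ℝ) * (n : ℝ) ^ (1 / 2 : ℝ) * n ≤ (K : ℝ) ^ 2 := by
      rw [← Real.sqrt_eq_rpow, ← Real.sqrt_eq_rpow]
      calc √(m : ℝ) * √(n : ℝ) * n ≤ √(K : ℝ) * √(K : ℝ) * K := by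
            have : (m : ℝ) ≤ K := by linarith
            gcongr
        _ = _ := by rw [Real.mul_self_sqrt (by positivity), sq]
    have h0 : 0 ≤ divisorCount m * divisorCount n / ((n : ℝ) - m) :=
      div_nonneg (mul_nonneg (divisorCount_nonneg _) (divisorCount_nonneg _)) (by linarith)
    calc _ = ((m : ℝ) ^ (1 / 2 : ℝ) * (n : ℝ) ^ (1 / 2 : ℝ) * n)
          * (divisorCount m * divisorCount n / ((n : ℝ) - m)) := by ring
      _ ≤ _ := mul_le_mul_of_nonneg_right hw h0
  have h3 := sum_divisorCount_pair_le K
  have h4 : (K : ℝ) ^ 2 * ∑ n ∈ Ioc 0 K, ∑ m ∈ Ioo 0 n, divisorCount m * divisorCount n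
        / ((n : ℝ) - m) ≤ (K : ℝ) ^ 2 * (8 * K * (1 + Real.log K) ^ 3) := by gcongr
  have h5 := (abs_le.1 h).2
  have h6 := mul_le_mul_of_nonneg_left hd (sub_nonneg.2 hab)
  have h7 : 0 ≤ (b - a) * (K ^ 2 * (1 + Real.log K) ^ 3) :=
    mul_nonneg (sub_nonneg.2 hab) (by positivity)
  have h8 : 0 ≤ (K : ℝ) * (K ^ 2 * (1 + Real.log K) ^ 3) := by positivity
  nlinarith

/-- Mean square of a tail of a Dirichlet series on the line of real part `3/2`. -/
lemma exists_integral_norm_sq_three_half_le :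
    ∃ C' : ℝ, 0 ≤ C' ∧ ∀ (N K : ℕ) (c : ℕ → ℂ), 1 ≤ N →
      (∀ n ∈ Ioc 0 K, ‖c n‖ ≤ divisorCount n) → ∀ a b : ℝ, a ≤ b →
      (∫ t in a..b, ‖∑ n ∈ Ioc N K,
          (c n * (((n : ℝ) ^ (-(3 / 2) : ℝ) : ℝ) : ℂ)) * (n : ℂ) ^ (-(t * I))‖ ^ 2)
        ≤ C' * ((b - a) + N) / (N : ℝ) ^ 2 * (1 + Real.log N) ^ 3 := by
  obtain ⟨C₁, hC₁, hT₁⟩ := exists_sum_Ioc_mul_rpow_le (e := divisorCount) divisorCount_nonneg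
    (C := 1) (j := 1) (fun N => by simpa using sum_divisorCount_le N) (α := 3 / 2) (by norm_num)
  obtain ⟨C₂, hC₂, hT₂⟩ := exists_sum_Ioc_mul_rpow_le (e := fun n => divisorCount n ^ 2)
    (fun n => by positivity)
    (C := 1) (j := 3) (fun N => by simpa using sum_divisorCount_sq_le N) (α := 2) (by norm_num)
  obtain ⟨C₃, hC₃, hT₃⟩ := exists_sum_Ioc_mul_rpow_le
    (e := fun n => ∑ m ∈ Ioo 0 n, divisorCount m * divisorCount n / ((n : ℝ) - m))
    (fun n => Finset.sum_nonneg fun m hm => by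
      rw [Finset.mem_Ioo] at hm
      have hmn : (m : ℝ) < n := by exact_mod_cast hm.2
      exact div_nonneg (mul_nonneg (divisorCount_nonneg _) (divisorCount_nonneg _)) (by linarith))
    (C := 8) (j := 3) sum_divisorCount_pair_le (α := 2) (by norm_num)
  refine ⟨C₂ + 4 * (4 * C₃ + 2 * C₁ ^ 2), by positivity, fun N K c hN hc a b hab => ?_⟩
  have h := abs_integral_norm_sq_dirichletPoly_sub_le (Ioc N K)
    (fun n hn => by have := (Finset.mem_Ioc.1 hn).1; omega)
    (fun n => c n * (((n : ℝ) ^ (-(3 / 2) : ℝ) : ℝ) : ℂ)) a b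
  simp only [norm_mul_ofReal_rpow] at h
  have hL := one_le_one_add_log N
  have hN0 : (0 : ℝ) < N := by exact_mod_cast hN
  have hd : ∑ n ∈ Ioc N K, (‖c n‖ * (n : ℝ) ^ (-(3 / 2) : ℝ)) ^ 2
      ≤ C₂ / (N : ℝ) ^ 2 * (1 + Real.log N) ^ 3 := by
    calc _ ≤ ∑ n ∈ Ioc N K, (N : ℝ)⁻¹ * (divisorCount n ^ 2 * (n : ℝ) ^ (-2 : ℝ)) := by
          refine Finset.sum_le_sum fun n hn => ?_
          rw [Finset.mem_Ioc] at hn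
          have hn0 : (0 : ℝ) < n := by
            have : 0 < n := by omega
            exact_mod_cast this
          have h1 := hc n (Finset.mem_Ioc.2 ⟨by omega, hn.2⟩)
          have h2 : ((n : ℝ) ^ (-(3 / 2) : ℝ)) ^ 2 = (n : ℝ)⁻¹ * (n : ℝ) ^ (-2 : ℝ) := by
            rw [← Real.rpow_natCast, ← Real.rpow_mul hn0.le, ← Real.rpow_neg_one,
              ← Real.rpow_add hn0]
            norm_num
          have h3 : (n : ℝ)⁻¹ ≤ (N : ℝ)⁻¹ := by
            have : (N : ℝ) ≤ n := by exact_mod_cast hn.1.le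
            gcongr
          calc (‖c n‖ * (n : ℝ) ^ (-(3 / 2) : ℝ)) ^ 2
              = ‖c n‖ ^ 2 * ((n : ℝ)⁻¹ * (n : ℝ) ^ (-2 : ℝ)) := by rw [mul_pow, h2]
            _ ≤ divisorCount n ^ 2 * ((N : ℝ)⁻¹ * (n : ℝ) ^ (-2 : ℝ)) := by gcongr
            _ = _ := by ring
      _ = (N : ℝ)⁻¹ * ∑ n ∈ Ioc N K, divisorCount n ^ 2 * (n : ℝ) ^ (-2 : ℝ) := by
          rw [Finset.mul_sum]
      _ ≤ (N : ℝ)⁻¹ * (C₂ * (N : ℝ) ^ (1 - 2 : ℝ) * (1 + Real.log N) ^ 3) := by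
          gcongr; exact hT₂ N K hN
      _ = _ := by
          norm_num [Real.rpow_neg_one]; field_simp
  have h1 := sum_pair_mono (σ := -(3 / 2)) (N := N) (fun n => norm_nonneg (c n)) hc
  have h2 := sum_offDiag_le (N := N) (K := K) (e := divisorCount) divisorCount_nonneg
    (β := 3 / 2) (by norm_num) (by norm_num)
  have h3 : ∑ n ∈ Ioc N K, (∑ m ∈ Ioo 0 n, divisorCount m * divisorCount n / ((n : ℝ) - m))
      * (n : ℝ) ^ (1 - 2 * (3 / 2 : ℝ)) ≤ C₃ * N / (N : ℝ) ^ 2 * (1 + Real.log N) ^ 3 := by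
    have := hT₃ N K hN
    rw [show (1 - 2 * (3 / 2 : ℝ)) = -2 by norm_num]
    refine this.trans (le_of_eq ?_)
    rw [show (1 - 2 : ℝ) = -1 by norm_num, Real.rpow_neg_one]; field_simp
  have h4 : (∑ n ∈ Ioc N K, divisorCount n * (n : ℝ) ^ (-(3 / 2) : ℝ)) ^ 2
      ≤ C₁ ^ 2 * N / (N : ℝ) ^ 2 * (1 + Real.log N) ^ 3 := by
    calc _ ≤ (C₁ * (N : ℝ) ^ (1 - 3 / 2 : ℝ) * (1 + Real.log N) ^ 1) ^ 2 := by
          refine pow_le_pow_left₀ ?_ (hT₁ N K hN) 2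
          exact Finset.sum_nonneg fun n _ => mul_nonneg (divisorCount_nonneg n) (by positivity)
      _ = C₁ ^ 2 * N / (N : ℝ) ^ 2 * (1 + Real.log N) ^ 2 := by
          have : ((N : ℝ) ^ (1 - 3 / 2 : ℝ)) ^ 2 = (N : ℝ)⁻¹ := by
            rw [← Real.rpow_natCast, ← Real.rpow_mul hN0.le, ← Real.rpow_neg_one]; norm_num
          rw [mul_pow, mul_pow, this]; field_simp
      _ ≤ _ := by gcongr; norm_num
  have h5 := (abs_le.1 h).2
  have h6 := mul_le_mul_of_nonneg_left hd (sub_nonneg.2 hab)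
  set X := 1 / (N : ℝ) ^ 2 * (1 + Real.log N) ^ 3 with hX
  have hX0 : 0 ≤ X := by positivity
  have e1 : C₂ / (N : ℝ) ^ 2 * (1 + Real.log N) ^ 3 = C₂ * X := by rw [hX]; ring
  have e2 : C₃ * N / (N : ℝ) ^ 2 * (1 + Real.log N) ^ 3 = C₃ * N * X := by rw [hX]; ring
  have e3 : C₁ ^ 2 * N / (N : ℝ) ^ 2 * (1 + Real.log N) ^ 3 = C₁ ^ 2 * N * X := by rw [hX]; ring
  have e4 : (C₂ + 4 * (4 * C₃ + 2 * C₁ ^ 2)) * ((b - a) + N) / (N : ℝ) ^ 2 * (1 + Real.log N) ^ 3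
    = (C₂ + 4 * (4 * C₃ + 2 * C₁ ^ 2)) * ((b - a) + N) * X := by rw [hX]; ring
  rw [e4]
  rw [e1] at h6
  rw [e2] at h3
  rw [e3] at h4
  have h7 : 0 ≤ (4 * (4 * C₃ + 2 * C₁ ^ 2)) * (b - a) * X :=
    mul_nonneg (mul_nonneg (by positivity) (sub_nonneg.2 hab)) hX0
  have h8 : 0 ≤ C₂ * N * X := by positivity
  linarith

/-! ### Sums over integers coprime to the modulus -/

/-- The arithmetic function `n ↦ 1 / n` restricted to integers coprime to `q`. -/
noncomputable def coprimeInv (q : ℕ) : ArithmeticFunction ℝ :=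
  ⟨fun n => if n.Coprime q then 1 / (n : ℝ) else 0, by simp⟩

lemma coprimeInv_apply (q n : ℕ) :
    coprimeInv q n = if n.Coprime q then 1 / (n : ℝ) else 0 := rfl

lemma coprimeInv_nonneg (q n : ℕ) : 0 ≤ coprimeInv q n := by
  rw [coprimeInv_apply]; split_ifs <;> positivity

lemma coprimeInv_le (q n : ℕ) : coprimeInv q n ≤ 1 / (n : ℝ) := by
  rw [coprimeInv_apply]; split_ifs
  · exact le_rfl
  · positivity

lemma coprimeInv_one (q : ℕ) : coprimeInv q 1 = 1 := by simp [coprimeInv_apply]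

lemma coprimeInv_mul (q m n : ℕ) : coprimeInv q (m * n) = coprimeInv q m * coprimeInv q n := by
  simp only [coprimeInv_apply, Nat.coprime_mul_iff_left]
  by_cases hm : m.Coprime q
  · by_cases hn : n.Coprime q
    · rw [if_pos ⟨hm, hn⟩, if_pos hm, if_pos hn]; push_cast; rw [one_div_mul_one_div]
    · rw [if_neg (fun h => hn h.2), if_neg hn, mul_zero]
  · rw [if_neg (fun h => hm h.1), if_neg hm, zero_mul]

lemma sum_divisors_moebius_eq (n : ℕ) :
    ∑ e ∈ n.divisors, (ArithmeticFunction.moebius e : ℝ) = if n = 1 then 1 else 0 := by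
  have h := congrArg (fun f : ArithmeticFunction ℤ => f n) ArithmeticFunction.moebius_mul_coe_zeta
  simp only [ArithmeticFunction.coe_mul_zeta_apply, ArithmeticFunction.one_apply] at h
  exact_mod_cast h

lemma coprimeInv_eq_sum (q : ℕ) [NeZero q] (n : ℕ) :
    coprimeInv q n = ∑ e ∈ q.divisors, if e ∣ n then (ArithmeticFunction.moebius e : ℝ) / n else 0 := by
  have hq := NeZero.ne q
  have hg : Nat.gcd n q ≠ 0 := fun h => hq (Nat.eq_zero_of_gcd_eq_zero_right h)
  have h := sum_divisors_moebius_eq (Nat.gcd n q)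
  have hset : (Nat.gcd n q).divisors = q.divisors.filter (· ∣ n) := by
    ext e
    simp only [Nat.mem_divisors, Finset.mem_filter, Nat.dvd_gcd_iff]
    tauto
  rw [hset, Finset.sum_filter] at h
  rw [coprimeInv_apply]
  calc _ = (if Nat.gcd n q = 1 then (1 : ℝ) else 0) / n := by
        by_cases hc : n.Coprime q
        · rw [if_pos hc, if_pos hc]
        · rw [if_neg hc, if_neg hc, zero_div]
    _ = _ := by
      rw [← h, Finset.sum_div]
      refine Finset.sum_congr rfl fun e _ => ?_
      split_ifs <;> simp

lemma sum_Ioc_dvd_inv {e N : ℕ} (he : 0 < e) :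
    ∑ n ∈ Ioc 0 N, (if e ∣ n then 1 / (n : ℝ) else 0)
      = 1 / (e : ℝ) * ∑ m ∈ Ioc 0 (N / e), 1 / (m : ℝ) := by
  rw [← Finset.sum_filter, Finset.mul_sum]
  refine Finset.sum_bij' (fun n _ => n / e) (fun m _ => e * m) ?_ ?_ ?_ ?_ ?_
  · intro n hn
    simp only [Finset.mem_filter, Finset.mem_Ioc] at hn ⊢
    obtain ⟨⟨h0, h1⟩, c, rfl⟩ := hn
    rw [Nat.mul_div_cancel_left _ he]
    exact ⟨Nat.pos_of_mul_pos_left h0, (Nat.le_div_iff_mul_le he).2 (by linarith)⟩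
  · intro m hm
    simp only [Finset.mem_filter, Finset.mem_Ioc] at hm ⊢
    have := (Nat.le_div_iff_mul_le he).1 hm.2
    exact ⟨⟨Nat.mul_pos he hm.1, by linarith⟩, dvd_mul_right _ _⟩
  · intro n hn
    simp only [Finset.mem_filter] at hn
    exact Nat.mul_div_cancel' hn.2
  · intro m _
    exact Nat.mul_div_cancel_left _ he
  · intro n hn
    simp only [Finset.mem_filter] at hn
    obtain ⟨-, c, rfl⟩ := hn
    rw [Nat.mul_div_cancel_left _ he]
    push_cast
    rw [one_div_mul_one_div]

lemma abs_sum_inv_natDiv_sub_log_le {e N : ℕ} (he : 0 < e) (hN : 0 < N) :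
    |∑ m ∈ Ioc 0 (N / e), 1 / (m : ℝ) - Real.log N| ≤ 1 + Real.log e := by
  have h1 := sum_inv_le_one_add_log (N / e)
  have h2 := log_natDiv_le N e
  have h3 : Real.log ((N / e + 1 : ℕ) : ℝ) ≤ ∑ m ∈ Ioc 0 (N / e), 1 / (m : ℝ) := by
    have h := log_add_one_le_harmonic (N / e)
    rw [harmonic_eq_sum_Icc] at h
    push_cast at h
    rw [show Ioc 0 (N / e) = Icc 1 (N / e) by ext; simp; omega]
    push_cast
    simpa [one_div] using h
  have he' : (0 : ℝ) < e := by exact_mod_cast he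
  have h4 : Real.log N - Real.log e ≤ Real.log ((N / e + 1 : ℕ) : ℝ) := by
    rw [← Real.log_div (by positivity) he'.ne']
    refine Real.log_le_log (by positivity) ?_
    rw [div_le_iff₀ he']
    have := Nat.lt_mul_div_succ N he
    have h : N ≤ (N / e + 1) * e := by linarith
    exact_mod_cast h
  have h5 : 0 ≤ Real.log e := Real.log_natCast_nonneg e
  rw [abs_le]
  constructor <;> linarith

lemma sum_moebius_div_eq (q : ℕ) [NeZero q] :
    ∑ e ∈ q.divisors, (ArithmeticFunction.moebius e : ℝ) / e = (q.totient : ℝ) / q := by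
  have hq : 0 < q := Nat.pos_of_ne_zero (NeZero.ne q)
  have h := (ArithmeticFunction.sum_eq_iff_sum_mul_moebius_eq (R := ℝ)
    (f := fun n => (n.totient : ℝ)) (g := fun n => (n : ℝ))).1
    (fun n _ => by exact_mod_cast Nat.sum_totient n) q hq
  rw [← h, Finset.sum_div, Nat.sum_divisorsAntidiagonal
    (f := fun a b => (ArithmeticFunction.moebius a : ℝ) * b / q)]
  refine Finset.sum_congr rfl fun e he => ?_
  obtain ⟨⟨c, rfl⟩, -⟩ := Nat.mem_divisors.1 he
  have he0 : 0 < e := Nat.pos_of_mul_pos_right hq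
  rw [Nat.mul_div_cancel_left _ he0]
  have : c ≠ 0 := by rintro rfl; simp at hq
  push_cast
  field_simp

/-- The sum of `1 / n` over `n ≤ N` coprime to `q` is `(φ(q)/q) log N + O(1)`. -/
lemma exists_abs_sum_coprimeInv_sub_le (q : ℕ) [NeZero q] :
    ∃ C : ℝ, 0 ≤ C ∧ ∀ N : ℕ, 0 < N →
      |∑ n ∈ Ioc 0 N, coprimeInv q n - (q.totient : ℝ) / q * Real.log N| ≤ C := by
  refine ⟨∑ e ∈ q.divisors, (1 + Real.log e), Finset.sum_nonneg fun e _ => by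
    have := Real.log_natCast_nonneg e; linarith, fun N hN => ?_⟩
  have h1 : ∑ n ∈ Ioc 0 N, coprimeInv q n = ∑ e ∈ q.divisors,
      (ArithmeticFunction.moebius e : ℝ) / e * ∑ m ∈ Ioc 0 (N / e), 1 / (m : ℝ) := by
    simp_rw [coprimeInv_eq_sum q]
    rw [Finset.sum_comm]
    refine Finset.sum_congr rfl fun e he => ?_
    have he0 : 0 < e := Nat.pos_of_mem_divisors he
    rw [div_eq_mul_one_div, mul_assoc, ← sum_Ioc_dvd_inv he0, Finset.mul_sum]
    refine Finset.sum_congr rfl fun n _ => ?_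
    split_ifs <;> ring
  rw [h1, ← sum_moebius_div_eq, Finset.sum_mul, ← Finset.sum_sub_distrib]
  refine (Finset.abs_sum_le_sum_abs _ _).trans (Finset.sum_le_sum fun e he => ?_)
  have he0 : 0 < e := Nat.pos_of_mem_divisors he
  rw [← mul_sub, abs_mul]
  have h2 := abs_sum_inv_natDiv_sub_log_le he0 hN
  have h3 : |(ArithmeticFunction.moebius e : ℝ) / e| ≤ 1 := by
    rw [abs_div, Nat.abs_cast, div_le_one (by exact_mod_cast he0)]
    have : |(ArithmeticFunction.moebius e : ℝ)| ≤ 1 := by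
      exact_mod_cast ArithmeticFunction.abs_moebius_le_one (n := e)
    have h4 : (1 : ℝ) ≤ e := by exact_mod_cast he0
    linarith
  calc _ ≤ 1 * (1 + Real.log e) := by gcongr
    _ = _ := one_mul _

lemma pow_succ_sub_pow_succ_bounds {A B : ℝ} (hB : 0 ≤ B) (hAB : B ≤ A) (k : ℕ) :
    (A - B) * B ^ k ≤ (A ^ (k + 1) - B ^ (k + 1)) / (k + 1) ∧
      (A ^ (k + 1) - B ^ (k + 1)) / (k + 1) ≤ (A - B) * A ^ k := by
  have hk : (0 : ℝ) < (k : ℝ) + 1 := by positivity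
  have h := (Commute.all A B).mul_geom_sum₂ (k + 1)
  simp only [Nat.add_sub_cancel] at h
  rw [← h]
  have h0 : 0 ≤ A - B := sub_nonneg.2 hAB
  have hterm : ∀ i ∈ Finset.range (k + 1), B ^ k ≤ A ^ i * B ^ (k - i) ∧
      A ^ i * B ^ (k - i) ≤ A ^ k := by
    intro i hi
    rw [Finset.mem_range] at hi
    have hki : k = i + (k - i) := by omega
    constructor
    · calc B ^ k = B ^ i * B ^ (k - i) := by rw [← pow_add, ← hki]
        _ ≤ _ := by gcongr
    · calc A ^ i * B ^ (k - i) ≤ A ^ i * A ^ (k - i) := by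
            have := hB.trans hAB
            gcongr
        _ = A ^ k := by rw [← pow_add, ← hki]
  have hlow := Finset.card_nsmul_le_sum _ _ _ fun i hi => (hterm i hi).1
  have hupp := Finset.sum_le_card_nsmul _ _ _ fun i hi => (hterm i hi).2
  rw [Finset.card_range, nsmul_eq_mul] at hlow hupp
  push_cast at hlow hupp
  constructor
  · rw [le_div_iff₀ hk]
    calc (A - B) * B ^ k * (k + 1) = (A - B) * ((k + 1) * B ^ k) := by ring
      _ ≤ _ := by gcongr
  · rw [div_le_iff₀ hk]
    calc _ ≤ (A - B) * ((k + 1) * A ^ k) := by gcongr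
      _ = _ := by ring

/-- Partial summation against powers of `log (x / n)`. -/
lemma abs_sum_mul_log_pow_sub_le {u : ℕ → ℝ} {κ C : ℝ} (hκ : 0 ≤ κ) (hC : 0 ≤ C)
    (hu : ∀ N : ℕ, 0 < N → |∑ n ∈ Ioc 0 N, u n - κ * Real.log N| ≤ C) (k : ℕ) {x : ℝ}
    (hx : 1 ≤ x) :
    |∑ n ∈ Ioc 0 ⌊x⌋₊, u n * Real.log (x / n) ^ k - κ * Real.log x ^ (k + 1) / (k + 1)|
      ≤ (2 * C + 2 * κ) * (1 + Real.log x) ^ k := by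
  have hx0 : 0 < x := by linarith
  set G : ℕ → ℝ := fun n => Real.log (x / n) with hG
  set D : ℕ → ℝ := fun N => ∑ n ∈ Ioc 0 N, u n - κ * Real.log N with hD
  have hGs : ∀ n : ℕ, 0 < n → G n = Real.log x - Real.log n := fun n hn =>
    Real.log_div hx0.ne' (by positivity)
  have hGnn : ∀ n : ℕ, 0 < n → n ≤ ⌊x⌋₊ → 0 ≤ G n := by
    intro n hn hnx
    have h1 : (n : ℝ) ≤ x := (Nat.le_floor_iff hx0.le).1 hnx
    have h2 : (0 : ℝ) < n := by exact_mod_cast hn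
    exact Real.log_nonneg ((one_le_div h2).2 h1)
  have main : ∀ N : ℕ, 1 ≤ N → N ≤ ⌊x⌋₊ →
      |∑ n ∈ Ioc 0 N, u n * G n ^ k - D N * G N ^ k
        - κ * (G 1 ^ (k + 1) - G N ^ (k + 1)) / (k + 1)| ≤ (C + κ) * (G 1 ^ k - G N ^ k) := by
    intro N hN
    induction N, hN using Nat.le_induction with
    | base => intro _; simp [hD]
    | succ N hN ih =>
      intro hNx
      have ih' := ih (by omega)
      set A := G N with hA
      set B := G (N + 1) with hB
      have hB0 : 0 ≤ B := hGnn _ (by omega) hNx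
      have hlog : Real.log ((N + 1 : ℕ) : ℝ) - Real.log N = A - B := by
        rw [hA, hB, hGs _ (by omega), hGs _ (by omega)]; ring
      have hABnn : B ≤ A := by
        have : Real.log N ≤ Real.log ((N + 1 : ℕ) : ℝ) :=
          Real.log_le_log (by exact_mod_cast hN) (by push_cast; linarith)
        linarith
      have hAB1 : A - B ≤ 1 := by
        have hN0 : (0 : ℝ) < N := by exact_mod_cast hN
        rw [← hlog, ← Real.log_div (by positivity) hN0.ne']
        have h1 := Real.log_le_sub_one_of_pos (show 0 < ((N + 1 : ℕ) : ℝ) / N by positivity)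
        have h2 : ((N + 1 : ℕ) : ℝ) / N - 1 = 1 / N := by push_cast; field_simp; ring
        have h3 : (1 : ℝ) / N ≤ 1 := by
          rw [div_le_one hN0]; exact_mod_cast hN
        linarith
      have hpow : B ^ k ≤ A ^ k := pow_le_pow_left₀ hB0 hABnn k
      obtain ⟨hb1, hb2⟩ := pow_succ_sub_pow_succ_bounds hB0 hABnn k
      have hDN : D (N + 1) = D N + u (N + 1) - κ * (A - B) := by
        simp only [hD]
        rw [Finset.sum_Ioc_succ_top (Nat.zero_le N), ← hlog]; ring
      have hdn : |D N| ≤ C := hu N (by omega)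
      rw [Finset.sum_Ioc_succ_top (Nat.zero_le N)]
      have e : ∑ n ∈ Ioc 0 N, u n * G n ^ k + u (N + 1) * B ^ k - D (N + 1) * B ^ k
          - κ * (G 1 ^ (k + 1) - B ^ (k + 1)) / (k + 1)
          = (∑ n ∈ Ioc 0 N, u n * G n ^ k - D N * A ^ k
            - κ * (G 1 ^ (k + 1) - A ^ (k + 1)) / (k + 1)) + (D N * (A ^ k - B ^ k)
            + κ * ((A - B) * B ^ k - (A ^ (k + 1) - B ^ (k + 1)) / (k + 1))) := by
        rw [hDN]; ring
      rw [e]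
      have e1 : |D N * (A ^ k - B ^ k)| ≤ C * (A ^ k - B ^ k) := by
        rw [abs_mul, abs_of_nonneg (sub_nonneg.2 hpow)]
        exact mul_le_mul_of_nonneg_right hdn (sub_nonneg.2 hpow)
      have e2 : |κ * ((A - B) * B ^ k - (A ^ (k + 1) - B ^ (k + 1)) / (k + 1))|
          ≤ κ * (A ^ k - B ^ k) := by
        rw [abs_mul, abs_of_nonneg hκ, abs_sub_comm, abs_of_nonneg (by linarith)]
        have : (A - B) * (A ^ k - B ^ k) ≤ 1 * (A ^ k - B ^ k) := by
          have := sub_nonneg.2 hpow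
          gcongr
        refine mul_le_mul_of_nonneg_left ?_ hκ
        linarith
      refine (abs_add_le _ _).trans ?_
      have e3 := abs_add_le (D N * (A ^ k - B ^ k))
        (κ * ((A - B) * B ^ k - (A ^ (k + 1) - B ^ (k + 1)) / (k + 1)))
      linarith
  have hfl : 1 ≤ ⌊x⌋₊ := Nat.floor_pos.2 hx
  have h := main ⌊x⌋₊ hfl le_rfl
  have hG1 : G 1 = Real.log x := by simp [hG]
  rw [hG1] at h
  set N := ⌊x⌋₊
  have hlx : 0 ≤ Real.log x := Real.log_nonneg hx
  have hGN0 : 0 ≤ G N := hGnn N hfl le_rfl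
  have hGN1 : G N ≤ 1 := by
    have hN0 : (0 : ℝ) < N := by exact_mod_cast hfl
    have h1 := Real.log_le_sub_one_of_pos (div_pos hx0 hN0)
    have h2 : x / N ≤ 2 := by
      rw [div_le_iff₀ hN0]
      have := Nat.lt_floor_add_one x
      have : (1 : ℝ) ≤ N := by exact_mod_cast hfl
      linarith
    simp only [hG]; linarith
  have hGNx : G N ≤ Real.log x := by
    rw [hGs N (by omega)]
    linarith [Real.log_natCast_nonneg N]
  have hone : 1 ≤ (1 + Real.log x) ^ k := one_le_pow₀ (by linarith)
  have hlk : Real.log x ^ k ≤ (1 + Real.log x) ^ k := by gcongr; linarith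
  have hgk : G N ^ k ≤ (1 + Real.log x) ^ k := by gcongr; linarith
  have hgk1 : G N ^ (k + 1) / (k + 1) ≤ 1 := by
    rw [div_le_one (by positivity)]
    exact (pow_le_one₀ hGN0 hGN1).trans (by linarith [(Nat.cast_nonneg k : (0 : ℝ) ≤ k)])
  have hgk2 : 0 ≤ G N ^ (k + 1) / (k + 1) := by positivity
  have hgk3 : 0 ≤ G N ^ k := by positivity
  have t1 : |D N * G N ^ k| ≤ C * (1 + Real.log x) ^ k := by
    rw [abs_mul, abs_of_nonneg hgk3]
    exact mul_le_mul (hu N (by omega)) hgk hgk3 hC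
  have t2 : (C + κ) * (Real.log x ^ k - G N ^ k) ≤ (C + κ) * (1 + Real.log x) ^ k := by
    gcongr; linarith
  have t3 : κ * (G N ^ (k + 1) / (k + 1)) ≤ κ * (1 + Real.log x) ^ k := by
    gcongr; linarith
  have t4 : 0 ≤ κ * (G N ^ (k + 1) / (k + 1)) := by positivity
  have e : κ * (Real.log x ^ (k + 1) - G N ^ (k + 1)) / (k + 1)
      = κ * Real.log x ^ (k + 1) / (k + 1) - κ * (G N ^ (k + 1) / (k + 1)) := by ring
  rw [e] at h
  rw [abs_le] at h t1 ⊢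
  constructor <;> linarith [h.1, h.2, t1.1, t1.2]

/-- Iterated Dirichlet convolutions of `coprimeInv q` with itself have summatory functions which
grow like powers of the logarithm. -/
lemma exists_abs_sum_coprimeInv_pow_sub_le (q : ℕ) [NeZero q] (k : ℕ) :
    ∃ C : ℝ, 0 ≤ C ∧ ∀ x : ℝ, 1 ≤ x →
      |∑ n ∈ Ioc 0 ⌊x⌋₊, (coprimeInv q ^ (k + 1)) n
          - ((q.totient : ℝ) / q) ^ (k + 1) * Real.log x ^ (k + 1) / (k + 1).factorial|
        ≤ C * (1 + Real.log x) ^ k := by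
  obtain ⟨C₀, hC₀, hu⟩ := exists_abs_sum_coprimeInv_sub_le q
  set κ : ℝ := (q.totient : ℝ) / q with hκ
  have hκ0 : 0 ≤ κ := by positivity
  induction k with
  | zero =>
    refine ⟨2 * C₀ + 2 * κ, by positivity, fun x hx => ?_⟩
    have := abs_sum_mul_log_pow_sub_le hκ0 hC₀ hu 0 hx
    simpa using this
  | succ k ih =>
    obtain ⟨C, hC, h⟩ := ih
    refine ⟨C * 1 + κ ^ (k + 1) / (k + 1).factorial * (2 * C₀ + 2 * κ), by positivity,
      fun x hx => ?_⟩
    have hx0 : 0 < x := by linarith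
    have hlx : 0 ≤ Real.log x := Real.log_nonneg hx
    set F : ℝ := ((k + 1).factorial : ℝ) with hF
    have hF0 : 0 < F := by positivity
    have hrec : ∑ n ∈ Ioc 0 ⌊x⌋₊, (coprimeInv q ^ (k + 1 + 1)) n
        = ∑ n ∈ Ioc 0 ⌊x⌋₊, coprimeInv q n
          * ∑ m ∈ Ioc 0 ⌊x / n⌋₊, (coprimeInv q ^ (k + 1)) m := by
      rw [pow_succ', ArithmeticFunction.sum_Ioc_mul_eq_sum_sum]
      simp_rw [Nat.floor_div_natCast]
    have hA := abs_sum_mul_log_pow_sub_le hκ0 hC₀ hu (k + 1) hx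
    have hB : |∑ n ∈ Ioc 0 ⌊x⌋₊, coprimeInv q n
          * (∑ m ∈ Ioc 0 ⌊x / n⌋₊, (coprimeInv q ^ (k + 1)) m
            - κ ^ (k + 1) * Real.log (x / n) ^ (k + 1) / F)|
        ≤ C * (1 + Real.log x) ^ (k + 1) := by
      calc _ ≤ ∑ n ∈ Ioc 0 ⌊x⌋₊, 1 / (n : ℝ) * (C * (1 + Real.log x) ^ k) := by
            refine (Finset.abs_sum_le_sum_abs _ _).trans (Finset.sum_le_sum fun n hn => ?_)
            rw [Finset.mem_Ioc] at hn
            have hn0 : (0 : ℝ) < n := by exact_mod_cast hn.1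
            have hnx : (n : ℝ) ≤ x := (Nat.le_floor_iff hx0.le).1 hn.2
            have h1 : 1 ≤ x / n := (one_le_div hn0).2 hnx
            rw [abs_mul, abs_of_nonneg (coprimeInv_nonneg q n)]
            refine mul_le_mul (coprimeInv_le q n) ((h (x / n) h1).trans ?_) (abs_nonneg _)
              (by positivity)
            have h2 : Real.log (x / n) ≤ Real.log x := by
              rw [Real.log_div hx0.ne' hn0.ne']
              linarith [Real.log_natCast_nonneg n]
            have h3 : 0 ≤ Real.log (x / n) := Real.log_nonneg h1
            gcongr
        _ = (∑ n ∈ Ioc 0 ⌊x⌋₊, 1 / (n : ℝ)) * (C * (1 + Real.log x) ^ k) := by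
            rw [Finset.sum_mul]
        _ ≤ (1 + Real.log x) * (C * (1 + Real.log x) ^ k) := by
            gcongr
            refine (sum_inv_le_one_add_log _).trans ?_
            have := Nat.floor_le hx0.le
            have h1 : (0 : ℝ) < (⌊x⌋₊ : ℝ) := by exact_mod_cast Nat.floor_pos.2 hx
            have := Real.log_le_log h1 this
            linarith
        _ = _ := by ring
    have e : ∑ n ∈ Ioc 0 ⌊x⌋₊, (coprimeInv q ^ (k + 1 + 1)) n
        - κ ^ (k + 1 + 1) * Real.log x ^ (k + 1 + 1) / (k + 1 + 1).factorial
        = (∑ n ∈ Ioc 0 ⌊x⌋₊, coprimeInv q n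
          * (∑ m ∈ Ioc 0 ⌊x / n⌋₊, (coprimeInv q ^ (k + 1)) m
            - κ ^ (k + 1) * Real.log (x / n) ^ (k + 1) / F))
          + κ ^ (k + 1) / F * (∑ n ∈ Ioc 0 ⌊x⌋₊, coprimeInv q n * Real.log (x / n) ^ (k + 1)
            - κ * Real.log x ^ (k + 1 + 1) / ((k + 1 : ℕ) + 1)) := by
      rw [hrec, mul_sub, Finset.mul_sum, ← add_sub_assoc, ← Finset.sum_add_distrib]
      congr 1
      · refine Finset.sum_congr rfl fun n _ => ?_
        ring
      · rw [Nat.factorial_succ (k + 1)]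
        push_cast
        rw [← hF]
        field_simp
        ring
    rw [e]
    refine (abs_add_le _ _).trans ?_
    rw [abs_mul, abs_of_nonneg (by positivity : 0 ≤ κ ^ (k + 1) / F), add_mul, mul_one]
    refine add_le_add hB ?_
    rw [mul_assoc]
    exact mul_le_mul_of_nonneg_left hA (by positivity)

lemma arithmeticFunction_mul_apply_prime_pow (f g : ArithmeticFunction ℝ) {p : ℕ} (hp : p.Prime)
    (k : ℕ) : (f * g) (p ^ k) = ∑ i ∈ Finset.range (k + 1), f (p ^ i) * g (p ^ (k - i)) := by
  rw [ArithmeticFunction.mul_apply, Nat.sum_divisorsAntidiagonal (f := fun a b => f a * g b),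
    Nat.divisors_prime_pow hp, Finset.sum_map]
  refine Finset.sum_congr rfl fun i hi => ?_
  rw [Finset.mem_range] at hi
  simp only [Function.Embedding.coeFn_mk]
  rw [Nat.pow_div (by omega) hp.pos]

lemma coprimeInv_pow (q n k : ℕ) : coprimeInv q (n ^ k) = coprimeInv q n ^ k := by
  induction k with
  | zero => simp [coprimeInv_one]
  | succ k ih => rw [pow_succ, coprimeInv_mul, ih, pow_succ]

lemma mul_coprimeInv_apply_prime_pow {q : ℕ} {f : ArithmeticFunction ℝ} {p : ℕ} (hp : p.Prime)
    {F G : ℕ → ℝ} (hf : ∀ k, f (p ^ k) = F k * coprimeInv q p ^ k) (h0 : F 0 = G 0)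
    (hs : ∀ k, G (k + 1) = G k + F (k + 1)) (k : ℕ) :
    (f * coprimeInv q) (p ^ k) = G k * coprimeInv q p ^ k := by
  rw [arithmeticFunction_mul_apply_prime_pow f _ hp]
  have hG : ∀ k, ∑ i ∈ Finset.range (k + 1), F i = G k := by
    intro k
    induction k with
    | zero => simpa using h0
    | succ k ih => rw [Finset.sum_range_succ, ih, hs]
  rw [← hG, Finset.sum_mul]
  refine Finset.sum_congr rfl fun i hi => ?_
  rw [Finset.mem_range] at hi
  rw [hf, coprimeInv_pow, mul_assoc, ← pow_add]
  congr 2; omega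

lemma coprimeInv_pow_four_apply_prime_pow (q : ℕ) {p : ℕ} (hp : p.Prime) (k : ℕ) :
    (coprimeInv q ^ 4) (p ^ k)
      = ((k : ℝ) + 1) * (k + 2) * (k + 3) / 6 * coprimeInv q p ^ k := by
  have h1 : ∀ k, coprimeInv q (p ^ k) = (fun _ => (1 : ℝ)) k * coprimeInv q p ^ k := by
    intro k; rw [coprimeInv_pow, one_mul]
  have h2 := mul_coprimeInv_apply_prime_pow (q := q) hp h1 (G := fun k => (k : ℝ) + 1)
    (by simp) (fun k => by push_cast; ring)
  have h3 := mul_coprimeInv_apply_prime_pow (q := q) hp h2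
    (G := fun k => ((k : ℝ) + 1) * (k + 2) / 2) (by norm_num) (fun k => by push_cast; ring)
  have h4 := mul_coprimeInv_apply_prime_pow (q := q) hp h3
    (G := fun k => ((k : ℝ) + 1) * (k + 2) * (k + 3) / 6) (by norm_num)
    (fun k => by push_cast; ring)
  rw [← h4 k]
  congr 1
  ring

lemma isMultiplicative_coprimeInv (q : ℕ) : (coprimeInv q).IsMultiplicative :=
  ⟨coprimeInv_one q, fun _ => coprimeInv_mul q _ _⟩

/-- The function supported on squares `e ^ 2` coprime to `q`, with value `μ(e) / e ^ 2`. -/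
noncomputable def sqMoebius (q : ℕ) : ArithmeticFunction ℝ :=
  ⟨fun n => if IsSquare n then (ArithmeticFunction.moebius (Nat.sqrt n) : ℝ) * coprimeInv q n else 0,
    by simp⟩

lemma sqMoebius_sq (q e : ℕ) :
    sqMoebius q (e ^ 2) = (ArithmeticFunction.moebius e : ℝ) * coprimeInv q (e ^ 2) := by
  change (if IsSquare (e ^ 2) then _ else _) = _
  rw [if_pos (IsSquare.sq e), Nat.sqrt_eq']

lemma sqMoebius_of_not_isSquare (q : ℕ) {n : ℕ} (h : ¬ IsSquare n) : sqMoebius q n = 0 :=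
  if_neg h

lemma isMultiplicative_sqMoebius (q : ℕ) : (sqMoebius q).IsMultiplicative := by
  refine ⟨?_, ?_⟩
  · have := sqMoebius_sq q 1
    simpa [coprimeInv_one] using this
  intro m n hmn
  by_cases hm : IsSquare m
  · by_cases hn : IsSquare n
    · obtain ⟨a, rfl⟩ := hm
      obtain ⟨b, rfl⟩ := hn
      have hab : Nat.Coprime a b := (Nat.Coprime.coprime_mul_left hmn).coprime_mul_left_right
      rw [← sq, ← sq, ← mul_pow, sqMoebius_sq, sqMoebius_sq, sqMoebius_sq, mul_pow, coprimeInv_mul,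
        ArithmeticFunction.isMultiplicative_moebius.map_mul_of_coprime hab]
      push_cast; ring
    · rw [sqMoebius_of_not_isSquare q hn, mul_zero, sqMoebius_of_not_isSquare]
      rintro ⟨c, hc⟩
      obtain ⟨d, hd⟩ := exists_eq_pow_of_mul_eq_pow (a := n) (b := m) (c := c) (k := 2)
        (by rw [gcd_comm]; exact Nat.isUnit_iff.2 hmn) (by rw [mul_comm, hc, sq])
      exact hn ⟨d, by rw [hd, sq]⟩
  · rw [sqMoebius_of_not_isSquare q hm, zero_mul, sqMoebius_of_not_isSquare]
    rintro ⟨c, hc⟩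
    obtain ⟨d, hd⟩ := exists_eq_pow_of_mul_eq_pow (a := m) (b := n) (c := c) (k := 2)
      (Nat.isUnit_iff.2 hmn) (by rw [hc, sq])
    exact hm ⟨d, by rw [hd, sq]⟩

lemma sqMoebius_prime_pow (q : ℕ) {p : ℕ} (hp : p.Prime) {i : ℕ} (h0 : i ≠ 0) (h2 : i ≠ 2) :
    sqMoebius q (p ^ i) = 0 := by
  rcases Nat.even_or_odd' i with ⟨j, rfl | rfl⟩
  · rw [mul_comm, pow_mul, sqMoebius_sq, ArithmeticFunction.moebius_apply_prime_pow hp (by omega),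
      if_neg (by omega)]
    simp
  · refine sqMoebius_of_not_isSquare q ?_
    rintro ⟨c, hc⟩
    have h := congrArg (fun n => n.factorization p) hc
    simp only [hp.factorization_pow, Finsupp.single_eq_same] at h
    have hc0 : c ≠ 0 := by
      rintro rfl
      rw [mul_zero] at hc
      exact pow_ne_zero _ hp.ne_zero hc
    rw [Nat.factorization_mul hc0 hc0, Finsupp.add_apply] at h
    omega

/-- The arithmetic function `n ↦ d(n) ^ 2 / n` restricted to integers coprime to `q`. -/
noncomputable def divisorSqCoprime (q : ℕ) : ArithmeticFunction ℝ :=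
  ⟨fun n => coprimeInv q n * divisorCount n ^ 2, by simp⟩

lemma divisorSqCoprime_apply (q n : ℕ) :
    divisorSqCoprime q n = coprimeInv q n * divisorCount n ^ 2 := rfl

lemma divisorSqCoprime_eq (q : ℕ) : divisorSqCoprime q = sqMoebius q * coprimeInv q ^ 4 := by
  have hU := isMultiplicative_coprimeInv q
  have hU4 : (coprimeInv q ^ 4).IsMultiplicative := by
    rw [show coprimeInv q ^ 4 = (coprimeInv q * coprimeInv q) * (coprimeInv q * coprimeInv q) by
      ring]
    exact (hU.mul hU).mul (hU.mul hU)
  have hV : (divisorSqCoprime q).IsMultiplicative := by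
    refine ⟨by simp [divisorSqCoprime_apply, coprimeInv_one, divisorCount], fun {m n} hmn => ?_⟩
    simp only [divisorSqCoprime_apply, coprimeInv_mul, divisorCount, hmn.card_divisors_mul]
    push_cast; ring
  rw [hV.eq_iff_eq_on_prime_powers _ _ ((isMultiplicative_sqMoebius q).mul hU4)]
  intro p k hp
  rw [arithmeticFunction_mul_apply_prime_pow _ _ hp, divisorSqCoprime_apply, coprimeInv_pow]
  have hd : divisorCount (p ^ k) = (k : ℝ) + 1 := by
    rw [divisorCount, Nat.divisors_prime_pow hp, Finset.card_map, Finset.card_range]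
    push_cast; rfl
  have hs0 : sqMoebius q (p ^ 0) = 1 := by
    have := sqMoebius_sq q 1
    simpa [coprimeInv_one] using this
  have hs2 : sqMoebius q (p ^ 2) = - coprimeInv q p ^ 2 := by
    rw [sqMoebius_sq, ArithmeticFunction.moebius_apply_prime hp, coprimeInv_pow]
    push_cast; ring
  rw [hd]
  match k with
  | 0 =>
    rw [Finset.sum_range_one, hs0, Nat.sub_zero, pow_zero p, hU4.1]
    norm_num
  | 1 =>
    rw [Finset.sum_range_succ, Finset.sum_range_one, sqMoebius_prime_pow q hp one_ne_zero (by norm_num),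
      hs0, coprimeInv_pow_four_apply_prime_pow q hp]
    norm_num
    ring
  | m + 2 =>
    have hsub : ({0, 2} : Finset ℕ) ⊆ Finset.range (m + 2 + 1) := by
      intro i hi
      simp only [Finset.mem_insert, Finset.mem_singleton] at hi
      rw [Finset.mem_range]; omega
    rw [← Finset.sum_subset hsub, Finset.sum_pair (by norm_num)]
    · rw [hs0, hs2, coprimeInv_pow_four_apply_prime_pow q hp,
        coprimeInv_pow_four_apply_prime_pow q hp]
      simp only [Nat.sub_zero, Nat.add_sub_cancel]
      push_cast
      ring
    · intro i _ hi
      simp only [Finset.mem_insert, Finset.mem_singleton, not_or] at hi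
      rw [sqMoebius_prime_pow q hp hi.1 hi.2, zero_mul]

lemma injective_sq_nat : Function.Injective (fun e : ℕ => e ^ 2) := fun a b h => by
  simpa using h

lemma sqMoebius_eq_zero_of_notMem_range (q : ℕ) {n : ℕ} (h : n ∉ Set.range (fun e : ℕ => e ^ 2)) :
    sqMoebius q n = 0 := by
  refine sqMoebius_of_not_isSquare q ?_
  rintro ⟨c, rfl⟩
  exact h ⟨c, sq c⟩

lemma abs_moebius_cast_le (e : ℕ) : |(ArithmeticFunction.moebius e : ℝ)| ≤ 1 := by
  exact_mod_cast ArithmeticFunction.abs_moebius_le_one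

lemma abs_sqMoebius_sq_le (q e : ℕ) : |sqMoebius q (e ^ 2)| ≤ 1 / (e : ℝ) ^ 2 := by
  rw [sqMoebius_sq, abs_mul, abs_of_nonneg (coprimeInv_nonneg _ _)]
  calc _ ≤ 1 * (1 / ((e ^ 2 : ℕ) : ℝ)) :=
        mul_le_mul (abs_moebius_cast_le e) (coprimeInv_le _ _) (coprimeInv_nonneg _ _) zero_le_one
    _ = _ := by push_cast; ring

lemma summable_abs_sqMoebius_mul_log (q : ℕ) :
    Summable fun m : ℕ => |sqMoebius q m| * (1 + Real.log m) := by
  rw [← injective_sq_nat.summable_iff fun n hn => by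
    rw [sqMoebius_eq_zero_of_notMem_range q hn]; simp]
  refine Summable.of_nonneg_of_le (g := fun e : ℕ => |sqMoebius q (e ^ 2)| * (1 + Real.log ((e ^ 2 : ℕ) : ℝ)))
    (fun e => mul_nonneg (abs_nonneg _) (by have := Real.log_natCast_nonneg (e ^ 2); linarith))
    (f := fun e : ℕ => 5 * (1 / (e : ℝ) ^ (3 / 2 : ℝ))) (fun e => ?_)
    ((Real.summable_one_div_nat_rpow.2 (by norm_num)).mul_left 5)
  rcases Nat.eq_zero_or_pos e with rfl | he
  · rw [zero_pow two_ne_zero, ArithmeticFunction.map_zero]; norm_num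
  have he1 : (1 : ℝ) ≤ e := by exact_mod_cast he
  have he0 : (0 : ℝ) < e := by linarith
  have h1 : 1 + Real.log ((e ^ 2 : ℕ) : ℝ) ≤ 5 * (e : ℝ) ^ (1 / 2 : ℝ) := by
    push_cast
    rw [Real.log_pow]
    have h2 := Real.log_le_rpow_div he0.le (ε := 1 / 2) (by norm_num)
    have h3 := Real.one_le_rpow he1 (z := 1 / 2) (by norm_num)
    push_cast
    linarith
  calc |sqMoebius q (e ^ 2)| * (1 + Real.log ((e ^ 2 : ℕ) : ℝ))
      ≤ 1 / (e : ℝ) ^ 2 * (5 * (e : ℝ) ^ (1 / 2 : ℝ)) :=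
        mul_le_mul (abs_sqMoebius_sq_le q e) h1
          (by have := Real.log_natCast_nonneg (e ^ 2); linarith) (by positivity)
    _ = _ := by
      have : (e : ℝ) ^ 2 = (e : ℝ) ^ (3 / 2 : ℝ) * (e : ℝ) ^ (1 / 2 : ℝ) := by
        rw [← Real.rpow_add he0]; norm_num
      rw [this]
      field_simp

lemma summable_sqMoebius (q : ℕ) : Summable fun m : ℕ => sqMoebius q m := by
  refine Summable.of_norm_bounded (summable_abs_sqMoebius_mul_log q) fun m => ?_
  rw [Real.norm_eq_abs]
  exact le_mul_of_one_le_right (abs_nonneg _) (by have := Real.log_natCast_nonneg m; linarith)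

/-- If the partial sums of `g` are `c log ^ 4` up to `O(log ^ 3)`, then the partial sums of the
Dirichlet product of `sqMoebius q` with `g` have the same shape. -/
lemma exists_abs_sum_sqMoebius_mul_sub_le (q : ℕ) (g : ArithmeticFunction ℝ) (c C : ℝ) (hC : 0 ≤ C)
    (hg : ∀ x : ℝ, 1 ≤ x →
      |∑ n ∈ Ioc 0 ⌊x⌋₊, g n - c * Real.log x ^ 4| ≤ C * (1 + Real.log x) ^ 3) :
    ∃ C' : ℝ, 0 ≤ C' ∧ ∀ N : ℕ, 0 < N →
      |∑ n ∈ Ioc 0 N, (sqMoebius q * g) n - c * (∑' m, sqMoebius q m) * Real.log N ^ 4|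
        ≤ C' * (1 + Real.log N) ^ 3 := by
  set M := ∑' m : ℕ, |sqMoebius q m| * (1 + Real.log m) with hM
  have hMnn : 0 ≤ M := tsum_nonneg fun m => mul_nonneg (abs_nonneg _)
    (by have := Real.log_natCast_nonneg m; linarith)
  refine ⟨(C + 4 * |c|) * M, by positivity, fun N hN => ?_⟩
  set L := Real.log N with hL
  have hL0 : 0 ≤ L := Real.log_natCast_nonneg N
  have hN0 : (0 : ℝ) < N := by exact_mod_cast hN
  set F : ℕ → ℝ := fun m =>
    (if m ∈ Ioc 0 N then sqMoebius q m * ∑ n ∈ Ioc 0 (N / m), g n else 0)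
      - sqMoebius q m * (c * L ^ 4) with hF
  have hs1 : Summable fun m : ℕ =>
      (if m ∈ Ioc 0 N then sqMoebius q m * ∑ n ∈ Ioc 0 (N / m), g n else 0) :=
    summable_of_ne_finset_zero (s := Ioc 0 N) fun m hm => if_neg hm
  have hFs : ∑' m, F m = ∑ n ∈ Ioc 0 N, (sqMoebius q * g) n
      - c * (∑' m, sqMoebius q m) * L ^ 4 := by
    rw [hF, hs1.tsum_sub ((summable_sqMoebius q).mul_right _), tsum_mul_right,
      tsum_eq_sum (s := Ioc 0 N) fun m hm => if_neg hm,
      ArithmeticFunction.sum_Ioc_mul_eq_sum_sum]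
    congr 1
    · exact Finset.sum_congr rfl fun m hm => if_pos hm
    · ring
  rw [← hFs]
  have hb : ∀ m, ‖F m‖ ≤ |sqMoebius q m| * (1 + Real.log m) * ((C + 4 * |c|) * (1 + L) ^ 3) := by
    intro m
    have hlm := Real.log_natCast_nonneg m
    have hc := abs_nonneg c
    have hp3 : 0 ≤ (1 + L) ^ 3 := by positivity
    have hL3 : L ^ 3 ≤ (1 + L) ^ 3 := pow_le_pow_left₀ hL0 (by linarith) 3
    rw [Real.norm_eq_abs, mul_assoc (|sqMoebius q m|)]
    rcases Nat.eq_zero_or_pos m with rfl | hm0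
    · simp [hF]
    by_cases hm : m ∈ Ioc 0 N
    · have hmN : m ≤ N := (Finset.mem_Ioc.1 hm).2
      have hm0' : (0 : ℝ) < m := by exact_mod_cast hm0
      have hx : (1 : ℝ) ≤ (N : ℝ) / m := by
        rw [le_div_iff₀ hm0', one_mul]; exact_mod_cast hmN
      have h1 := hg _ hx
      rw [Nat.floor_div_natCast, Nat.floor_natCast, Real.log_div hN0.ne' hm0'.ne', ← hL] at h1
      have hlmL : Real.log m ≤ L := Real.log_le_log hm0' (by exact_mod_cast hmN)
      set l := Real.log m
      have h2 : |c * (L - l) ^ 4 - c * L ^ 4| ≤ |c| * (4 * L ^ 3 * l) := by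
        rw [← mul_sub, abs_mul]
        refine mul_le_mul_of_nonneg_left ?_ hc
        have ha : 0 ≤ L - l := by linarith
        have e : (L - l) ^ 4 - L ^ 4
            = -(l * ((L - l) ^ 3 + (L - l) ^ 2 * L + (L - l) * L ^ 2 + L ^ 3)) := by ring
        rw [e, abs_neg, abs_of_nonneg (by positivity)]
        have h3 : (L - l) ^ 3 ≤ L ^ 3 := pow_le_pow_left₀ ha (by linarith) 3
        have h4 : (L - l) ^ 2 * L ≤ L ^ 2 * L :=
          mul_le_mul_of_nonneg_right (pow_le_pow_left₀ ha (by linarith) 2) hL0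
        have h5 : (L - l) * L ^ 2 ≤ L * L ^ 2 :=
          mul_le_mul_of_nonneg_right (by linarith) (by positivity)
        calc l * ((L - l) ^ 3 + (L - l) ^ 2 * L + (L - l) * L ^ 2 + L ^ 3)
            ≤ l * (L ^ 3 + L ^ 2 * L + L * L ^ 2 + L ^ 3) :=
              mul_le_mul_of_nonneg_left (by linarith) hlm
          _ = _ := by ring
      have e : F m = sqMoebius q m * ((∑ n ∈ Ioc 0 (N / m), g n - c * (L - l) ^ 4)
          + (c * (L - l) ^ 4 - c * L ^ 4)) := by
        simp only [hF, if_pos hm]; ring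
      rw [e, abs_mul]
      refine mul_le_mul_of_nonneg_left ((abs_add_le _ _).trans ?_) (abs_nonneg _)
      have h6 : (1 + (L - l)) ^ 3 ≤ (1 + L) ^ 3 :=
        pow_le_pow_left₀ (by linarith) (by linarith) 3
      have h7 : C * (1 + (L - l)) ^ 3 ≤ C * (1 + L) ^ 3 := mul_le_mul_of_nonneg_left h6 hC
      have h8 : |c| * (4 * L ^ 3 * l) ≤ |c| * (4 * (1 + L) ^ 3 * l) := by gcongr
      have h9 : 0 ≤ l * (C * (1 + L) ^ 3) := by positivity
      have h10 : 0 ≤ |c| * (1 + L) ^ 3 := by positivity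
      nlinarith
    · have hmN : N < m := by
        by_contra! hcon
        exact hm (Finset.mem_Ioc.2 ⟨hm0, hcon⟩)
      have hlmL : L ≤ Real.log m := Real.log_le_log hN0 (by exact_mod_cast hmN.le)
      set l := Real.log m
      have e : F m = -(sqMoebius q m * (c * L ^ 4)) := by
        simp only [hF, if_neg hm]; ring
      rw [e, abs_neg, abs_mul, abs_mul, abs_of_nonneg (by positivity : 0 ≤ L ^ 4)]
      refine mul_le_mul_of_nonneg_left ?_ (abs_nonneg _)
      have h1 : |c| * L ^ 4 ≤ |c| * ((1 + L) ^ 3 * l) := by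
        refine mul_le_mul_of_nonneg_left ?_ hc
        calc L ^ 4 = L ^ 3 * L := by ring
          _ ≤ _ := mul_le_mul hL3 hlmL hL0 hp3
      have h2 : 0 ≤ C * (1 + L) ^ 3 := by positivity
      have h3 : 0 ≤ |c| * (1 + L) ^ 3 := by positivity
      have h4 : 0 ≤ l * (C * (1 + L) ^ 3) := by positivity
      have h5 : 0 ≤ l * (|c| * (1 + L) ^ 3) := by positivity
      nlinarith
  have hsum := (summable_abs_sqMoebius_mul_log q).mul_right ((C + 4 * |c|) * (1 + L) ^ 3)
  have := tsum_of_norm_bounded hsum.hasSum hb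
  rw [Real.norm_eq_abs, tsum_mul_right] at this
  linarith [this]

lemma tsum_sqMoebius_mul_eq_one (q : ℕ) [NeZero q] :
    (∑' m, sqMoebius q m) * ((∏ p ∈ q.primeFactors, (1 - ((p : ℝ) ^ 2)⁻¹)) * (π ^ 2 / 6)) = 1 := by
  have h1 : (1 : ℝ) < (2 : ℂ).re := by norm_num
  have hL := DirichletCharacter.LSeries.mul_mu_eq_one (1 : DirichletCharacter ℂ q) h1
  rw [← DirichletCharacter.LFunction_eq_LSeries _ h1] at hL
  have hT := DirichletCharacter.LFunctionTrivChar_eq_mul_riemannZeta (N := q) (s := 2) (by norm_num)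
  rw [DirichletCharacter.LFunctionTrivChar] at hT
  rw [hT, riemannZeta_two] at hL
  have hB : LSeries ((fun n : ℕ => (1 : DirichletCharacter ℂ q) n)
      * fun n => ((ArithmeticFunction.moebius n : ℤ) : ℂ)) 2 = ((∑' m, sqMoebius q m : ℝ) : ℂ) := by
    rw [← injective_sq_nat.tsum_eq (f := fun m => sqMoebius q m) (fun n hn => by
      by_contra h
      exact hn (sqMoebius_eq_zero_of_notMem_range q h)), Complex.ofReal_tsum, LSeries]
    refine tsum_congr fun n => ?_
    rcases Nat.eq_zero_or_pos n with rfl | hn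
    · simp
    rw [LSeries.term_of_ne_zero hn.ne', sqMoebius_sq, coprimeInv_pow, coprimeInv_apply]
    simp only [Pi.mul_apply]
    by_cases hc : n.Coprime q
    · rw [if_pos hc, MulChar.one_apply ((ZMod.isUnit_iff_coprime n q).2 hc)]
      push_cast
      rw [Complex.cpow_ofNat]
      ring
    · rw [if_neg hc, MulChar.map_nonunit _ (fun h => hc ((ZMod.isUnit_iff_coprime n q).1 h))]
      simp
  rw [hB] at hL
  have hP : (∏ p ∈ q.primeFactors, (1 - (p : ℂ) ^ (-2 : ℂ)))
      = ((∏ p ∈ q.primeFactors, (1 - ((p : ℝ) ^ 2)⁻¹) : ℝ) : ℂ) := by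
    push_cast
    refine Finset.prod_congr rfl fun p _ => ?_
    rw [Complex.cpow_neg, Complex.cpow_ofNat]
  rw [hP] at hL
  rw [mul_comm]
  exact_mod_cast hL

lemma totient_div_pow_four_mul_tsum_sqMoebius (q : ℕ) [NeZero q] :
    ((q.totient : ℝ) / q) ^ 4 / 24 * ∑' m, sqMoebius q m
      = 1 / (4 * π ^ 2) * ((q.totient : ℝ) / q) ^ 2
        * ∏ p ∈ q.primeFactors, (1 - 2 / ((p : ℝ) + 1)) := by
  have hq : (q : ℝ) ≠ 0 := by exact_mod_cast NeZero.ne q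
  have hk : (q.totient : ℝ) / q = ∏ p ∈ q.primeFactors, (1 - (p : ℝ)⁻¹) := by
    have h : (q.totient : ℝ) = q * ∏ p ∈ q.primeFactors, (1 - (p : ℝ)⁻¹) := by
      have h' := congrArg (fun x : ℚ => (x : ℝ)) (Nat.totient_eq_mul_prod_factors q)
      push_cast at h'
      exact h'
    rw [h]; field_simp
  have hp : ((q.totient : ℝ) / q) ^ 2 = (∏ p ∈ q.primeFactors, (1 - 2 / ((p : ℝ) + 1)))
      * ∏ p ∈ q.primeFactors, (1 - ((p : ℝ) ^ 2)⁻¹) := by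
    rw [hk, ← Finset.prod_pow, ← Finset.prod_mul_distrib]
    refine Finset.prod_congr rfl fun p hp => ?_
    have hp0 : (0 : ℝ) < p := by exact_mod_cast (Nat.prime_of_mem_primeFactors hp).pos
    field_simp
    ring
  have hB := tsum_sqMoebius_mul_eq_one q
  set B := ∑' m, sqMoebius q m
  set P := ∏ p ∈ q.primeFactors, (1 - ((p : ℝ) ^ 2)⁻¹)
  set R := ∏ p ∈ q.primeFactors, (1 - 2 / ((p : ℝ) + 1))
  set k := (q.totient : ℝ) / q
  have hpi := Real.pi_ne_zero
  have hB' : B * P * π ^ 2 = 6 := by linarith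
  have e : k ^ 4 / 24 * B = k ^ 2 * R * (B * P * π ^ 2) / (24 * π ^ 2) := by
    rw [show k ^ 4 = k ^ 2 * k ^ 2 by ring, hp]
    field_simp
  rw [e, hB']
  field_simp
  ring

/-- The main arithmetic input: the logarithmic mean of `d(n) ^ 2` over integers coprime to `q`. -/
lemma exists_abs_sum_divisorSqCoprime_sub_le (q : ℕ) [NeZero q] :
    ∃ C : ℝ, 0 ≤ C ∧ ∀ N : ℕ, 0 < N →
      |∑ n ∈ Ioc 0 N, divisorSqCoprime q n
          - 1 / (4 * π ^ 2) * ((q.totient : ℝ) / q) ^ 2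
            * (∏ p ∈ q.primeFactors, (1 - 2 / ((p : ℝ) + 1))) * Real.log N ^ 4|
        ≤ C * (1 + Real.log N) ^ 3 := by
  obtain ⟨C, hC, h⟩ := exists_abs_sum_coprimeInv_pow_sub_le q 3
  obtain ⟨C', hC', h'⟩ := exists_abs_sum_sqMoebius_mul_sub_le q (coprimeInv q ^ 4)
    (((q.totient : ℝ) / q) ^ 4 / 24) C hC (fun x hx => by
      have := h x hx
      have e24 : ((3 + 1).factorial : ℝ) = 24 := by norm_num [Nat.factorial]
      rw [e24] at this
      convert this using 3
      ring)
  refine ⟨C', hC', fun N hN => ?_⟩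
  have := h' N hN
  rwa [← divisorSqCoprime_eq, totient_div_pow_four_mul_tsum_sqMoebius] at this

lemma exists_norm_mellin_le {f : ℝ → ℂ} {a b : ℝ} (ha : MellinConvergent f a)
    (hb : MellinConvergent f b) :
    ∃ C : ℝ, 0 ≤ C ∧ ∀ s : ℂ, a ≤ s.re → s.re ≤ b → ‖mellin f s‖ ≤ C := by
  set F : ℝ → ℝ := fun t => ‖(t : ℂ) ^ ((a : ℂ) - 1) • f t‖ + ‖(t : ℂ) ^ ((b : ℂ) - 1) • f t‖
    with hF
  refine ⟨∫ t in Set.Ioi (0 : ℝ), F t, integral_nonneg fun t => by positivity, fun s has hsb => ?_⟩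
  refine norm_integral_le_of_norm_le (ha.norm.add hb.norm) ?_
  refine (ae_restrict_iff' measurableSet_Ioi).2 (Eventually.of_forall fun t ht => ?_)
  have ht0 : (0 : ℝ) < t := ht
  simp only [hF, norm_smul, Complex.norm_cpow_eq_rpow_re_of_pos ht0, Complex.sub_re, Complex.one_re,
    Complex.ofReal_re]
  rw [← add_mul]
  refine mul_le_mul_of_nonneg_right ?_ (norm_nonneg _)
  rcases le_total 1 t with h | h
  · exact (Real.rpow_le_rpow_of_exponent_le h (by linarith)).trans
      (le_add_of_nonneg_left (by positivity))
  · exact (Real.rpow_le_rpow_of_exponent_ge ht0 h (by linarith)).trans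
      (le_add_of_nonneg_right (by positivity))

lemma exists_norm_Gamma_le {a b : ℝ} (ha : 0 < a) (hab : a ≤ b) :
    ∃ C : ℝ, 0 ≤ C ∧ ∀ s : ℂ, a ≤ s.re → s.re ≤ b → ‖Complex.Gamma s‖ ≤ C := by
  have h : ∀ c : ℝ, 0 < c → MellinConvergent (fun x : ℝ => ((Real.exp (-x) : ℝ) : ℂ)) c := by
    intro c hc
    refine (Complex.GammaIntegral_convergent (s := (c : ℂ)) (by simpa using hc)).congr_fun
      (fun x _ => ?_) measurableSet_Ioi
    simp only [smul_eq_mul]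
    rw [mul_comm]
  obtain ⟨C, hC, hb⟩ := exists_norm_mellin_le (h a ha) (h b (ha.trans_le hab))
  refine ⟨C, hC, fun s h1 h2 => ?_⟩
  rw [Complex.Gamma_eq_integral (by linarith), Complex.GammaIntegral_eq_mellin]
  exact hb s h1 h2

lemma norm_complex_sin_le (z : ℂ) : ‖Complex.sin z‖ ≤ Real.exp |z.im| := by
  rw [Complex.sin, norm_div, norm_mul, Complex.norm_I, mul_one, Complex.norm_two,
    div_le_iff₀ two_pos]
  refine (norm_sub_le _ _).trans ?_
  rw [Complex.norm_exp, Complex.norm_exp]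
  have h1 : (-z * Complex.I).re = z.im := by simp
  have h2 : (z * Complex.I).re = -z.im := by simp
  rw [h1, h2]
  have := Real.exp_le_exp.2 (le_abs_self z.im)
  have := Real.exp_le_exp.2 (neg_le_abs z.im)
  linarith

lemma exists_norm_inv_Gamma_le :
    ∃ C : ℝ, 0 ≤ C ∧ ∀ z : ℂ, 1 / 4 ≤ z.re → z.re ≤ 7 / 4 → 1 / 2 ≤ |z.im| →
      ‖(Complex.Gamma z)⁻¹‖ ≤ C * Real.exp (π * |z.im|) := by
  obtain ⟨C, hC, h⟩ := exists_norm_Gamma_le (a := 1 / 4) (b := 7 / 4) (by norm_num) (by norm_num)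
  refine ⟨2 * C, by positivity, fun z h1 h2 h3 => ?_⟩
  have him : z.im ≠ 0 := fun h0 => by rw [h0, abs_zero] at h3; norm_num at h3
  have hz1 : (1 - z) ≠ 0 := fun h0 => him (by simpa using congrArg Complex.im h0)
  have hG := Complex.Gamma_mul_Gamma_one_sub z
  have hG2 := Complex.Gamma_add_one (1 - z) hz1
  have hsin : Complex.sin (π * z) ≠ 0 := by
    intro h0
    obtain ⟨k, hk⟩ := Complex.sin_eq_zero_iff.1 h0
    have hzk : z = k := by
      have hpi : (π : ℂ) ≠ 0 := by exact_mod_cast Real.pi_ne_zero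
      rw [mul_comm] at hk
      exact mul_right_cancel₀ hpi hk
    exact him (by rw [hzk]; simp)
  have hpi : (π : ℂ) ≠ 0 := by exact_mod_cast Real.pi_ne_zero
  have hGz : Complex.Gamma z ≠ 0 := Complex.Gamma_ne_zero_of_re_pos (by linarith)
  have e : (Complex.Gamma z)⁻¹ = Complex.Gamma (1 - z + 1) * Complex.sin (π * z) / (π * (1 - z)) := by
    rw [eq_div_iff hsin] at hG
    generalize Complex.sin (π * z) = S at hG ⊢
    rw [hG2, eq_div_iff (mul_ne_zero hpi hz1), ← hG]
    field_simp
  rw [e, norm_div, norm_mul, norm_mul]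
  have h4 := h (1 - z + 1) (by simp; linarith) (by simp; linarith)
  have h5 := norm_complex_sin_le (π * z)
  have h6 : (π * z : ℂ).im = π * z.im := by simp
  rw [h6, abs_mul, abs_of_pos Real.pi_pos] at h5
  have h7 : 1 / 2 ≤ ‖(π : ℂ)‖ * ‖1 - z‖ := by
    have h8 : |z.im| ≤ ‖1 - z‖ := by simpa using Complex.abs_im_le_norm (1 - z)
    have h9 : ‖(π : ℂ)‖ = π := by simp [abs_of_pos Real.pi_pos]
    rw [h9]
    have := Real.pi_gt_three
    nlinarith
  rw [div_le_iff₀ (by linarith)]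
  calc _ ≤ C * Real.exp (π * |z.im|) := mul_le_mul h4 h5 (norm_nonneg _) hC
    _ ≤ C * Real.exp (π * |z.im|) * (2 * (‖(π : ℂ)‖ * ‖1 - z‖)) :=
      le_mul_of_one_le_right (by positivity) (by linarith)
    _ = _ := by ring

lemma norm_pi_cpow (s : ℂ) : ‖(π : ℂ) ^ s‖ = π ^ s.re :=
  Complex.norm_cpow_eq_rpow_re_of_pos Real.pi_pos s

lemma exists_norm_Gammaℝ_le :
    ∃ C : ℝ, 0 ≤ C ∧ ∀ s : ℂ, 1 / 2 ≤ s.re → s.re ≤ 7 / 2 → ‖Complex.Gammaℝ s‖ ≤ C := by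
  obtain ⟨C, hC, h⟩ := exists_norm_Gamma_le (a := 1 / 4) (b := 7 / 4) (by norm_num) (by norm_num)
  refine ⟨C, hC, fun s h1 h2 => ?_⟩
  rw [Complex.Gammaℝ_def, norm_mul, norm_pi_cpow]
  have h3 : (s / 2).re = s.re / 2 := by simp
  have h4 : (-s / 2).re = -s.re / 2 := by simp
  have h5 := h (s / 2) (by rw [h3]; linarith) (by rw [h3]; linarith)
  have h6 : π ^ (-s / 2).re ≤ 1 := Real.rpow_le_one_of_one_le_of_nonpos
    (by linarith [Real.pi_gt_three]) (by rw [h4]; linarith)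
  calc _ ≤ 1 * C := mul_le_mul h6 h5 (norm_nonneg _) zero_le_one
    _ = C := one_mul C

lemma exists_norm_inv_Gammaℝ_le :
    ∃ C : ℝ, 0 ≤ C ∧ ∀ s : ℂ, 1 / 2 ≤ s.re → s.re ≤ 7 / 2 → 1 ≤ |s.im| →
      ‖(Complex.Gammaℝ s)⁻¹‖ ≤ C * Real.exp (2 * |s.im|) := by
  obtain ⟨C, hC, h⟩ := exists_norm_inv_Gamma_le
  refine ⟨π ^ (2 : ℝ) * C, by positivity, fun s h1 h2 h3 => ?_⟩
  rw [Complex.Gammaℝ_def, mul_inv, norm_mul, norm_inv, norm_pi_cpow]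
  have h3r : (s / 2).re = s.re / 2 := by simp
  have h3i : |(s / 2).im| = |s.im| / 2 := by
    rw [show (s / 2).im = s.im / 2 by simp, abs_div, abs_two]
  have h4 : (-s / 2).re = -s.re / 2 := by simp
  have h5 := h (s / 2) (by rw [h3r]; linarith) (by rw [h3r]; linarith) (by rw [h3i]; linarith)
  have hpi := Real.pi_gt_three
  have hpi' := Real.pi_le_four
  rw [← Real.rpow_neg Real.pi_pos.le]
  have h6 : π ^ (-(-s / 2).re) ≤ π ^ (2 : ℝ) :=
    Real.rpow_le_rpow_of_exponent_le (by linarith) (by rw [h4]; linarith)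
  have h7 : Real.exp (π * |(s / 2).im|) ≤ Real.exp (2 * |s.im|) := by
    rw [Real.exp_le_exp, h3i]
    nlinarith [abs_nonneg s.im]
  calc _ ≤ π ^ (2 : ℝ) * (C * Real.exp (π * |(s / 2).im|)) :=
        mul_le_mul h6 h5 (norm_nonneg _) (by positivity)
    _ ≤ π ^ (2 : ℝ) * (C * Real.exp (2 * |s.im|)) := by gcongr
    _ = _ := by ring

lemma exists_norm_weakFEPair_Λ₀_le (P : WeakFEPair ℂ) (a b : ℝ) :
    ∃ C : ℝ, 0 ≤ C ∧ ∀ s : ℂ, a ≤ s.re → s.re ≤ b → ‖P.Λ₀ s‖ ≤ C :=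
  exists_norm_mellin_le (P.isStrongFEPair_toStrongFEPair.hasMellin a).1
    (P.isStrongFEPair_toStrongFEPair.hasMellin b).1

lemma exists_norm_hurwitzZeta_le (a : UnitAddCircle) :
    ∃ C : ℝ, 0 ≤ C ∧ ∀ s : ℂ, 1 / 2 ≤ s.re → s.re ≤ 3 / 2 → 1 ≤ |s.im| →
      ‖hurwitzZeta a s‖ ≤ C * Real.exp (2 * |s.im|) := by
  obtain ⟨C₁, hC₁, h₁⟩ := exists_norm_weakFEPair_Λ₀_le (hurwitzEvenFEPair a) (1 / 4) (3 / 4)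
  obtain ⟨C₂, hC₂, h₂⟩ := exists_norm_weakFEPair_Λ₀_le (hurwitzOddFEPair a) (3 / 4) (5 / 4)
  obtain ⟨C₃, hC₃, h₃⟩ := exists_norm_inv_Gammaℝ_le
  refine ⟨(C₁ + 2 + C₂) * C₃, by positivity, fun s hs1 hs2 hs3 => ?_⟩
  have him : s.im ≠ 0 := fun h0 => by rw [h0, abs_zero] at hs3; norm_num at hs3
  have hs0 : s ≠ 0 := fun h0 => him (by rw [h0]; rfl)
  have hr2 : (s / 2).re = s.re / 2 := by simp
  have hr3 : ((s + 1) / 2).re = (s.re + 1) / 2 := by simp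
  have hE : ‖completedHurwitzZetaEven a s‖ ≤ C₁ + 2 := by
    rw [completedHurwitzZetaEven_eq]
    have e1 : ‖completedHurwitzZetaEven₀ a s‖ ≤ C₁ := by
      rw [completedHurwitzZetaEven₀, norm_div, Complex.norm_two]
      have := h₁ (s / 2) (by rw [hr2]; linarith) (by rw [hr2]; linarith)
      linarith
    have e2 : ‖((if a = 0 then 1 else 0 : ℂ)) / s‖ ≤ 1 := by
      rw [norm_div, div_le_one (norm_pos_iff.2 hs0)]
      have h4 := Complex.abs_im_le_norm s
      have h5 : ‖(if a = 0 then 1 else 0 : ℂ)‖ ≤ 1 := by split_ifs <;> simp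
      linarith
    have e3 : ‖1 / (1 - s)‖ ≤ 1 := by
      have h4 : |s.im| ≤ ‖1 - s‖ := by simpa using Complex.abs_im_le_norm (1 - s)
      rw [norm_div, norm_one, div_le_one (by linarith)]
      linarith
    refine (norm_sub_le _ _).trans ?_
    have := norm_sub_le (completedHurwitzZetaEven₀ a s) ((if a = 0 then 1 else 0 : ℂ) / s)
    linarith
  have hO : ‖completedHurwitzZetaOdd a s‖ ≤ C₂ := by
    rw [completedHurwitzZetaOdd, norm_div, Complex.norm_two]
    have h4 : (hurwitzOddFEPair a).Λ ((s + 1) / 2) = (hurwitzOddFEPair a).Λ₀ ((s + 1) / 2) := by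
      rw [WeakFEPair.Λ, (isStrong_hurwitzOddFEPair a).hf₀, (isStrong_hurwitzOddFEPair a).hg₀]
      simp
    have := h₂ ((s + 1) / 2) (by rw [hr3]; linarith) (by rw [hr3]; linarith)
    rw [h4]
    linarith
  rw [hurwitzZeta, hurwitzZetaEven_def_of_ne_or_ne (Or.inr hs0), hurwitzZetaOdd, div_eq_mul_inv,
    div_eq_mul_inv]
  have g1 := h₃ s hs1 (by linarith) hs3
  have g2 := h₃ (s + 1) (by simp; linarith) (by simp; linarith) (by simpa using hs3)
  have hi : (s + 1).im = s.im := by simp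
  rw [hi] at g2
  calc _ ≤ (C₁ + 2) * (C₃ * Real.exp (2 * |s.im|)) + C₂ * (C₃ * Real.exp (2 * |s.im|)) := by
        refine (norm_add_le _ _).trans (add_le_add ?_ ?_)
        · rw [norm_mul]; exact mul_le_mul hE g1 (norm_nonneg _) (by positivity)
        · rw [norm_mul]; exact mul_le_mul hO g2 (norm_nonneg _) (by positivity)
    _ = _ := by ring

lemma exists_norm_LFunction_le {N : ℕ} [NeZero N] (χ : DirichletCharacter ℂ N) :
    ∃ C : ℝ, 0 ≤ C ∧ ∀ s : ℂ, 1 / 2 ≤ s.re → s.re ≤ 3 / 2 → 1 ≤ |s.im| →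
      ‖DirichletCharacter.LFunction χ s‖ ≤ C * Real.exp (2 * |s.im|) := by
  choose C hC h using fun j : ZMod N => exists_norm_hurwitzZeta_le (ZMod.toAddCircle j)
  refine ⟨∑ j, C j, Finset.sum_nonneg fun j _ => hC j, fun s hs1 hs2 hs3 => ?_⟩
  have hN : (0 : ℝ) < N := by exact_mod_cast Nat.pos_of_ne_zero (NeZero.ne N)
  have hN1 : (1 : ℝ) ≤ N := by exact_mod_cast Nat.pos_of_ne_zero (NeZero.ne N)
  rw [DirichletCharacter.LFunction, ZMod.LFunction, norm_mul, ← Complex.ofReal_natCast,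
    Complex.norm_cpow_eq_rpow_re_of_pos hN]
  have h1 : (N : ℝ) ^ (-s).re ≤ 1 :=
    Real.rpow_le_one_of_one_le_of_nonpos hN1 (by simp; linarith)
  have h2 : ‖∑ j : ZMod N, χ j * hurwitzZeta (ZMod.toAddCircle j) s‖
      ≤ (∑ j, C j) * Real.exp (2 * |s.im|) := by
    rw [Finset.sum_mul]
    refine norm_sum_le_of_le _ fun j _ => ?_
    rw [norm_mul]
    calc _ ≤ 1 * (C j * Real.exp (2 * |s.im|)) :=
          mul_le_mul (χ.norm_le_one j) (h j s hs1 hs2 hs3) (norm_nonneg _) zero_le_one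
      _ = _ := one_mul _
  calc _ ≤ 1 * ((∑ j, C j) * Real.exp (2 * |s.im|)) :=
        mul_le_mul h1 h2 (norm_nonneg _) zero_le_one
    _ = _ := one_mul _

/-- The factor relating `L(s, χ)` to `L(1 - s, χ⁻¹)` in the functional equation, up to the root
number; here `κ` is the parity of the character and `f` its conductor. -/
noncomputable def funcFactor (f κ : ℕ) (s : ℂ) : ℂ :=
  (f : ℂ) ^ (s - 1 / 2) * Complex.Gammaℝ (s + κ) / Complex.Gammaℝ (1 - s + κ)

lemma Gammaℝ_ne_zero_of_im_ne_zero {s : ℂ} (hs : s.im ≠ 0) : Complex.Gammaℝ s ≠ 0 := by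
  rw [Ne, Complex.Gammaℝ_eq_zero_iff]
  rintro ⟨n, rfl⟩
  simp at hs

lemma differentiableAt_Gammaℝ_of_im_ne_zero {s : ℂ} (hs : s.im ≠ 0) :
    DifferentiableAt ℂ Complex.Gammaℝ s := by
  have h := (Complex.differentiable_Gammaℝ_inv s).inv
    (inv_ne_zero (Gammaℝ_ne_zero_of_im_ne_zero hs))
  exact h.congr_of_eventuallyEq (Eventually.of_forall fun z => by simp)

section
variable {f κ : ℕ} {s : ℂ}

lemma funcFactor_ne_zero [NeZero f] (hs : s.im ≠ 0) : funcFactor f κ s ≠ 0 := by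
  refine div_ne_zero (mul_ne_zero ?_ (Gammaℝ_ne_zero_of_im_ne_zero (by simpa using hs)))
    (Gammaℝ_ne_zero_of_im_ne_zero (by simpa using hs))
  rw [Complex.cpow_def_of_ne_zero (by exact_mod_cast NeZero.ne f)]
  exact Complex.exp_ne_zero _

lemma differentiableAt_funcFactor [NeZero f] (hs : s.im ≠ 0) :
    DifferentiableAt ℂ (funcFactor f κ) s := by
  have h1 : DifferentiableAt ℂ (fun s : ℂ => Complex.Gammaℝ (s + κ)) s :=
    DifferentiableAt.comp (f := fun s : ℂ => s + κ) s
      (differentiableAt_Gammaℝ_of_im_ne_zero (by simpa using hs)) (by fun_prop)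
  have h2 : DifferentiableAt ℂ (fun s : ℂ => Complex.Gammaℝ (1 - s + κ)) s :=
    DifferentiableAt.comp (f := fun s : ℂ => 1 - s + κ) s
      (differentiableAt_Gammaℝ_of_im_ne_zero (by simpa using hs)) (by fun_prop)
  have h3 : DifferentiableAt ℂ (fun s : ℂ => (f : ℂ) ^ (s - 1 / 2)) s :=
    DifferentiableAt.const_cpow (by fun_prop) (Or.inl (by exact_mod_cast NeZero.ne f))
  exact (h3.mul h1).div h2 (Gammaℝ_ne_zero_of_im_ne_zero (by simpa using hs))

lemma conj_natCast_cpow (n : ℕ) (s : ℂ) :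
    (starRingEnd ℂ) ((n : ℂ) ^ s) = (n : ℂ) ^ ((starRingEnd ℂ) s) := by
  have h := Complex.cpow_conj (n : ℂ) s (by
    rw [← Complex.ofReal_natCast, Complex.arg_ofReal_of_nonneg (Nat.cast_nonneg n)]
    exact Real.pi_pos.ne)
  rw [h, Complex.conj_natCast]

lemma Gammaℝ_conj (s : ℂ) :
    Complex.Gammaℝ ((starRingEnd ℂ) s) = (starRingEnd ℂ) (Complex.Gammaℝ s) := by
  rw [Complex.Gammaℝ_def, Complex.Gammaℝ_def, map_mul, ← Complex.Gamma_conj]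
  congr 1
  · have h := Complex.cpow_conj (π : ℂ) (-s / 2) (by
      rw [Complex.arg_ofReal_of_nonneg Real.pi_pos.le]; exact Real.pi_pos.ne)
    rw [Complex.conj_ofReal] at h
    rw [← h]
    rw [map_div₀, map_neg, map_ofNat]
  · rw [map_div₀, map_ofNat]

lemma conj_half_add_mul_I (t : ℝ) :
    (starRingEnd ℂ) (1 / 2 + t * Complex.I) = 1 - (1 / 2 + t * Complex.I) := by
  simp only [map_add, map_mul, map_div₀, map_one, map_ofNat, Complex.conj_ofReal, Complex.conj_I]
  ring

lemma conj_funcFactor (f κ : ℕ) (t : ℝ) :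
    (starRingEnd ℂ) (funcFactor f κ (1 / 2 + t * Complex.I))
      = (funcFactor f κ (1 / 2 + t * Complex.I))⁻¹ := by
  set s : ℂ := 1 / 2 + t * Complex.I with hs
  have h1 : (starRingEnd ℂ) s = 1 - s := conj_half_add_mul_I t
  have h2 : s = 1 - (starRingEnd ℂ) s := by rw [h1]; ring
  rw [funcFactor, map_div₀, map_mul, conj_natCast_cpow, ← Gammaℝ_conj, ← Gammaℝ_conj]
  simp only [map_add, map_sub, map_one, map_natCast, h1, map_div₀, map_ofNat]
  rw [inv_div, show 1 - (1 - s) = s by ring, show 1 - s - 1 / 2 = -(s - 1 / 2) by ring,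
    Complex.cpow_neg]
  rw [← div_div, inv_mul_eq_div, div_right_comm]

lemma exists_norm_funcFactor_le (f κ : ℕ) [NeZero f] (hκ : κ ≤ 1) :
    ∃ C : ℝ, 0 ≤ C ∧ ∀ s : ℂ, 1 / 2 ≤ s.re → s.re ≤ 3 / 2 → 1 ≤ |s.im| →
      ‖funcFactor f κ s‖ ≤ C * Real.exp (4 * |s.im|) ∧
      ‖(funcFactor f κ s)⁻¹‖ ≤ C * Real.exp (4 * |s.im|) := by
  obtain ⟨C₁, hC₁, h₁⟩ := exists_norm_Gammaℝ_le
  obtain ⟨C₂, hC₂, h₂⟩ := exists_norm_inv_Gammaℝ_le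
  have hf : (0 : ℝ) < f := by exact_mod_cast Nat.pos_of_ne_zero (NeZero.ne f)
  have hf1 : (1 : ℝ) ≤ f := by exact_mod_cast Nat.pos_of_ne_zero (NeZero.ne f)
  have hκ0 : (0 : ℝ) ≤ κ := Nat.cast_nonneg κ
  have hκ1 : (κ : ℝ) ≤ 1 := by exact_mod_cast hκ
  have hpi := Real.pi_gt_three
  refine ⟨f * C₁ * C₂ * (2 * π), by positivity, fun s hs1 hs2 hs3 => ?_⟩
  have him : s.im ≠ 0 := fun h0 => by rw [h0, abs_zero] at hs3; norm_num at hs3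
  set w : ℂ := 1 - s + κ with hw
  have hwi : w.im = -s.im := by simp [hw]
  have hwr : w.re = 1 - s.re + κ := by simp [hw]
  have hw0 : w ≠ 0 := fun h0 => him (by
    have := congrArg Complex.im h0
    rw [hwi] at this; simpa using this)
  have hG := Complex.Gammaℝ_add_two hw0
  have hpi0 : (π : ℂ) ≠ 0 := by exact_mod_cast Real.pi_ne_zero
  have hGw : Complex.Gammaℝ w ≠ 0 := Gammaℝ_ne_zero_of_im_ne_zero (by rw [hwi]; simpa using him)
  have hw1 : 1 ≤ ‖w‖ := by
    have := Complex.abs_im_le_norm w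
    rw [hwi, abs_neg] at this
    linarith
  have hw2 : ‖w‖ ≤ 3 * Real.exp |s.im| := by
    have h3 := Complex.norm_le_abs_re_add_abs_im w
    rw [hwi, abs_neg] at h3
    have h4 : |w.re| ≤ 2 := by rw [hwr, abs_le]; constructor <;> linarith
    have := Real.add_one_le_exp |s.im|
    linarith [abs_nonneg s.im]
  have hexp : (0 : ℝ) < Real.exp |s.im| := Real.exp_pos _
  have hnpi : ‖(π : ℂ)‖ = π := by simp [abs_of_pos Real.pi_pos]
  have a1 := h₁ (s + κ) (by simp; linarith) (by simp; linarith)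
  have a2 := h₂ (s + κ) (by simp; linarith) (by simp; linarith) (by simpa using hs3)
  have b1 := h₁ (w + 2) (by simp [hwr]; linarith) (by simp [hwr]; linarith)
  have b2 := h₂ (w + 2) (by simp [hwr]; linarith) (by simp [hwr]; linarith)
    (by simpa [hwi] using hs3)
  rw [show |(s + κ).im| = |s.im| by simp] at a2
  rw [show |(w + 2).im| = |s.im| by simp [hwi]] at b2
  have hN1 : ‖(f : ℂ) ^ (s - 1 / 2)‖ ≤ f := by
    rw [← Complex.ofReal_natCast, Complex.norm_cpow_eq_rpow_re_of_pos hf]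
    calc (f : ℝ) ^ (s - 1 / 2 : ℂ).re ≤ (f : ℝ) ^ (1 : ℝ) :=
          Real.rpow_le_rpow_of_exponent_le hf1 (by simp; linarith)
      _ = f := Real.rpow_one _
  have hN2 : ‖((f : ℂ) ^ (s - 1 / 2))⁻¹‖ ≤ f := by
    rw [← Complex.cpow_neg, ← Complex.ofReal_natCast, Complex.norm_cpow_eq_rpow_re_of_pos hf]
    refine le_trans (Real.rpow_le_one_of_one_le_of_nonpos hf1 ?_) hf1
    simp; linarith
  have hexp3 : Real.exp (2 * |s.im|) * Real.exp |s.im| ≤ Real.exp (4 * |s.im|) := by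
    rw [← Real.exp_add, Real.exp_le_exp]; linarith
  have hexp2 : Real.exp (2 * |s.im|) ≤ Real.exp (4 * |s.im|) := by
    rw [Real.exp_le_exp]; linarith
  constructor
  · have e : funcFactor f κ s = (f : ℂ) ^ (s - 1 / 2) * Complex.Gammaℝ (s + κ)
        * (Complex.Gammaℝ (w + 2))⁻¹ * w / (2 * π) := by
      rw [funcFactor, ← hw, hG]
      field_simp
    rw [e, norm_div, norm_mul, norm_mul, norm_mul, norm_mul, hnpi, Complex.norm_two]
    rw [div_le_iff₀ (by positivity)]
    calc _ ≤ f * C₁ * (C₂ * Real.exp (2 * |s.im|)) * (3 * Real.exp |s.im|) := by gcongr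
      _ = f * C₁ * C₂ * 3 * (Real.exp (2 * |s.im|) * Real.exp |s.im|) := by ring
      _ ≤ f * C₁ * C₂ * 3 * Real.exp (4 * |s.im|) := by gcongr
      _ ≤ f * C₁ * C₂ * (2 * π * (2 * π)) * Real.exp (4 * |s.im|) := by
        gcongr; nlinarith
      _ = _ := by ring
  · have e : (funcFactor f κ s)⁻¹ = ((f : ℂ) ^ (s - 1 / 2))⁻¹ * (Complex.Gammaℝ (s + κ))⁻¹
        * Complex.Gammaℝ (w + 2) * (2 * π) / w := by
      rw [funcFactor, ← hw, hG]
      field_simp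
    rw [e, norm_div, norm_mul, norm_mul, norm_mul, norm_mul, hnpi, Complex.norm_two]
    rw [div_le_iff₀ (by linarith)]
    calc _ ≤ f * (C₂ * Real.exp (2 * |s.im|)) * C₁ * (2 * π) := by gcongr
      _ ≤ f * (C₂ * Real.exp (4 * |s.im|)) * C₁ * (2 * π) := by gcongr
      _ = f * C₁ * C₂ * (2 * π) * Real.exp (4 * |s.im|) * 1 := by ring
      _ ≤ _ := mul_le_mul_of_nonneg_left hw1 (by positivity)

lemma norm_funcFactor_three_half [NeZero f] {t : ℝ} (ht : t ≠ 0) :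
    ‖funcFactor f κ (3 / 2 + t * Complex.I)‖ = f * ‖(κ : ℂ) - 1 / 2 + t * Complex.I‖ / (2 * π) := by
  have hf : (0 : ℝ) < f := by exact_mod_cast Nat.pos_of_ne_zero (NeZero.ne f)
  set s : ℂ := 3 / 2 + t * Complex.I with hs
  have hsi : s.im = t := by simp [hs]
  set w : ℂ := 1 - s + κ with hw
  have hwi : w.im = -t := by simp [hw, hsi]
  have hw0 : w ≠ 0 := fun h0 => ht (by
    have := congrArg Complex.im h0
    rw [hwi] at this; simpa using this)
  have hGw : Complex.Gammaℝ w ≠ 0 := Gammaℝ_ne_zero_of_im_ne_zero (by rw [hwi]; simpa using ht)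
  have hG := Complex.Gammaℝ_add_two hw0
  have hcs : (starRingEnd ℂ) (s + κ) = w + 2 := by
    simp only [hw, hs, map_add, map_mul, map_div₀, map_ofNat, map_natCast, Complex.conj_ofReal,
      Complex.conj_I]
    ring
  have hcw : (starRingEnd ℂ) w = (κ : ℂ) - 1 / 2 + t * Complex.I := by
    simp only [hw, hs, map_add, map_sub, map_one, map_mul, map_div₀, map_ofNat, map_natCast,
      Complex.conj_ofReal, Complex.conj_I]
    ring
  have hn : ‖Complex.Gammaℝ (s + κ)‖ = ‖Complex.Gammaℝ w‖ * ‖w‖ / 2 / π := by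
    rw [← Complex.norm_conj, ← Gammaℝ_conj, hcs, hG]
    simp [abs_of_pos Real.pi_pos]
  have hn2 : ‖w‖ = ‖(κ : ℂ) - 1 / 2 + t * Complex.I‖ := by rw [← hcw, Complex.norm_conj]
  rw [funcFactor, ← hw, norm_div, norm_mul, hn, ← hn2, ← Complex.ofReal_natCast,
    Complex.norm_cpow_eq_rpow_re_of_pos hf, show (s - 1 / 2).re = 1 by simp [hs]; norm_num,
    Real.rpow_one]
  have : ‖Complex.Gammaℝ w‖ ≠ 0 := norm_ne_zero_iff.2 hGw
  have hpi := Real.pi_ne_zero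
  field_simp

lemma norm_funcFactor_three_half_le [NeZero f] (hκ : κ ≤ 1) {t : ℝ} (ht : 1 ≤ t) :
    ‖funcFactor f κ (3 / 2 + t * Complex.I)‖ ≤ f * t := by
  have hf : (0 : ℝ) < f := by exact_mod_cast Nat.pos_of_ne_zero (NeZero.ne f)
  have hκ0 : (0 : ℝ) ≤ κ := Nat.cast_nonneg κ
  have hκ1 : (κ : ℝ) ≤ 1 := by exact_mod_cast hκ
  have hpi := Real.pi_gt_three
  rw [norm_funcFactor_three_half (by linarith), div_le_iff₀ (by positivity), mul_assoc]
  refine mul_le_mul_of_nonneg_left ?_ hf.le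
  refine (Complex.norm_le_abs_re_add_abs_im _).trans ?_
  have h1 : ((κ : ℂ) - 1 / 2 + t * Complex.I).re = κ - 1 / 2 := by simp
  have h2 : ((κ : ℂ) - 1 / 2 + t * Complex.I).im = t := by simp
  rw [h1, h2, abs_of_nonneg (by linarith : 0 ≤ t)]
  have h3 : |(κ : ℝ) - 1 / 2| ≤ 1 := by rw [abs_le]; constructor <;> linarith
  nlinarith

lemma norm_inv_funcFactor_three_half_le [NeZero f] {t : ℝ} (ht : 1 ≤ t) :
    ‖(funcFactor f κ (3 / 2 + t * Complex.I))⁻¹‖ ≤ 8 / t := by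
  have hf1 : (1 : ℝ) ≤ f := by exact_mod_cast Nat.pos_of_ne_zero (NeZero.ne f)
  have hpi := Real.pi_le_four
  have h2 : t ≤ ‖(κ : ℂ) - 1 / 2 + t * Complex.I‖ := by
    refine le_trans ?_ (Complex.abs_im_le_norm _)
    have h2 : ((κ : ℂ) - 1 / 2 + t * Complex.I).im = t := by simp
    rw [h2]; exact le_abs_self t
  have hf0 : (0 : ℝ) < f := by linarith
  have hw0 : 0 < ‖(κ : ℂ) - 1 / 2 + t * Complex.I‖ := by linarith
  rw [norm_inv, norm_funcFactor_three_half (by linarith), inv_div,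
    div_le_div_iff₀ (by positivity) (by linarith)]
  have h3 : t ≤ f * ‖(κ : ℂ) - 1 / 2 + t * Complex.I‖ := by nlinarith
  nlinarith

end

section FunctionalEquation

open ComplexConjugate

lemma LFunction_inv_eq_conj {N : ℕ} [NeZero N] (χ : DirichletCharacter ℂ N) {s : ℂ} (hs : s ≠ 1) :
    DirichletCharacter.LFunction χ⁻¹ s = conj (DirichletCharacter.LFunction χ (conj s)) := by
  have hpc : IsPreconnected ({1}ᶜ : Set ℂ) :=
    (isConnected_compl_singleton_of_one_lt_rank (rank_real_complex ▸ Nat.one_lt_ofNat) _)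
      |>.isPreconnected
  have hne : (2 : ℂ) ∈ ({1}ᶜ : Set ℂ) := by simp
  refine AnalyticOnNhd.eqOn_of_preconnected_of_eventuallyEq (𝕜 := ℂ)
    (f := DirichletCharacter.LFunction χ⁻¹)
    (g := fun s ↦ conj (DirichletCharacter.LFunction χ (conj s))) ?_ ?_ hpc hne ?_ hs
  · refine DifferentiableOn.analyticOnNhd (fun s hs ↦ ?_) isOpen_compl_singleton
    exact (DirichletCharacter.differentiableAt_LFunction _ _ (.inl hs)).differentiableWithinAt
  · refine DifferentiableOn.analyticOnNhd (fun s hs ↦ ?_) isOpen_compl_singleton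
    have h : DifferentiableAt ℂ (DirichletCharacter.LFunction χ) (conj s) :=
      DirichletCharacter.differentiableAt_LFunction _ _ (.inl fun h ↦ hs (by
        have := congrArg conj h
        simpa using this))
    have := h.conj_conj
    rw [Complex.conj_conj] at this
    exact this.differentiableWithinAt
  · refine eventually_of_mem ((continuous_re.isOpen_preimage _ isOpen_Ioi).mem_nhds
      (by simp : 1 < (2 : ℂ).re)) fun t (ht : 1 < t.re) ↦ ?_
    have ht' : 1 < (conj t).re := by simpa using ht
    simp only [DirichletCharacter.LFunction_eq_LSeries _ ht,
      DirichletCharacter.LFunction_eq_LSeries _ ht', LSeries, Complex.conj_tsum]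
    refine tsum_congr fun n ↦ ?_
    rcases eq_or_ne n 0 with rfl | hn
    · simp
    · rw [LSeries.term_of_ne_zero hn, LSeries.term_of_ne_zero hn, map_div₀, conj_natCast_cpow,
        Complex.conj_conj, ← MulChar.star_apply']
      rfl

lemma exists_conj_LFunction_eq {f : ℕ} [NeZero f] {ψ : DirichletCharacter ℂ f}
    (hψ : ψ.IsPrimitive) :
    ∃ κ : ℕ, κ ≤ 1 ∧ ∃ ε : ℂ, ∀ t : ℝ, t ≠ 0 →
      conj (DirichletCharacter.LFunction ψ (1 / 2 + t * I)) =
        ε * funcFactor f κ (1 / 2 + t * I) *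
          DirichletCharacter.LFunction ψ (1 / 2 + t * I) := by
  obtain ⟨κ, hκ, h1, h2⟩ : ∃ κ : ℕ, κ ≤ 1 ∧ (∀ s, ψ.gammaFactor s = Gammaℝ (s + κ)) ∧
      (∀ s, ψ⁻¹.gammaFactor s = Gammaℝ (s + κ)) := by
    have hm : ψ⁻¹ (-1) = conj (ψ (-1)) := (MulChar.star_apply' ψ (-1)).symm
    rcases ψ.even_or_odd with h | h
    · have h' : ψ⁻¹.Even := by rw [DirichletCharacter.Even, hm, h, map_one]
      exact ⟨0, by norm_num, fun s ↦ by simp [h.gammaFactor_def], fun s ↦ by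
        simp [h'.gammaFactor_def]⟩
    · have h' : ψ⁻¹.Odd := by rw [DirichletCharacter.Odd, hm, h, map_neg, map_one]
      exact ⟨1, by norm_num, fun s ↦ by simp [h.gammaFactor_def], fun s ↦ by
        simp [h'.gammaFactor_def]⟩
  refine ⟨κ, hκ, ψ.rootNumber⁻¹, fun t ht ↦ ?_⟩
  set s : ℂ := 1 / 2 + t * I with hs
  have him : s.im ≠ 0 := by simpa [hs] using ht
  have hΓ1 : Gammaℝ (s + κ) ≠ 0 := Gammaℝ_ne_zero_of_im_ne_zero (by simpa using him)
  have hΓ2 : Gammaℝ (1 - s + κ) ≠ 0 := Gammaℝ_ne_zero_of_im_ne_zero (by simpa using him)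
  have hs0 : s ≠ 0 := fun h ↦ him (by simp [h])
  have hs1 : 1 - s ≠ 0 := fun h ↦ him (by
    have := congrArg Complex.im h
    simpa using this)
  have hs2 : 1 - s ≠ 1 := fun h ↦ hs0 (by linear_combination -h)
  have e1 := DirichletCharacter.LFunction_eq_completed_div_gammaFactor ψ s (.inl hs0)
  have e2 := DirichletCharacter.LFunction_eq_completed_div_gammaFactor ψ⁻¹ (1 - s) (.inl hs1)
  rw [h1, eq_div_iff hΓ1] at e1
  rw [h2, eq_div_iff hΓ2, LFunction_inv_eq_conj _ hs2, ← conj_half_add_mul_I, ← hs,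
    Complex.conj_conj] at e2
  have e3 := hψ.completedLFunction_one_sub (1 - s)
  rw [sub_sub_cancel, ← e1, ← conj_half_add_mul_I, ← hs, ← e2] at e3
  have hf : (f : ℂ) ≠ 0 := NeZero.ne _
  have hneg : (f : ℂ) ^ (conj s - 1 / 2) = ((f : ℂ) ^ (s - 1 / 2))⁻¹ := by
    rw [← cpow_neg]
    congr 1
    rw [hs, conj_half_add_mul_I]; ring
  have hfs : (f : ℂ) ^ (s - 1 / 2) ≠ 0 := by simp [cpow_eq_zero_iff, hf]
  rw [hneg] at e3
  by_cases hε : ψ.rootNumber = 0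
  · have : DirichletCharacter.LFunction ψ s = 0 := by
      rw [hε] at e3
      simpa [hΓ1] using e3
    simp [this]
  · rw [funcFactor]
    have hc : conj s = 1 - s := conj_half_add_mul_I t
    rw [hc] at e3
    generalize (f : ℂ) ^ (s - 1 / 2) = F at *
    field_simp
    field_simp at e3
    linear_combination (-1 : ℂ) * e3

end FunctionalEquation

section GaussianShift

lemma norm_cexp_sub_sq (σ t u : ℝ) :
    ‖cexp ((σ + t * I - 1 / 2 - u * I) ^ 2)‖ = Real.exp ((σ - 1 / 2) ^ 2 - (t - u) ^ 2) := by
  rw [Complex.norm_exp]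
  congr 1
  have : ((σ : ℂ) + t * I - 1 / 2 - u * I) ^ 2 =
      (((σ - 1 / 2) ^ 2 - (t - u) ^ 2 : ℝ) : ℂ) + ((2 * (σ - 1 / 2) * (t - u) : ℝ) : ℂ) * I := by
    push_cast
    linear_combination ((t : ℂ) - u) ^ 2 * I_sq
  rw [this, Complex.add_re, Complex.re_ofReal_mul, Complex.ofReal_re]
  simp

/-- Shifting the line of integration from `re s = 1 / 2` to `re s = 3 / 2` against a Gaussian. -/
lemma norm_integral_gaussian_mul_le {G : ℂ → ℂ} {A B K δ u : ℝ} (hAB : A ≤ B) (hK : 0 ≤ K)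
    (hG : ∀ s : ℂ, 1 / 2 ≤ s.re → s.re ≤ 3 / 2 → A ≤ s.im → s.im ≤ B →
      DifferentiableAt ℂ G s)
    (hGK : ∀ s : ℂ, 1 / 2 ≤ s.re → s.re ≤ 3 / 2 → A ≤ s.im → s.im ≤ B → ‖G s‖ ≤ K)
    (hδ : 0 ≤ δ) (hA : A + δ ≤ u) (hB : u ≤ B - δ) :
    ‖∫ t in A..B, (Real.exp (-(t - u) ^ 2) : ℂ) * G (1 / 2 + t * I)‖ ≤
      Real.exp 1 * (∫ t in A..B, Real.exp (-(t - u) ^ 2) * ‖G (3 / 2 + t * I)‖) +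
        2 * K * Real.exp 1 * Real.exp (-δ ^ 2) := by
  set F : ℂ → ℂ := fun s ↦ cexp ((s - 1 / 2 - u * I) ^ 2) * G s with hF
  have hdiff : ∀ s : ℂ, 1 / 2 ≤ s.re → s.re ≤ 3 / 2 → A ≤ s.im → s.im ≤ B →
      DifferentiableAt ℂ F s := fun s h1 h2 h3 h4 ↦
    DifferentiableAt.mul (by fun_prop) (hG s h1 h2 h3 h4)
  have hrect := Complex.integral_boundary_rect_eq_zero_of_differentiableOn F
    (((1 / 2 : ℝ) : ℂ) + A * I) (((3 / 2 : ℝ) : ℂ) + B * I) (by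
      intro s hs
      rw [Complex.mem_reProdIm] at hs
      simp only [Complex.add_re, Complex.ofReal_re, Complex.mul_re, Complex.I_re, mul_zero,
        Complex.ofReal_im, Complex.I_im, mul_one, sub_self, add_zero, Complex.add_im,
        Complex.mul_im, zero_add] at hs
      rw [Set.uIcc_of_le hAB, Set.uIcc_of_le (by norm_num)] at hs
      exact (hdiff s hs.1.1 hs.1.2 hs.2.1 hs.2.2).differentiableWithinAt)
  simp only [Complex.add_re, Complex.ofReal_re, Complex.mul_re, Complex.I_re, mul_zero,
    Complex.ofReal_im, Complex.I_im, mul_one, sub_self, add_zero, Complex.add_im,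
    Complex.mul_im, zero_add, smul_eq_mul] at hrect
  have hhor : ∀ y : ℝ, A ≤ y → y ≤ B → δ ^ 2 ≤ (y - u) ^ 2 →
      ‖∫ x in (1 / 2 : ℝ)..(3 / 2), F (x + y * I)‖ ≤
        K * Real.exp 1 * Real.exp (-δ ^ 2) := by
    intro y hy1 hy2 hy3
    have := intervalIntegral.norm_integral_le_of_norm_le_const (a := (1 / 2 : ℝ)) (b := 3 / 2)
      (f := fun x : ℝ ↦ F (x + y * I)) (C := K * Real.exp 1 * Real.exp (-δ ^ 2)) (by
        intro x hx
        rw [Set.uIoc_of_le (by norm_num)] at hx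
        rw [hF]
        simp only
        rw [norm_mul, norm_cexp_sub_sq, mul_comm, mul_assoc]
        refine mul_le_mul (hGK _ (by simpa using hx.1.le) (by simpa using hx.2) (by simpa using hy1)
          (by simpa using hy2)) ?_ (Real.exp_pos _).le hK
        rw [← Real.exp_add]
        refine Real.exp_le_exp.mpr ?_
        nlinarith [hx.1, hx.2])
    refine this.trans (le_of_eq ?_)
    norm_num
  have hright : ‖∫ t in A..B, F ((3 / 2 : ℝ) + t * I)‖ ≤
      Real.exp 1 * ∫ t in A..B, Real.exp (-(t - u) ^ 2) * ‖G (3 / 2 + t * I)‖ := by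
    rw [← intervalIntegral.integral_const_mul]
    refine (intervalIntegral.norm_integral_le_integral_norm hAB).trans (le_of_eq ?_)
    refine intervalIntegral.integral_congr fun t _ ↦ ?_
    simp only [hF]
    rw [norm_mul, norm_cexp_sub_sq, ← mul_assoc, ← Real.exp_add]
    norm_num
    left; ring
  have hleft : (∫ t in A..B, (Real.exp (-(t - u) ^ 2) : ℂ) * G (1 / 2 + t * I)) =
      ∫ t in A..B, F ((1 / 2 : ℝ) + t * I) := by
    refine intervalIntegral.integral_congr fun t _ ↦ ?_
    simp only [hF]
    push_cast
    congr 2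
    linear_combination (-((t : ℂ) - u) ^ 2) * I_sq
  have h1 := hhor A le_rfl hAB (by nlinarith)
  have h2 := hhor B hAB le_rfl (by nlinarith)
  rw [hleft]
  have hI : ‖∫ t in A..B, F ((1 / 2 : ℝ) + t * I)‖ =
      ‖I * ∫ t in A..B, F ((1 / 2 : ℝ) + t * I)‖ := by simp
  rw [hI, ← sub_eq_zero.mp hrect]
  refine (norm_add_le _ _).trans ?_
  rw [norm_mul, Complex.norm_I, one_mul]
  have h3 := norm_sub_le (∫ x in (1 / 2 : ℝ)..(3 / 2), F (x + A * I))
    (∫ x in (1 / 2 : ℝ)..(3 / 2), F (x + B * I))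
  linarith

/-- A smooth approximation to the indicator function of `[U₁, U₂]`. -/
noncomputable def gaussWindow (U₁ U₂ t : ℝ) : ℝ :=
  (√π)⁻¹ * ∫ u in U₁..U₂, Real.exp (-(t - u) ^ 2)

lemma continuous_gaussWindow (U₁ U₂ : ℝ) : Continuous (gaussWindow U₁ U₂) := by
  refine continuous_const.mul ?_
  exact intervalIntegral.continuous_parametric_intervalIntegral_of_continuous' (by fun_prop) _ _

lemma integral_exp_neg_sub_sq (t : ℝ) : ∫ u : ℝ, Real.exp (-(t - u) ^ 2) = √π := by
  have h := integral_gaussian 1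
  rw [div_one] at h
  rw [← h, ← integral_sub_left_eq_self (fun u ↦ Real.exp (-1 * u ^ 2)) volume t]
  simp

lemma integrable_exp_neg_sub_sq {b : ℝ} (hb : 0 < b) (t : ℝ) :
    Integrable fun u : ℝ ↦ Real.exp (-b * (t - u) ^ 2) :=
  (integrable_exp_neg_mul_sq hb).comp_sub_left t

lemma gaussWindow_nonneg {U₁ U₂ : ℝ} (h : U₁ ≤ U₂) (t : ℝ) : 0 ≤ gaussWindow U₁ U₂ t :=
  mul_nonneg (by positivity) (intervalIntegral.integral_nonneg h fun _ _ ↦ (Real.exp_pos _).le)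

lemma gaussWindow_eq_setIntegral {U₁ U₂ : ℝ} (h : U₁ ≤ U₂) (t : ℝ) :
    gaussWindow U₁ U₂ t = (√π)⁻¹ * ∫ u in Set.Ioc U₁ U₂, Real.exp (-(t - u) ^ 2) := by
  rw [gaussWindow, intervalIntegral.integral_of_le h]

lemma gaussWindow_le_one {U₁ U₂ : ℝ} (h : U₁ ≤ U₂) (t : ℝ) : gaussWindow U₁ U₂ t ≤ 1 := by
  rw [gaussWindow_eq_setIntegral h, inv_mul_le_iff₀ (by positivity), mul_one,
    ← integral_exp_neg_sub_sq t]
  refine setIntegral_le_integral ?_ (ae_of_all _ fun u ↦ (Real.exp_pos _).le)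
  simpa using integrable_exp_neg_sub_sq one_pos t

/-- Gaussian tails. -/
lemma setIntegral_exp_neg_sub_sq_le {H t : ℝ} {S : Set ℝ} (hS : MeasurableSet S)
    (h : ∀ u ∈ S, H ^ 2 ≤ (t - u) ^ 2) :
    (√π)⁻¹ * ∫ u in S, Real.exp (-(t - u) ^ 2) ≤ 2 * Real.exp (-H ^ 2 / 2) := by
  have hi : Integrable fun u : ℝ ↦ Real.exp (-(t - u) ^ 2) := by
    simpa using integrable_exp_neg_sub_sq one_pos t
  have hi2 := integrable_exp_neg_sub_sq (one_half_pos (α := ℝ)) t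
  have h1 : ∫ u in S, Real.exp (-(t - u) ^ 2) ≤
      Real.exp (-H ^ 2 / 2) * ∫ u : ℝ, Real.exp (-(1 / 2) * (t - u) ^ 2) := by
    rw [← integral_const_mul]
    refine (setIntegral_mono_on hi.integrableOn (hi2.const_mul _).integrableOn hS
      fun u hu ↦ ?_).trans (setIntegral_le_integral (hi2.const_mul _)
        (ae_of_all _ fun u ↦ by positivity))
    rw [← Real.exp_add]
    refine Real.exp_le_exp.mpr ?_
    linarith [h u hu]
  have h2 : ∫ u : ℝ, Real.exp (-(1 / 2) * (t - u) ^ 2) = √π * √2 := by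
    rw [integral_sub_left_eq_self (fun u ↦ Real.exp (-(1 / 2) * u ^ 2)) volume t,
      integral_gaussian, ← Real.sqrt_mul Real.pi_pos.le]
    congr 1; ring
  rw [h2] at h1
  rw [inv_mul_le_iff₀ (by positivity)]
  have h3 : √2 ≤ 2 := by
    rw [Real.sqrt_le_left (by norm_num)]; norm_num
  calc _ ≤ _ := h1
    _ ≤ Real.exp (-H ^ 2 / 2) * (√π * 2) := by gcongr
    _ = _ := by ring

lemma gaussWindow_le_of_le {U₁ U₂ H t : ℝ} (h : U₁ ≤ U₂) (hH : 0 ≤ H) (ht : t ≤ U₁ - H) :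
    gaussWindow U₁ U₂ t ≤ 2 * Real.exp (-H ^ 2 / 2) := by
  rw [gaussWindow_eq_setIntegral h]
  refine setIntegral_exp_neg_sub_sq_le measurableSet_Ioc fun u hu ↦ ?_
  nlinarith [hu.1]

lemma gaussWindow_le_of_ge {U₁ U₂ H t : ℝ} (h : U₁ ≤ U₂) (hH : 0 ≤ H) (ht : U₂ + H ≤ t) :
    gaussWindow U₁ U₂ t ≤ 2 * Real.exp (-H ^ 2 / 2) := by
  rw [gaussWindow_eq_setIntegral h]
  refine setIntegral_exp_neg_sub_sq_le measurableSet_Ioc fun u hu ↦ ?_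
  nlinarith [hu.2]

lemma one_sub_gaussWindow_le {U₁ U₂ H t : ℝ} (hH : 0 ≤ H) (h1 : U₁ + H ≤ t) (h2 : t ≤ U₂ - H) :
    1 - gaussWindow U₁ U₂ t ≤ 2 * Real.exp (-H ^ 2 / 2) := by
  have h : U₁ ≤ U₂ := by linarith
  have hi : Integrable fun u : ℝ ↦ Real.exp (-(t - u) ^ 2) := by
    simpa using integrable_exp_neg_sub_sq one_pos t
  have hc := integral_add_compl (s := Set.Ioc U₁ U₂) measurableSet_Ioc hi
  rw [integral_exp_neg_sub_sq] at hc
  have hsub := setIntegral_exp_neg_sub_sq_le (H := H) (t := t)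
    (S := (Set.Ioc U₁ U₂)ᶜ) measurableSet_Ioc.compl (fun u hu ↦ by
      simp only [Set.mem_compl_iff, Set.mem_Ioc, not_and_or, not_lt, not_le] at hu
      rcases hu with hu | hu <;> nlinarith)
  rw [gaussWindow_eq_setIntegral h]
  have hpi : (√π)⁻¹ * √π = 1 := inv_mul_cancel₀ (by positivity)
  calc _ = (√π)⁻¹ * ∫ u in (Set.Ioc U₁ U₂)ᶜ, Real.exp (-(t - u) ^ 2) := by
        rw [← hpi, ← hc]; ring
    _ ≤ _ := hsub

lemma norm_integral_gaussWindow_mul_le {G : ℂ → ℂ} {A B K δ U₁ U₂ : ℝ} (hAB : A ≤ B)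
    (hK : 0 ≤ K)
    (hG : ∀ s : ℂ, 1 / 2 ≤ s.re → s.re ≤ 3 / 2 → A ≤ s.im → s.im ≤ B →
      DifferentiableAt ℂ G s)
    (hGK : ∀ s : ℂ, 1 / 2 ≤ s.re → s.re ≤ 3 / 2 → A ≤ s.im → s.im ≤ B → ‖G s‖ ≤ K)
    (hδ : 0 ≤ δ) (hU : U₁ ≤ U₂) (hA : A + δ ≤ U₁) (hB : U₂ ≤ B - δ) :
    ‖∫ t in A..B, (gaussWindow U₁ U₂ t : ℂ) * G (1 / 2 + t * I)‖ ≤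
      Real.exp 1 * (∫ t in A..B, ‖G (3 / 2 + t * I)‖) +
        2 * K * Real.exp 1 * Real.exp (-δ ^ 2) * (U₂ - U₁) := by
  have hcont : ∀ σ : ℝ, 1 / 2 ≤ σ → σ ≤ 3 / 2 →
      ContinuousOn (fun t : ℝ ↦ G (σ + t * I)) (Set.Icc A B) := by
    intro σ h1 h2 t ht
    have h := (hG (σ + t * I) (by simpa using h1) (by simpa using h2) (by simpa using ht.1)
      (by simpa using ht.2)).continuousAt
    exact (ContinuousAt.comp (f := fun t : ℝ ↦ (σ : ℂ) + t * I) h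
      (by fun_prop)).continuousWithinAt
  have hc1 : ContinuousOn (fun t : ℝ ↦ G (1 / 2 + t * I)) (Set.Icc A B) := by
    simpa using hcont (1 / 2) le_rfl (by norm_num)
  have hc3 : ContinuousOn (fun t : ℝ ↦ G (3 / 2 + t * I)) (Set.Icc A B) := by
    simpa using hcont (3 / 2) (by norm_num) le_rfl
  have hfst : ∀ g : ℝ → ℂ, ContinuousOn g (Set.Icc A B) →
      ContinuousOn (fun p : ℝ × ℝ ↦ g p.1) (Set.Icc A B ×ˢ Set.Icc U₁ U₂) := fun g hg ↦
    hg.comp continuousOn_fst fun p hp ↦ hp.1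
  have hInt : ∀ F : ℝ × ℝ → ℂ, ContinuousOn F (Set.Icc A B ×ˢ Set.Icc U₁ U₂) →
      IntegrableOn F (Set.uIoc A B ×ˢ Set.uIoc U₁ U₂) := fun F hF ↦ by
    rw [Set.uIoc_of_le hAB, Set.uIoc_of_le hU]
    exact (hF.integrableOn_compact (isCompact_Icc.prod isCompact_Icc)).mono_set
      (Set.prod_mono Set.Ioc_subset_Icc_self Set.Ioc_subset_Icc_self)
  have hswap : ∀ g : ℝ → ℂ, ContinuousOn g (Set.Icc A B) →
      ∫ t in A..B, (gaussWindow U₁ U₂ t : ℂ) * g t =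
      ((√π)⁻¹ : ℂ) * ∫ u in U₁..U₂, ∫ t in A..B, (Real.exp (-(t - u) ^ 2) : ℂ) * g t := by
    intro g hg
    rw [← intervalIntegral_intervalIntegral_swap (hInt _ (ContinuousOn.mul
      (by fun_prop) (hfst _ hg))), ← intervalIntegral.integral_const_mul]
    refine intervalIntegral.integral_congr fun t _ ↦ ?_
    simp only [gaussWindow]
    rw [intervalIntegral.integral_mul_const, intervalIntegral.integral_ofReal]
    push_cast
    ring
  have hcn : ContinuousOn (fun t : ℝ ↦ ((‖G (3 / 2 + t * I)‖ : ℝ) : ℂ)) (Set.Icc A B) :=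
    continuous_ofReal.comp_continuousOn hc3.norm
  have hpar : ∀ g : ℝ → ℂ, ContinuousOn g (Set.Icc A B) →
      IntervalIntegrable (fun u ↦ ∫ t in A..B, (Real.exp (-(t - u) ^ 2) : ℂ) * g t)
        volume U₁ U₂ := by
    intro g hg
    have h := (hInt _ (ContinuousOn.mul (f := fun p : ℝ × ℝ ↦
      (Real.exp (-(p.1 - p.2) ^ 2) : ℂ)) (by fun_prop) (hfst _ hg)))
    rw [IntegrableOn, Measure.volume_eq_prod, ← Measure.prod_restrict] at h
    have h2 := h.integral_prod_right
    rw [intervalIntegrable_iff, IntegrableOn]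
    refine h2.congr (ae_of_all _ fun u ↦ ?_)
    simp only
    rw [intervalIntegral.integral_of_le hAB, Set.uIoc_of_le hAB]
    rfl
  have hpi : (√π)⁻¹ ≤ 1 := by
    refine inv_le_one_of_one_le₀ (Real.one_le_sqrt.mpr ?_)
    linarith [Real.pi_gt_three]
  have hreal : ∀ u : ℝ, ∫ t in A..B, (Real.exp (-(t - u) ^ 2) : ℂ) *
      ((‖G (3 / 2 + t * I)‖ : ℝ) : ℂ) =
      ((∫ t in A..B, Real.exp (-(t - u) ^ 2) * ‖G (3 / 2 + t * I)‖ : ℝ) : ℂ) := by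
    intro u
    rw [← intervalIntegral.integral_ofReal]
    push_cast
    rfl
  have hpar3 : IntervalIntegrable (fun u ↦ ∫ t in A..B, Real.exp (-(t - u) ^ 2) *
      ‖G (3 / 2 + t * I)‖) volume U₁ U₂ := by
    have h := hpar _ hcn
    simp only [hreal] at h
    rw [intervalIntegrable_iff] at h ⊢
    exact h.re
  have hmain := hswap _ hcn
  simp only [hreal] at hmain
  rw [intervalIntegral.integral_ofReal] at hmain
  have hmain' : (√π)⁻¹ * ∫ u in U₁..U₂, ∫ t in A..B, Real.exp (-(t - u) ^ 2) *
      ‖G (3 / 2 + t * I)‖ = ∫ t in A..B, gaussWindow U₁ U₂ t * ‖G (3 / 2 + t * I)‖ := by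
    have h : ((∫ t in A..B, gaussWindow U₁ U₂ t * ‖G (3 / 2 + t * I)‖ : ℝ) : ℂ) =
      ∫ t in A..B, (gaussWindow U₁ U₂ t : ℂ) * ((‖G (3 / 2 + t * I)‖ : ℝ) : ℂ) := by
      rw [← intervalIntegral.integral_ofReal]
      push_cast
      rfl
    rw [← h] at hmain
    exact_mod_cast hmain.symm
  have hle : ∫ t in A..B, gaussWindow U₁ U₂ t * ‖G (3 / 2 + t * I)‖ ≤
      ∫ t in A..B, ‖G (3 / 2 + t * I)‖ := by
    refine intervalIntegral.integral_mono_on hAB ?_ ?_ fun t _ ↦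
      mul_le_of_le_one_left (norm_nonneg _) (gaussWindow_le_one hU t)
    · refine ContinuousOn.intervalIntegrable_of_Icc hAB ?_
      exact (continuous_gaussWindow _ _).continuousOn.mul hc3.norm
    · exact ContinuousOn.intervalIntegrable_of_Icc hAB hc3.norm
  rw [hswap _ hc1, norm_mul, norm_inv, Complex.norm_real, Real.norm_of_nonneg (Real.sqrt_nonneg _)]
  have hbound : ‖∫ u in U₁..U₂, ∫ t in A..B, (Real.exp (-(t - u) ^ 2) : ℂ) *
      G (1 / 2 + t * I)‖ ≤ ∫ u in U₁..U₂, (Real.exp 1 * (∫ t in A..B,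
        Real.exp (-(t - u) ^ 2) * ‖G (3 / 2 + t * I)‖) +
        2 * K * Real.exp 1 * Real.exp (-δ ^ 2)) :=
    intervalIntegral.norm_integral_le_of_norm_le hU
      (ae_of_all _ fun u hu ↦ norm_integral_gaussian_mul_le hAB hK hG hGK hδ
        (by linarith [hu.1]) (by linarith [hu.2])) ((hpar3.const_mul _).add (by simp))
  rw [intervalIntegral.integral_add (hpar3.const_mul _) (by simp),
    intervalIntegral.integral_const_mul, intervalIntegral.integral_const, smul_eq_mul] at hbound
  refine (mul_le_mul_of_nonneg_left hbound (by positivity)).trans ?_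
  have h0 : 0 ≤ (U₂ - U₁) * (2 * K * Real.exp 1 * Real.exp (-δ ^ 2)) :=
    mul_nonneg (by linarith) (by positivity)
  calc _ = Real.exp 1 * ((√π)⁻¹ * ∫ u in U₁..U₂, ∫ t in A..B, Real.exp (-(t - u) ^ 2) *
      ‖G (3 / 2 + t * I)‖) + (√π)⁻¹ * ((U₂ - U₁) * (2 * K * Real.exp 1 * Real.exp (-δ ^ 2))) := by
        ring
    _ ≤ Real.exp 1 * (∫ t in A..B, ‖G (3 / 2 + t * I)‖) +
        1 * ((U₂ - U₁) * (2 * K * Real.exp 1 * Real.exp (-δ ^ 2))) := by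
        rw [hmain']
        gcongr
    _ = _ := by ring

end GaussianShift

section DirichletPolynomials

/-- The Dirichlet polynomial `∑_{n ≤ N} c(n) n ^ (-s)`. -/
noncomputable def dirichletPoly (c : ℕ → ℂ) (N : ℕ) (s : ℂ) : ℂ :=
  ∑ n ∈ Ioc 0 N, c n * (n : ℂ) ^ (-s)

lemma differentiable_dirichletPoly (c : ℕ → ℂ) (N : ℕ) : Differentiable ℂ (dirichletPoly c N) := by
  unfold dirichletPoly
  refine Differentiable.fun_sum fun n hn ↦ ?_
  have : NeZero n := ⟨(Finset.mem_Ioc.1 hn).1.ne'⟩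
  fun_prop

lemma conj_dirichletPoly (c : ℕ → ℂ) (N : ℕ) (s : ℂ) :
    (starRingEnd ℂ) (dirichletPoly c N s) =
      dirichletPoly (fun n ↦ (starRingEnd ℂ) (c n)) N ((starRingEnd ℂ) s) := by
  simp only [dirichletPoly, map_sum, map_mul, conj_natCast_cpow, map_neg]

lemma norm_dirichletPoly_le {c : ℕ → ℂ} {N : ℕ} {s : ℂ} (hc : ∀ n ∈ Ioc 0 N, ‖c n‖ ≤ n)
    (hs : -(1 / 2) ≤ s.re) : ‖dirichletPoly c N s‖ ≤ (N : ℝ) ^ 3 := by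
  have : ∀ n ∈ Ioc 0 N, ‖c n * (n : ℂ) ^ (-s)‖ ≤ (N : ℝ) ^ 2 := by
    intro n hn
    obtain ⟨h0, hN⟩ := Finset.mem_Ioc.1 hn
    have h1 : (1 : ℝ) ≤ n := by exact_mod_cast h0
    have hN' : (n : ℝ) ≤ N := by exact_mod_cast hN
    rw [norm_mul, norm_natCast_cpow_of_pos h0, sq]
    refine mul_le_mul ((hc n hn).trans hN') ?_ (by positivity) (by positivity)
    calc (n : ℝ) ^ (-s).re ≤ (n : ℝ) ^ (1 : ℝ) :=
          Real.rpow_le_rpow_of_exponent_le h1 (by rw [Complex.neg_re]; linarith)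
      _ ≤ N := by rwa [Real.rpow_one]
  calc _ ≤ ∑ n ∈ Ioc 0 N, ‖c n * (n : ℂ) ^ (-s)‖ := norm_sum_le _ _
    _ ≤ ∑ n ∈ Ioc 0 N, (N : ℝ) ^ 2 := Finset.sum_le_sum this
    _ = (N : ℝ) ^ 3 := by
        rw [Finset.sum_const, Nat.card_Ioc, nsmul_eq_mul, tsub_zero]; ring

lemma natCast_cpow_neg_add_mul_I {n : ℕ} (hn : n ≠ 0) (σ t : ℝ) :
    (n : ℂ) ^ (-(σ + t * I)) = (((n : ℝ) ^ (-σ) : ℝ) : ℂ) * (n : ℂ) ^ (-(t * I)) := by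
  rw [neg_add, cpow_add _ _ (by exact_mod_cast hn), Complex.ofReal_cpow (Nat.cast_nonneg n)]
  simp

lemma dirichletPoly_add_mul_I (c : ℕ → ℂ) (N : ℕ) (σ t : ℝ) :
    dirichletPoly c N (σ + t * I) =
      ∑ n ∈ Ioc 0 N, (c n * (((n : ℝ) ^ (-σ) : ℝ) : ℂ)) * (n : ℂ) ^ (-(t * I)) := by
  refine Finset.sum_congr rfl fun n hn ↦ ?_
  rw [natCast_cpow_neg_add_mul_I (Finset.mem_Ioc.1 hn).1.ne', mul_assoc]

lemma support_term_subset {c : ArithmeticFunction ℂ} {N : ℕ} (h : ∀ n, N < n → c n = 0) (s : ℂ) :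
    Function.support (LSeries.term c s) ⊆ (Ioc 0 N : Finset ℕ) := by
  intro n hn
  rw [Function.mem_support] at hn
  rw [Finset.coe_Ioc]
  refine ⟨Nat.pos_of_ne_zero fun h0 ↦ hn (by simp [h0]), not_lt.1 fun h1 ↦ hn ?_⟩
  rw [LSeries.term_def, h n h1]; simp

lemma LSeriesSummable_of_bounded_support {c : ArithmeticFunction ℂ} {N : ℕ}
    (h : ∀ n, N < n → c n = 0) (s : ℂ) : LSeriesSummable (c ·) s :=
  summable_of_hasFiniteSupport ((Finset.finite_toSet _).subset (support_term_subset h s))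

lemma LSeries_eq_dirichletPoly {c : ArithmeticFunction ℂ} {N : ℕ}
    (h : ∀ n, N < n → c n = 0) (s : ℂ) : LSeries (c ·) s = dirichletPoly c N s := by
  rw [LSeries, dirichletPoly, tsum_eq_sum' (support_term_subset h s)]
  refine Finset.sum_congr rfl fun n hn ↦ ?_
  rw [LSeries.term_of_ne_zero (Finset.mem_Ioc.1 hn).1.ne', cpow_neg, div_eq_mul_inv]

lemma mul_apply_eq_zero_of_lt {c d : ArithmeticFunction ℂ} {M N : ℕ}
    (hc : ∀ n, M < n → c n = 0) (hd : ∀ n, N < n → d n = 0) (n : ℕ) (hn : M * N < n) :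
    (c * d) n = 0 := by
  rw [ArithmeticFunction.mul_apply]
  refine Finset.sum_eq_zero fun x hx ↦ ?_
  obtain ⟨h1, -⟩ := Nat.mem_divisorsAntidiagonal.1 hx
  by_cases hM : M < x.1
  · rw [hc _ hM, zero_mul]
  · rw [hd x.2, mul_zero]
    by_contra! hN
    have := Nat.mul_le_mul (not_lt.1 hM) hN
    omega

lemma dirichletPoly_mul {c d : ArithmeticFunction ℂ} {M N : ℕ}
    (hc : ∀ n, M < n → c n = 0) (hd : ∀ n, N < n → d n = 0) (s : ℂ) :
    dirichletPoly c M s * dirichletPoly d N s = dirichletPoly (c * d : ArithmeticFunction ℂ) (M * N) s := by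
  rw [← LSeries_eq_dirichletPoly hc, ← LSeries_eq_dirichletPoly hd,
    ← LSeries_eq_dirichletPoly (mul_apply_eq_zero_of_lt hc hd)]
  exact (ArithmeticFunction.LSeries_mul' (LSeriesSummable_of_bounded_support hc s)
    (LSeriesSummable_of_bounded_support hd s)).symm

lemma mul_apply_congr_of_le {c d d' : ArithmeticFunction ℂ} {N : ℕ}
    (h : ∀ n ≤ N, d n = d' n) {n : ℕ} (hn : n ≤ N) : (c * d) n = (c * d') n := by
  rw [ArithmeticFunction.mul_apply, ArithmeticFunction.mul_apply]
  refine Finset.sum_congr rfl fun x hx ↦ ?_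
  rw [h x.2 ((Nat.divisor_le (Nat.snd_mem_divisors_of_mem_antidiagonal hx)).trans hn)]

end DirichletPolynomials

section Coefficients

variable {f : ℕ} (ψ : DirichletCharacter ℂ f)

lemma chiArith_apply {n : ℕ} (hn : n ≠ 0) : chiArith ψ n = ψ n := by
  simp [chiArith, hn]

lemma chiArith_mul_self_apply {n : ℕ} (hn : n ≠ 0) :
    (chiArith ψ * chiArith ψ) n = divisorCount n * ψ n := by
  rw [ArithmeticFunction.mul_apply, divisorCount_eq_sum]
  push_cast
  rw [Finset.sum_mul]
  refine Finset.sum_congr rfl fun x hx ↦ ?_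
  obtain ⟨h1, -⟩ := Nat.mem_divisorsAntidiagonal.1 hx
  rw [← h1] at hn
  rw [chiArith_apply _ (left_ne_zero_of_mul hn), chiArith_apply _ (right_ne_zero_of_mul hn),
    ← map_mul, ← h1]
  push_cast
  ring

/-- The coefficients of the finite Euler product `∏_{p ∣ r} (1 - ψ(p) p ^ (-s))`, for squarefree
`r`. -/
noncomputable def eulerCoeff (r : ℕ) : ArithmeticFunction ℂ :=
  ⟨fun e ↦ if e ∈ r.divisors then (ArithmeticFunction.moebius e : ℂ) * ψ e else 0, by simp⟩

lemma eulerCoeff_apply (r e : ℕ) : eulerCoeff ψ r e =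
    if e ∈ r.divisors then (ArithmeticFunction.moebius e : ℂ) * ψ e else 0 := rfl

lemma norm_eulerCoeff_le (r e : ℕ) : ‖eulerCoeff ψ r e‖ ≤ if e ∈ r.divisors then 1 else 0 := by
  rw [eulerCoeff_apply]
  split_ifs with h
  · rw [norm_mul, Complex.norm_intCast]
    refine mul_le_one₀ ?_ (norm_nonneg _) (ψ.norm_le_one _)
    exact_mod_cast ArithmeticFunction.abs_moebius_le_one
  · simp

lemma eulerCoeff_eq_zero_of_lt {r e : ℕ} (h : r < e) : eulerCoeff ψ r e = 0 := by
  rw [eulerCoeff_apply, if_neg fun h' ↦ (Nat.divisor_le h').not_gt h]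

lemma eulerCoeff_mul_chiArith_apply {r n : ℕ} (hr : r ≠ 0) (hn : n ≠ 0) :
    (eulerCoeff ψ r * chiArith ψ) n = if n.Coprime r then ψ n else 0 := by
  have h1 : (eulerCoeff ψ r * chiArith ψ) n =
      ∑ e ∈ n.divisors, (if e ∈ r.divisors then (ArithmeticFunction.moebius e : ℂ) else 0) * ψ n := by
    rw [ArithmeticFunction.mul_apply, ← Nat.sum_divisorsAntidiagonal
      (fun e _ ↦ (if e ∈ r.divisors then (ArithmeticFunction.moebius e : ℂ) else 0) * ψ n)]
    refine Finset.sum_congr rfl fun x hx ↦ ?_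
    obtain ⟨h1, -⟩ := Nat.mem_divisorsAntidiagonal.1 hx
    rw [chiArith_apply _ (right_ne_zero_of_mul (h1 ▸ hn)), eulerCoeff_apply]
    split_ifs
    · rw [← h1, Nat.cast_mul, map_mul]; ring
    · simp
  have h2 : ∑ e ∈ n.divisors, (if e ∈ r.divisors then (ArithmeticFunction.moebius e : ℂ) else 0) =
      if n.gcd r = 1 then 1 else 0 := by
    have h := sum_divisors_moebius_eq (n.gcd r)
    have h3 : (n.gcd r).divisors = {e ∈ n.divisors | e ∈ r.divisors} := by
      ext e
      simp only [Nat.mem_divisors, Finset.mem_filter, Nat.dvd_gcd_iff]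
      have := Nat.gcd_ne_zero_left (n := r) hn
      tauto
    rw [← Finset.sum_filter, ← h3]
    exact_mod_cast congrArg (fun x : ℝ ↦ (x : ℂ)) h
  rw [h1, ← Finset.sum_mul, h2]
  simp only [Nat.Coprime]
  split_ifs <;> simp

lemma norm_eulerCoeff_mul_apply_le {r : ℕ} {c : ArithmeticFunction ℂ} {C : ℝ} (hC : 0 ≤ C)
    (hc : ∀ n ≠ 0, ‖c n‖ ≤ C * divisorCount n) {n : ℕ} (hn : n ≠ 0) :
    ‖(eulerCoeff ψ r * c) n‖ ≤ divisorCount r * C * divisorCount n := by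
  rw [ArithmeticFunction.mul_apply]
  have h1 : ∀ x ∈ n.divisorsAntidiagonal, ‖eulerCoeff ψ r x.1 * c x.2‖ ≤
      (if x.1 ∈ r.divisors then 1 else 0) * (C * divisorCount n) := by
    intro x hx
    obtain ⟨h1, -⟩ := Nat.mem_divisorsAntidiagonal.1 hx
    rw [norm_mul]
    refine mul_le_mul (norm_eulerCoeff_le ψ r x.1) ?_ (norm_nonneg _) (by split_ifs <;> norm_num)
    refine (hc _ (right_ne_zero_of_mul (h1 ▸ hn))).trans ?_
    exact mul_le_mul_of_nonneg_left (divisorCount_mono_of_dvd ⟨x.1, by rw [← h1, mul_comm]⟩ hn) hC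
  refine (norm_sum_le _ _).trans ((Finset.sum_le_sum h1).trans ?_)
  rw [← Finset.sum_mul, mul_assoc]
  refine mul_le_mul_of_nonneg_right ?_ (mul_nonneg hC (divisorCount_nonneg _))
  rw [Nat.sum_divisorsAntidiagonal (fun e _ ↦ if e ∈ r.divisors then (1 : ℝ) else 0),
    ← Finset.sum_filter, Finset.sum_const, nsmul_eq_mul, mul_one, divisorCount]
  exact_mod_cast Finset.card_le_card fun e he ↦ (Finset.mem_filter.1 he).2

lemma prod_one_sub_eq_dirichletPoly {q : ℕ} (s : ℂ) :
    ∏ p ∈ q.primeFactors, (1 - ψ p * (p : ℂ) ^ (-s)) =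
      dirichletPoly (eulerCoeff ψ (∏ p ∈ q.primeFactors, p)) (∏ p ∈ q.primeFactors, p) s := by
  set r := ∏ p ∈ q.primeFactors, p with hr
  have hp : ∀ p ∈ q.primeFactors, p.Prime := fun p hp ↦ Nat.prime_of_mem_primeFactors hp
  have hrf : r.primeFactors = q.primeFactors := Nat.primeFactors_prod hp
  have hsq : Squarefree r := by
    rw [hr]
    refine Finset.squarefree_prod_of_pairwise_isCoprime ?_ fun p h ↦ (hp p h).squarefree
    intro a ha b hb hab
    exact Nat.coprime_iff_isRelPrime.1 ((Nat.coprime_primes (hp a ha) (hp b hb)).2 hab)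
  let F : ArithmeticFunction ℂ := ⟨fun n ↦ if n = 0 then 0 else ψ n * (n : ℂ) ^ (-s), by simp⟩
  have hF : ∀ n ≠ 0, F n = ψ n * (n : ℂ) ^ (-s) := fun n hn ↦ by simp [F, hn]
  have hFm : F.IsMultiplicative := by
    rw [ArithmeticFunction.IsMultiplicative.iff_ne_zero]
    refine ⟨by simp [hF], fun {m n} hm hn _ ↦ ?_⟩
    rw [hF _ hm, hF _ hn, hF _ (mul_ne_zero hm hn), Nat.cast_mul, map_mul, Nat.cast_mul,
      natCast_mul_natCast_cpow]
    ring
  have h := ArithmeticFunction.IsMultiplicative.prodPrimeFactors_one_sub_of_squarefree F hFm hsq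
  rw [hrf] at h
  rw [← Finset.prod_congr rfl fun p h' ↦ by rw [← hF p (hp p h').ne_zero], h, dirichletPoly]
  have hr0 : r ≠ 0 := hsq.ne_zero
  have hsub : r.divisors ⊆ Ioc 0 r := fun e he ↦ Finset.mem_Ioc.2
    ⟨Nat.pos_of_mem_divisors he, Nat.divisor_le he⟩
  rw [← Finset.sum_subset hsub fun e _ he ↦ by rw [eulerCoeff_apply, if_neg he, zero_mul]]
  refine Finset.sum_congr rfl fun e he ↦ ?_
  rw [hF _ (Nat.pos_of_mem_divisors he).ne', eulerCoeff_apply, if_pos he, mul_assoc]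

end Coefficients

section MainTerm

/-- The truncation of an arithmetic function to `n ≤ N`. -/
noncomputable def truncArith (c : ArithmeticFunction ℂ) (N : ℕ) : ArithmeticFunction ℂ :=
  ⟨fun n ↦ if n ≤ N then c n else 0, by simp⟩

lemma truncArith_of_le (c : ArithmeticFunction ℂ) {n N : ℕ} (h : n ≤ N) :
    truncArith c N n = c n := if_pos h

lemma truncArith_of_lt (c : ArithmeticFunction ℂ) {n N : ℕ} (h : N < n) :
    truncArith c N n = 0 := if_neg h.not_ge

lemma dirichletPoly_truncArith (c : ArithmeticFunction ℂ) (N : ℕ) (s : ℂ) :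
    dirichletPoly (truncArith c N) N s = dirichletPoly c N s :=
  Finset.sum_congr rfl fun n hn ↦ by rw [truncArith_of_le c (Finset.mem_Ioc.1 hn).2]

variable {f : ℕ} (ψ : DirichletCharacter ℂ f)

lemma norm_chiArith_mul_self_apply_le (n : ℕ) :
    ‖(chiArith ψ * chiArith ψ) n‖ ≤ divisorCount n := by
  rcases eq_or_ne n 0 with rfl | hn
  · simpa using divisorCount_nonneg 0
  · rw [chiArith_mul_self_apply _ hn, norm_mul, Complex.norm_real,
      Real.norm_of_nonneg (divisorCount_nonneg n)]
    exact mul_le_of_le_one_right (divisorCount_nonneg n) (ψ.norm_le_one _)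

lemma divisorCount_le_self (n : ℕ) : divisorCount n ≤ n := by
  unfold divisorCount
  exact_mod_cast Nat.card_divisors_le_self n

/-- The coefficients of the square of `∏_{p ∣ r} (1 - ψ(p) p ^ (-s))` times the truncated
Dirichlet series of `L(s, ψ) ^ 2`. -/
noncomputable def mainCoeff (r N : ℕ) : ArithmeticFunction ℂ :=
  eulerCoeff ψ r * (eulerCoeff ψ r * truncArith (chiArith ψ * chiArith ψ) N)

lemma dirichletPoly_mainCoeff (r N : ℕ) (s : ℂ) :
    dirichletPoly (mainCoeff ψ r N) (r * (r * N)) s =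
      dirichletPoly (eulerCoeff ψ r) r s ^ 2 * dirichletPoly (chiArith ψ * chiArith ψ :
        ArithmeticFunction ℂ) N s := by
  have h1 : ∀ n, r < n → eulerCoeff ψ r n = 0 := fun n hn ↦ eulerCoeff_eq_zero_of_lt ψ hn
  have h2 : ∀ n, N < n → truncArith (chiArith ψ * chiArith ψ) N n = 0 :=
    fun n hn ↦ truncArith_of_lt _ hn
  rw [mainCoeff, ← dirichletPoly_mul h1 (mul_apply_eq_zero_of_lt h1 h2), ← dirichletPoly_mul h1 h2,
    dirichletPoly_truncArith]
  ring

lemma norm_mainCoeff_le (r N : ℕ) {n : ℕ} (hn : n ≠ 0) :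
    ‖mainCoeff ψ r N n‖ ≤ divisorCount r ^ 2 * divisorCount n := by
  have hr := divisorCount_nonneg r
  have h1 : ∀ n ≠ 0, ‖truncArith (chiArith ψ * chiArith ψ) N n‖ ≤ 1 * divisorCount n := by
    intro n _
    rw [one_mul]
    by_cases h : n ≤ N
    · rw [truncArith_of_le _ h]; exact norm_chiArith_mul_self_apply_le ψ n
    · rw [truncArith_of_lt _ (not_le.1 h), norm_zero]; exact divisorCount_nonneg n
  have h2 := norm_eulerCoeff_mul_apply_le ψ (r := r) (by positivity)
    (fun n hn ↦ norm_eulerCoeff_mul_apply_le ψ (r := r) zero_le_one h1 hn) hn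
  refine h2.trans (le_of_eq ?_)
  ring

lemma mainCoeff_apply_of_le {r N n : ℕ} (hr : r ≠ 0) (hn : n ≠ 0) (hN : n ≤ N) :
    mainCoeff ψ r N n = if n.Coprime r then divisorCount n * ψ n else 0 := by
  have h1 : mainCoeff ψ r N n =
      ((eulerCoeff ψ r * chiArith ψ) * (eulerCoeff ψ r * chiArith ψ)) n := by
    rw [mainCoeff, mul_apply_congr_of_le (d' := eulerCoeff ψ r * (chiArith ψ * chiArith ψ))
      (fun n hn ↦ mul_apply_congr_of_le (fun k hk ↦ truncArith_of_le _ hk) hn) hN]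
    congr 1
    ring
  rw [h1, ArithmeticFunction.mul_apply, divisorCount_eq_sum]
  have h2 : ∀ x ∈ n.divisorsAntidiagonal, (eulerCoeff ψ r * chiArith ψ) x.1 *
      (eulerCoeff ψ r * chiArith ψ) x.2 = if n.Coprime r then ψ n else 0 := by
    intro x hx
    obtain ⟨h1, -⟩ := Nat.mem_divisorsAntidiagonal.1 hx
    have hn' := hn
    rw [← h1] at hn' ⊢
    rw [eulerCoeff_mul_chiArith_apply _ hr (left_ne_zero_of_mul hn'),
      eulerCoeff_mul_chiArith_apply _ hr (right_ne_zero_of_mul hn'), Nat.cast_mul, map_mul]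
    simp only [Nat.coprime_mul_iff_left]
    split_ifs <;> simp_all
  rw [Finset.sum_congr rfl h2]
  split_ifs <;> simp

lemma norm_mainCoeff_sq_div_of_le {q N n : ℕ} [NeZero q] (hf : f ∣ q) (hn : n ≠ 0) (hN : n ≤ N) :
    ‖mainCoeff ψ (∏ p ∈ q.primeFactors, p) N n‖ ^ 2 / n = divisorSqCoprime q n := by
  have hp : ∀ p ∈ q.primeFactors, p.Prime := fun p hp ↦ Nat.prime_of_mem_primeFactors hp
  have hr : (∏ p ∈ q.primeFactors, p) ≠ 0 :=
    Finset.prod_ne_zero_iff.2 fun p h ↦ (hp p h).ne_zero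
  have hiff : n.Coprime (∏ p ∈ q.primeFactors, p) ↔ n.Coprime q := by
    rw [← Nat.disjoint_primeFactors hn hr, ← Nat.disjoint_primeFactors hn (NeZero.ne q),
      Nat.primeFactors_prod hp]
  rw [mainCoeff_apply_of_le ψ hr hn hN, divisorSqCoprime_apply, coprimeInv_apply]
  simp only [hiff]
  split_ifs with h
  · have hu : IsUnit (n : ZMod f) := (ZMod.isUnit_iff_coprime n f).2 (h.coprime_dvd_right hf)
    have h1 : ‖ψ n‖ = 1 := by
      obtain ⟨u, hu⟩ := hu
      rw [← hu]
      exact ψ.unit_norm_eq_one u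
    rw [norm_mul, h1, Complex.norm_real, Real.norm_of_nonneg (divisorCount_nonneg n)]
    ring
  · simp

lemma one_add_log_mul_le {r : ℕ} (N : ℕ) (hr : 0 < r) :
    1 + Real.log ((r * N : ℕ) : ℝ) ≤ (1 + Real.log r) * (1 + Real.log N) := by
  rcases Nat.eq_zero_or_pos N with rfl | hN
  · simpa using Real.log_natCast_nonneg r
  · rw [Nat.cast_mul, Real.log_mul (by positivity) (by positivity)]
    nlinarith [mul_nonneg (Real.log_natCast_nonneg r) (Real.log_natCast_nonneg N)]

lemma exists_abs_integral_norm_sq_mainCoeff_sub_le {q : ℕ} [NeZero q] (hf : f ∣ q) :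
    ∃ C : ℝ, 0 ≤ C ∧ ∀ N : ℕ, 0 < N → ∀ a b : ℝ, a ≤ b →
      |(∫ t in a..b, ‖dirichletPoly (mainCoeff ψ (∏ p ∈ q.primeFactors, p) N)
          ((∏ p ∈ q.primeFactors, p) * ((∏ p ∈ q.primeFactors, p) * N)) (1 / 2 + t * I)‖ ^ 2) -
        (b - a) * (1 / (4 * π ^ 2) * ((q.totient : ℝ) / q) ^ 2 *
          (∏ p ∈ q.primeFactors, (1 - 2 / ((p : ℝ) + 1))) * Real.log N ^ 4)| ≤
        C * ((b - a) + N) * (1 + Real.log N) ^ 3 := by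
  set r := ∏ p ∈ q.primeFactors, p with hrdef
  have hr : 0 < r := Finset.prod_pos fun p h ↦ (Nat.prime_of_mem_primeFactors h).pos
  obtain ⟨C1, hC1, h1⟩ := exists_abs_integral_norm_sq_half_sub_le (divisorCount r ^ 2)
  obtain ⟨C2, hC2, h2⟩ := exists_abs_sum_divisorSqCoprime_sub_le q
  set L : ℝ := (1 + Real.log r) ^ 2 with hL
  have hL0 : 0 ≤ L := sq_nonneg _
  refine ⟨C1 * (r * r : ℕ) * L ^ 3 + (C2 + divisorCount r ^ 4 * (r * r : ℕ) * L ^ 3),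
    by positivity, fun N hN a b hab ↦ ?_⟩
  have hN1 := one_le_one_add_log N
  have hlog : 1 + Real.log ((r * (r * N) : ℕ) : ℝ) ≤ L * (1 + Real.log N) := by
    refine (one_add_log_mul_le _ hr).trans ?_
    rw [hL, sq, mul_assoc]
    exact mul_le_mul_of_nonneg_left (one_add_log_mul_le _ hr)
      (zero_le_one.trans (one_le_one_add_log r))
  have hlog0 : 0 ≤ 1 + Real.log ((r * (r * N) : ℕ) : ℝ) :=
    zero_le_one.trans (one_le_one_add_log _)
  have hlog3 := pow_le_pow_left₀ hlog0 hlog 3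
  rw [mul_pow] at hlog3
  have e1 := h1 (r * (r * N)) (mainCoeff ψ r N)
    (fun n hn ↦ norm_mainCoeff_le ψ r N (Finset.mem_Ioc.1 hn).1.ne') a b
  have hInt : ∀ t : ℝ, dirichletPoly (mainCoeff ψ r N) (r * (r * N)) (1 / 2 + t * I) =
      ∑ n ∈ Ioc 0 (r * (r * N)), (mainCoeff ψ r N n * (((n : ℝ) ^ (-(1 / 2) : ℝ) : ℝ) : ℂ)) *
        (n : ℂ) ^ (-(t * I)) := fun t ↦ by
    have h := dirichletPoly_add_mul_I (mainCoeff ψ r N) (r * (r * N)) (1 / 2) t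
    rw [← h]
    push_cast
    rfl
  simp only [← hInt] at e1
  set J := ∫ t in a..b, ‖dirichletPoly (mainCoeff ψ r N) (r * (r * N)) (1 / 2 + t * I)‖ ^ 2
  have hNr : N ≤ r * (r * N) := by
    rw [← mul_assoc]; exact Nat.le_mul_of_pos_left _ (by positivity)
  have hsplit : ∑ n ∈ Ioc 0 (r * (r * N)), ‖mainCoeff ψ r N n‖ ^ 2 / n =
      ∑ n ∈ Ioc 0 N, divisorSqCoprime q n +
        ∑ n ∈ Ioc N (r * (r * N)), ‖mainCoeff ψ r N n‖ ^ 2 / n := by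
    rw [← Finset.sum_Ioc_consecutive _ (Nat.zero_le N) hNr]
    congr 1
    refine Finset.sum_congr rfl fun n hn ↦ ?_
    rw [hrdef, norm_mainCoeff_sq_div_of_le ψ hf (Finset.mem_Ioc.1 hn).1.ne' (Finset.mem_Ioc.1 hn).2]
  have hNpos : (0 : ℝ) < N := by exact_mod_cast hN
  have htail : ∑ n ∈ Ioc N (r * (r * N)), ‖mainCoeff ψ r N n‖ ^ 2 / n ≤
      divisorCount r ^ 4 * (r * r : ℕ) * L ^ 3 * (1 + Real.log N) ^ 3 := by
    calc _ ≤ ∑ n ∈ Ioc N (r * (r * N)), divisorCount r ^ 4 / N * divisorCount n ^ 2 := by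
          refine Finset.sum_le_sum fun n hn ↦ ?_
          obtain ⟨ha, -⟩ := Finset.mem_Ioc.1 hn
          have hn0 : n ≠ 0 := by omega
          have hb := pow_le_pow_left₀ (norm_nonneg _) (norm_mainCoeff_le ψ r N hn0) 2
          have : (N : ℝ) ≤ n := by exact_mod_cast ha.le
          calc _ ≤ (divisorCount r ^ 2 * divisorCount n) ^ 2 / N := by gcongr
            _ = _ := by ring
      _ ≤ ∑ n ∈ Ioc 0 (r * (r * N)), divisorCount r ^ 4 / N * divisorCount n ^ 2 :=
          Finset.sum_le_sum_of_subset_of_nonneg (Finset.Ioc_subset_Ioc_left (Nat.zero_le N))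
            fun n _ _ ↦ by positivity
      _ ≤ divisorCount r ^ 4 / N * ((r * (r * N) : ℕ) *
            (L ^ 3 * (1 + Real.log N) ^ 3)) := by
          rw [← Finset.mul_sum]
          refine mul_le_mul_of_nonneg_left ((sum_divisorCount_sq_le _).trans ?_) (by positivity)
          gcongr
      _ = _ := by
          push_cast
          field_simp
  have htail0 : 0 ≤ ∑ n ∈ Ioc N (r * (r * N)), ‖mainCoeff ψ r N n‖ ^ 2 / n :=
    Finset.sum_nonneg fun _ _ ↦ by positivity
  have e2 := h2 N hN
  rw [hsplit] at e1
  set S := ∑ n ∈ Ioc 0 N, divisorSqCoprime q n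
  set R := ∑ n ∈ Ioc N (r * (r * N)), ‖mainCoeff ψ r N n‖ ^ 2 / n
  set M := 1 / (4 * π ^ 2) * ((q.totient : ℝ) / q) ^ 2 *
          (∏ p ∈ q.primeFactors, (1 - 2 / ((p : ℝ) + 1))) * Real.log N ^ 4
  set P := (1 + Real.log (N : ℝ)) ^ 3
  have hP : 0 ≤ P := by positivity
  have e3 : |J - (b - a) * (S + R)| ≤ C1 * (r * r : ℕ) * L ^ 3 * (N * P) := by
    refine e1.trans ?_
    calc _ ≤ C1 * (r * (r * N) : ℕ) * (L ^ 3 * P) := by gcongr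
      _ = _ := by push_cast; ring
  have e4 : |(b - a) * ((S + R) - M)| ≤
      (b - a) * ((C2 + divisorCount r ^ 4 * (r * r : ℕ) * L ^ 3) * P) := by
    rw [abs_mul, abs_of_nonneg (sub_nonneg.2 hab)]
    refine mul_le_mul_of_nonneg_left ?_ (sub_nonneg.2 hab)
    rw [add_mul]
    rw [abs_le] at e2 ⊢
    constructor <;> linarith [e2.1, e2.2]
  have e5 : |J - (b - a) * M| ≤ |J - (b - a) * (S + R)| + |(b - a) * ((S + R) - M)| := by
    refine le_trans (le_of_eq ?_) (abs_add_le _ _)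
    congr 1; ring
  refine e5.trans ((add_le_add e3 e4).trans ?_)
  have hX : 0 ≤ C1 * (r * r : ℕ) * L ^ 3 := by positivity
  have hY : 0 ≤ C2 + divisorCount r ^ 4 * (r * r : ℕ) * L ^ 3 := by positivity
  have hba : 0 ≤ b - a := sub_nonneg.2 hab
  generalize C1 * (r * r : ℕ) * L ^ 3 = X at hX ⊢
  generalize C2 + divisorCount r ^ 4 * (r * r : ℕ) * L ^ 3 = Y at hY ⊢
  have h : 0 ≤ X * (b - a) * P + Y * N * P := by positivity
  calc X * (N * P) + (b - a) * (Y * P) ≤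
        X * (N * P) + (b - a) * (Y * P) + (X * (b - a) * P + Y * N * P) := le_add_of_nonneg_right h
    _ = _ := by ring

end MainTerm

section ShiftedMeanSquares

variable {f : ℕ} (ψ : DirichletCharacter ℂ f)

lemma exists_integral_norm_sq_dirichletPoly_reflect_le :
    ∃ C : ℝ, 0 ≤ C ∧ ∀ (N : ℕ) (a b : ℝ), a ≤ b →
      (∫ t in a..b, ‖dirichletPoly (fun n ↦ (starRingEnd ℂ) ((chiArith ψ * chiArith ψ) n)) N
        (1 - (3 / 2 + t * I))‖ ^ 2) ≤
        C * ((b - a) + N) * (N : ℝ) ^ 2 * (1 + Real.log N) ^ 3 := by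
  obtain ⟨C, hC, h⟩ := exists_integral_norm_sq_neg_half_le
  refine ⟨C, hC, fun N a b hab ↦ ?_⟩
  have h1 := h N (chiArith ψ * chiArith ψ : ArithmeticFunction ℂ)
    (fun n _ ↦ norm_chiArith_mul_self_apply_le ψ n) a b hab
  refine (le_of_eq (intervalIntegral.integral_congr fun t _ ↦ ?_)).trans h1
  have h2 := dirichletPoly_add_mul_I (chiArith ψ * chiArith ψ : ArithmeticFunction ℂ) N (-(1 / 2)) t
  rw [neg_neg] at h2
  rw [← h2, ← RCLike.norm_conj (dirichletPoly _ N (((-(1 / 2) : ℝ) : ℂ) + t * I)),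
    conj_dirichletPoly]
  congr 3
  simp only [map_add, map_mul, Complex.conj_ofReal, Complex.conj_I]
  push_cast
  ring

lemma LFunction_eq_LSeries_chiArith [NeZero f] {s : ℂ} (hs : 1 < s.re) :
    DirichletCharacter.LFunction ψ s = LSeries (chiArith ψ ·) s := by
  rw [DirichletCharacter.LFunction_eq_LSeries ψ hs]
  exact LSeries_congr (fun {n} hn ↦ (chiArith_apply ψ hn).symm) s

lemma LSeriesSummable_chiArith {s : ℂ} (hs : 1 < s.re) : LSeriesSummable (chiArith ψ ·) s :=
  (LSeriesSummable_congr s fun {_} hn ↦ (chiArith_apply ψ hn).symm).1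
    (DirichletCharacter.LSeriesSummable_of_one_lt_re ψ hs)

lemma LSeriesSummable_chiArith_mul_self {s : ℂ} (hs : 1 < s.re) :
    LSeriesSummable ((chiArith ψ * chiArith ψ : ArithmeticFunction ℂ) ·) s :=
  ArithmeticFunction.LSeriesSummable_mul (LSeriesSummable_chiArith ψ hs)
    (LSeriesSummable_chiArith ψ hs)

lemma LFunction_sq_eq_LSeries [NeZero f] {s : ℂ} (hs : 1 < s.re) :
    DirichletCharacter.LFunction ψ s ^ 2 =
      LSeries ((chiArith ψ * chiArith ψ : ArithmeticFunction ℂ) ·) s := by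
  rw [LFunction_eq_LSeries_chiArith ψ hs, sq]
  exact (ArithmeticFunction.LSeries_mul' (LSeriesSummable_chiArith ψ hs)
    (LSeriesSummable_chiArith ψ hs)).symm

lemma dirichletPoly_eq_sum_term (c : ℕ → ℂ) (N : ℕ) (s : ℂ) :
    dirichletPoly c N s = ∑ n ∈ Ioc 0 N, LSeries.term c s n := by
  refine Finset.sum_congr rfl fun n hn ↦ ?_
  rw [LSeries.term_of_ne_zero (Finset.mem_Ioc.1 hn).1.ne', cpow_neg, div_eq_mul_inv]

lemma tendsto_dirichletPoly {c : ℕ → ℂ} {s : ℂ} (h : LSeriesSummable c s) :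
    Tendsto (fun N ↦ dirichletPoly c N s) atTop (nhds (LSeries c s)) := by
  have h1 := (HasSum.tendsto_sum_nat h.hasSum).comp (tendsto_add_atTop_nat 1)
  refine h1.congr fun N ↦ ?_
  simp only [Function.comp]
  rw [dirichletPoly_eq_sum_term, Finset.sum_range_succ', LSeries.term_zero, add_zero,
    Finset.range_eq_Ico, Finset.sum_Ico_add' (fun n ↦ LSeries.term c s n) 0 N 1]
  rfl

lemma exists_integral_norm_sq_sub_dirichletPoly_le [NeZero f] :
    ∃ C : ℝ, 0 ≤ C ∧ ∀ (N : ℕ) (a b : ℝ), 1 ≤ N → a ≤ b →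
      (∫ t in a..b, ‖DirichletCharacter.LFunction ψ (3 / 2 + t * I) ^ 2 -
        dirichletPoly (chiArith ψ * chiArith ψ : ArithmeticFunction ℂ) N (3 / 2 + t * I)‖ ^ 2) ≤
        C * ((b - a) + N) / (N : ℝ) ^ 2 * (1 + Real.log N) ^ 3 := by
  obtain ⟨C, hC, h⟩ := exists_integral_norm_sq_three_half_le
  refine ⟨C, hC, fun N a b hN hab ↦ ?_⟩
  set c : ArithmeticFunction ℂ := chiArith ψ * chiArith ψ
  have hre : ∀ t : ℝ, ((3 / 2 : ℂ) + t * I).re = 3 / 2 := fun t ↦ by simp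
  have hsum : ∀ t : ℝ, LSeriesSummable (c ·) (3 / 2 + t * I) := fun t ↦
    LSeriesSummable_chiArith_mul_self ψ (by rw [hre]; norm_num)
  set B : ℝ := ∑' n, ‖LSeries.term (c ·) (3 / 2 : ℂ) n‖
  have hB : ∀ (K : ℕ) (t : ℝ), ‖dirichletPoly c K (3 / 2 + t * I)‖ ≤ B := by
    intro K t
    rw [dirichletPoly_eq_sum_term]
    refine (norm_sum_le _ _).trans ?_
    have hs : Summable fun n ↦ ‖LSeries.term (c ·) (3 / 2 : ℂ) n‖ := by
      have := (hsum 0).norm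
      simpa using this
    refine le_trans (le_of_eq ?_) (hs.sum_le_tsum (Ioc 0 K) fun _ _ ↦ norm_nonneg _)
    refine Finset.sum_congr rfl fun n _ ↦ ?_
    rw [LSeries.norm_term_eq, LSeries.norm_term_eq, hre]
    norm_num
  have hcont : ∀ K : ℕ, Continuous fun t : ℝ ↦ dirichletPoly c K (3 / 2 + t * I) := fun K ↦
    (differentiable_dirichletPoly c K).continuous.comp (by fun_prop)
  have hlim : Tendsto (fun K : ℕ ↦ ∫ t in a..b, ‖dirichletPoly c K (3 / 2 + t * I) -
        dirichletPoly c N (3 / 2 + t * I)‖ ^ 2) atTop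
      (nhds (∫ t in a..b, ‖DirichletCharacter.LFunction ψ (3 / 2 + t * I) ^ 2 -
        dirichletPoly c N (3 / 2 + t * I)‖ ^ 2)) := by
    refine intervalIntegral.tendsto_integral_filter_of_dominated_convergence (fun _ ↦ (2 * B) ^ 2)
      (Eventually.of_forall fun K ↦ ?_) (Eventually.of_forall fun K ↦ ?_) (by simp) ?_
    · exact (((hcont K).sub (hcont N)).norm.pow 2).aestronglyMeasurable
    · refine ae_of_all _ fun t _ ↦ ?_
      rw [norm_pow, norm_norm]
      refine pow_le_pow_left₀ (norm_nonneg _) ((norm_sub_le _ _).trans ?_) 2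
      linarith [hB K t, hB N t]
    · refine ae_of_all _ fun t _ ↦ ?_
      rw [LFunction_sq_eq_LSeries ψ (by rw [hre]; norm_num)]
      exact (((tendsto_dirichletPoly (hsum t)).sub_const _).norm.pow 2)
  refine le_of_tendsto hlim ((eventually_ge_atTop N).mono fun K hK ↦ ?_)
  have h1 := h N K c hN (fun n _ ↦ norm_chiArith_mul_self_apply_le ψ n) a b hab
  refine (le_of_eq (intervalIntegral.integral_congr fun t _ ↦ ?_)).trans h1
  congr 2
  have h3 := dirichletPoly_add_mul_I c K (3 / 2) t
  have h4 := dirichletPoly_add_mul_I c N (3 / 2) t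
  rw [← Finset.sum_Ioc_consecutive _ (Nat.zero_le N) hK] at h3
  push_cast at h3 h4 ⊢
  rw [h3, h4]
  ring

end ShiftedMeanSquares

section ShiftedIntegrals

variable {f : ℕ} (ψ : DirichletCharacter ℂ f)

/-- The reflection `s ↦ ∑_{n ≤ N} conj (d(n) ψ(n)) n ^ (s - 1)`. -/
noncomputable def reflectPoly (N : ℕ) (s : ℂ) : ℂ :=
  dirichletPoly (fun n ↦ (starRingEnd ℂ) ((chiArith ψ * chiArith ψ) n)) N (1 - s)

/-- The difference between `L(s, ψ) ^ 2` and its `N`-th partial sum. -/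
noncomputable def sqRemainder [NeZero f] (N : ℕ) (s : ℂ) : ℂ :=
  DirichletCharacter.LFunction ψ s ^ 2 -
    dirichletPoly (chiArith ψ * chiArith ψ : ArithmeticFunction ℂ) N s

/-- The entire function equal to `|∏_{p ∣ r} (1 - ψ(p) p ^ (-s))| ^ 4` on the critical line. -/
noncomputable def eulerWeight (r : ℕ) (s : ℂ) : ℂ :=
  dirichletPoly (eulerCoeff ψ r) r s ^ 2 *
    dirichletPoly (fun n ↦ (starRingEnd ℂ) (eulerCoeff ψ r n)) r (1 - s) ^ 2

lemma differentiable_reflectPoly (N : ℕ) : Differentiable ℂ (reflectPoly ψ N) :=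
  (differentiable_dirichletPoly _ N).comp (by fun_prop : Differentiable ℂ fun s : ℂ ↦ 1 - s)

lemma differentiable_eulerWeight (r : ℕ) : Differentiable ℂ (eulerWeight ψ r) :=
  ((differentiable_dirichletPoly _ r).pow 2).mul
    (((differentiable_dirichletPoly _ r).comp
      (by fun_prop : Differentiable ℂ fun s : ℂ ↦ 1 - s)).pow 2)

lemma differentiableAt_sqRemainder [NeZero f] (N : ℕ) {s : ℂ} (hs : s ≠ 1) :
    DifferentiableAt ℂ (sqRemainder ψ N) s :=
  ((DirichletCharacter.differentiableAt_LFunction ψ s (Or.inl hs)).pow 2).sub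
    (differentiable_dirichletPoly _ N s)

lemma norm_chiArith_mul_self_apply_le_self (n : ℕ) : ‖(chiArith ψ * chiArith ψ) n‖ ≤ n :=
  (norm_chiArith_mul_self_apply_le ψ n).trans (divisorCount_le_self n)

lemma norm_reflectPoly_le (N : ℕ) {s : ℂ} (hs : s.re ≤ 3 / 2) :
    ‖reflectPoly ψ N s‖ ≤ (N : ℝ) ^ 3 := by
  refine norm_dirichletPoly_le (fun n _ ↦ ?_) ?_
  · rw [RCLike.norm_conj]
    exact norm_chiArith_mul_self_apply_le_self ψ n
  · rw [Complex.sub_re, Complex.one_re]; linarith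

lemma norm_eulerWeight_le (r : ℕ) {s : ℂ} (h1 : 1 / 2 ≤ s.re) (h2 : s.re ≤ 3 / 2) :
    ‖eulerWeight ψ r s‖ ≤ (r : ℝ) ^ 12 := by
  have hc : ∀ n ∈ Ioc 0 r, ‖eulerCoeff ψ r n‖ ≤ n := by
    intro n hn
    have : (1 : ℝ) ≤ n := by exact_mod_cast (Finset.mem_Ioc.1 hn).1
    refine (norm_eulerCoeff_le ψ r n).trans ?_
    split_ifs <;> linarith
  have e1 := norm_dirichletPoly_le hc (s := s) (by linarith)
  have e2 := norm_dirichletPoly_le (c := fun n ↦ (starRingEnd ℂ) (eulerCoeff ψ r n)) (s := 1 - s)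
    (fun n hn ↦ by rw [RCLike.norm_conj]; exact hc n hn)
    (by rw [Complex.sub_re, Complex.one_re]; linarith)
  rw [eulerWeight, norm_mul, norm_pow, norm_pow]
  calc _ ≤ ((r : ℝ) ^ 3) ^ 2 * ((r : ℝ) ^ 3) ^ 2 := by gcongr
    _ = _ := by ring

lemma exists_norm_sqRemainder_le [NeZero f] : ∃ C : ℝ, 0 ≤ C ∧ ∀ (N : ℕ) (T : ℝ) (s : ℂ),
    (N : ℝ) ≤ T → 1 / 2 ≤ s.re → s.re ≤ 3 / 2 → 1 ≤ |s.im| → |s.im| ≤ 4 * T →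
      ‖sqRemainder ψ N s‖ ≤ C * Real.exp (16 * T) := by
  obtain ⟨C, hC, h⟩ := exists_norm_LFunction_le ψ
  refine ⟨C ^ 2 + 1, by positivity, fun N T s hN h1 h2 h3 h4 ↦ ?_⟩
  have hT : (0 : ℝ) ≤ T := (Nat.cast_nonneg N).trans hN
  have e1 := norm_dirichletPoly_le (N := N) (c := (chiArith ψ * chiArith ψ : ArithmeticFunction ℂ))
    (s := s) (fun n _ ↦ norm_chiArith_mul_self_apply_le_self ψ n) (by linarith)
  have e2 : (N : ℝ) ^ 3 ≤ Real.exp (16 * T) := by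
    have : (N : ℝ) ≤ Real.exp T := by linarith [Real.add_one_le_exp T]
    calc (N : ℝ) ^ 3 ≤ Real.exp T ^ 3 := by gcongr
      _ = Real.exp (3 * T) := by rw [← Real.exp_nat_mul]; norm_num
      _ ≤ _ := Real.exp_le_exp.2 (by linarith)
  have e3 : ‖DirichletCharacter.LFunction ψ s‖ ≤ C * Real.exp (8 * T) :=
    (h s h1 h2 h3).trans (mul_le_mul_of_nonneg_left (Real.exp_le_exp.2 (by linarith)) hC)
  refine (norm_sub_le _ _).trans ?_
  rw [norm_pow]
  calc _ ≤ (C * Real.exp (8 * T)) ^ 2 + Real.exp (16 * T) :=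
        add_le_add (pow_le_pow_left₀ (norm_nonneg _) e3 2) (e1.trans e2)
    _ = _ := by
        rw [mul_pow, ← Real.exp_nat_mul, show ((2 : ℕ) : ℝ) * (8 * T) = 16 * T by push_cast; ring]
        ring

/-- The sum of weighted squares which dominates the shifted integrands on `re s = 3 / 2`. -/
noncomputable def shiftedSquares [NeZero f] (N : ℕ) (T t : ℝ) : ℝ :=
  T⁻¹ ^ 2 * ‖reflectPoly ψ N (3 / 2 + t * I)‖ ^ 2 + T ^ 2 * ‖sqRemainder ψ N (3 / 2 + t * I)‖ ^ 2

lemma continuous_shiftedSquares [NeZero f] (N : ℕ) (T : ℝ) :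
    Continuous (shiftedSquares ψ N T) := by
  have h1 : Continuous fun t : ℝ ↦ reflectPoly ψ N (3 / 2 + t * I) :=
    (differentiable_reflectPoly ψ N).continuous.comp (by fun_prop)
  have h2 : Continuous fun t : ℝ ↦ sqRemainder ψ N (3 / 2 + t * I) := by
    refine continuous_iff_continuousAt.2 fun t ↦ ?_
    refine ContinuousAt.comp (f := fun t : ℝ ↦ (3 / 2 + t * I : ℂ)) (g := sqRemainder ψ N)
      (differentiableAt_sqRemainder ψ N fun h ↦ ?_).continuousAt (by fun_prop)
    have := congrArg Complex.re h
    norm_num at this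
  unfold shiftedSquares
  fun_prop

lemma exists_integral_shiftedSquares_le [NeZero f] :
    ∃ C : ℝ, 0 ≤ C ∧ ∀ (N : ℕ) (T : ℝ), 2 ≤ T → T / 2 ≤ N → N ≤ T →
      ∫ t in (T / 2)..(4 * T), shiftedSquares ψ N T t ≤ C * T * (1 + Real.log T) ^ 3 := by
  obtain ⟨C1, hC1, h1⟩ := exists_integral_norm_sq_dirichletPoly_reflect_le ψ
  obtain ⟨C2, hC2, h2⟩ := exists_integral_norm_sq_sub_dirichletPoly_le ψ
  refine ⟨5 * C1 + 20 * C2, by positivity, fun N T hT hN1 hN2 ↦ ?_⟩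
  have hN : (1 : ℝ) ≤ N := by linarith
  have hN' : 1 ≤ N := by exact_mod_cast hN
  have e1 := h1 N (T / 2) (4 * T) (by linarith)
  have e2 := h2 N (T / 2) (4 * T) hN' (by linarith)
  have hlog : (1 + Real.log N) ^ 3 ≤ (1 + Real.log T) ^ 3 := by
    have := one_le_one_add_log N
    gcongr
  have hlog0 : 0 ≤ (1 + Real.log T) ^ 3 := by
    have := one_le_one_add_log N
    exact le_trans (by positivity) hlog
  have hlogN0 : 0 ≤ (1 + Real.log N) ^ 3 := by
    have := one_le_one_add_log N
    positivity
  have c1 : Continuous fun t : ℝ ↦ T⁻¹ ^ 2 * ‖reflectPoly ψ N (3 / 2 + t * I)‖ ^ 2 := by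
    have : Continuous fun t : ℝ ↦ reflectPoly ψ N (3 / 2 + t * I) :=
      (differentiable_reflectPoly ψ N).continuous.comp (by fun_prop)
    fun_prop
  have c2 : Continuous fun t : ℝ ↦ T ^ 2 * ‖sqRemainder ψ N (3 / 2 + t * I)‖ ^ 2 := by
    have := (continuous_shiftedSquares ψ N T).sub c1
    refine this.congr fun t ↦ ?_
    change shiftedSquares ψ N T t - _ = _
    rw [shiftedSquares]
    ring
  simp only [shiftedSquares]
  rw [intervalIntegral.integral_add (c1.intervalIntegrable _ _) (c2.intervalIntegrable _ _),
    intervalIntegral.integral_const_mul, intervalIntegral.integral_const_mul]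
  have k1 : T⁻¹ ^ 2 * ∫ t in (T / 2)..(4 * T), ‖reflectPoly ψ N (3 / 2 + t * I)‖ ^ 2 ≤
      5 * C1 * T * (1 + Real.log T) ^ 3 := by
    calc _ ≤ T⁻¹ ^ 2 * (C1 * ((4 * T - T / 2) + N) * (N : ℝ) ^ 2 * (1 + Real.log N) ^ 3) :=
          mul_le_mul_of_nonneg_left e1 (by positivity)
      _ ≤ T⁻¹ ^ 2 * (C1 * (5 * T) * T ^ 2 * (1 + Real.log T) ^ 3) := by
          gcongr
          linarith
      _ = _ := by field_simp
  have k2 : T ^ 2 * ∫ t in (T / 2)..(4 * T), ‖sqRemainder ψ N (3 / 2 + t * I)‖ ^ 2 ≤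
      20 * C2 * T * (1 + Real.log T) ^ 3 := by
    calc _ ≤ T ^ 2 * (C2 * ((4 * T - T / 2) + N) / (N : ℝ) ^ 2 * (1 + Real.log N) ^ 3) :=
          mul_le_mul_of_nonneg_left e2 (by positivity)
      _ ≤ T ^ 2 * (C2 * (5 * T) / (T / 2) ^ 2 * (1 + Real.log T) ^ 3) := by
          gcongr
          linarith
      _ = _ := by field_simp; ring
  linarith

lemma exists_norm_integral_gaussWindow_mul_le [NeZero f] (C K : ℝ) (hC : 0 ≤ C) (hK : 0 ≤ K) :
    ∃ C' : ℝ, 0 ≤ C' ∧ ∀ (N : ℕ) (T U₁ U₂ : ℝ) (G : ℂ → ℂ), 2 ≤ T → T / 2 ≤ N → N ≤ T →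
      (∀ s : ℂ, 1 / 2 ≤ s.re → s.re ≤ 3 / 2 → T / 2 ≤ s.im → s.im ≤ 4 * T →
        DifferentiableAt ℂ G s) →
      (∀ s : ℂ, 1 / 2 ≤ s.re → s.re ≤ 3 / 2 → T / 2 ≤ s.im → s.im ≤ 4 * T →
        ‖G s‖ ≤ K * Real.exp (64 * T)) →
      (∀ t : ℝ, T / 2 ≤ t → t ≤ 4 * T → ‖G (3 / 2 + t * I)‖ ≤ C * shiftedSquares ψ N T t) →
      3 / 4 * T ≤ U₁ → U₁ ≤ U₂ → U₂ ≤ 3 * T →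
      ‖∫ t in (T / 2)..(4 * T), (gaussWindow U₁ U₂ t : ℂ) * G (1 / 2 + t * I)‖ ≤
        C' * T * (1 + Real.log T) ^ 3 := by
  obtain ⟨C1, hC1, h1⟩ := exists_integral_shiftedSquares_le ψ
  refine ⟨Real.exp 1 * (C * C1) + 8 * K * Real.exp 1 * Real.exp 32768, by positivity,
    fun N T U₁ U₂ G hT hN1 hN2 hG hGK hGs hU1 hU hU2 ↦ ?_⟩
  have hmain := norm_integral_gaussWindow_mul_le (δ := T / 4) (by linarith) (by positivity) hG hGK
    (by linarith) hU (by linarith) (by linarith)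
  have e1 : ∫ t in (T / 2)..(4 * T), ‖G (3 / 2 + t * I)‖ ≤ C * (C1 * T * (1 + Real.log T) ^ 3) := by
    refine le_trans ?_ (mul_le_mul_of_nonneg_left (h1 N T hT hN1 hN2) hC)
    rw [← intervalIntegral.integral_const_mul]
    refine intervalIntegral.integral_mono_on (by linarith) ?_
      (((continuous_shiftedSquares ψ N T).const_mul C).intervalIntegrable _ _)
      fun t ht ↦ hGs t ht.1 ht.2
    refine ContinuousOn.intervalIntegrable fun t ht ↦ ?_
    rw [Set.uIcc_of_le (by linarith)] at ht
    refine ContinuousAt.continuousWithinAt (ContinuousAt.norm ?_)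
    refine ContinuousAt.comp (f := fun t : ℝ ↦ (3 / 2 + t * I : ℂ)) (g := G)
      (hG _ ?_ ?_ ?_ ?_).continuousAt (by fun_prop)
    · norm_num
    · norm_num
    · simpa using ht.1
    · simpa using ht.2
  have e2 : Real.exp (64 * T) * Real.exp (-(T / 4) ^ 2) ≤ Real.exp 32768 := by
    rw [← Real.exp_add]
    exact Real.exp_le_exp.2 (by nlinarith [sq_nonneg (T - 512)])
  have hlog : 1 ≤ (1 + Real.log T) ^ 3 :=
    one_le_pow₀ (by linarith [Real.log_nonneg (by linarith : (1 : ℝ) ≤ T)])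
  calc _ ≤ _ := hmain
    _ = Real.exp 1 * (∫ t in (T / 2)..(4 * T), ‖G (3 / 2 + t * I)‖) +
        2 * K * Real.exp 1 * (Real.exp (64 * T) * Real.exp (-(T / 4) ^ 2)) * (U₂ - U₁) := by ring
    _ ≤ Real.exp 1 * (C * (C1 * T * (1 + Real.log T) ^ 3)) +
        2 * K * Real.exp 1 * Real.exp 32768 * (4 * T * (1 + Real.log T) ^ 3) := by
        gcongr
        nlinarith
    _ = _ := by ring

end ShiftedIntegrals

section ApproximateFunctionalEquation

variable {f : ℕ} [NeZero f] (ψ : DirichletCharacter ℂ f)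

lemma conj_dirichletPoly_half_add_mul_I (c : ℕ → ℂ) (N : ℕ) (t : ℝ) :
    (starRingEnd ℂ) (dirichletPoly c N (1 / 2 + t * I)) =
      dirichletPoly (fun n ↦ (starRingEnd ℂ) (c n)) N (1 - (1 / 2 + t * I)) := by
  rw [conj_dirichletPoly, conj_half_add_mul_I]

/-- The polynomial identity behind the approximate functional equation for `‖L ^ 2‖ ^ 2`: if
`L ^ 2 = a + d` and `conj L = ε Z L` with `Z` unimodular, then `‖L‖ ^ 4` differs from `2 ‖a‖ ^ 2`
by the real part of a combination of three terms, each being the value of a meromorphic function. -/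
lemma norm_pow_four_sub_eq {l a d ε Z : ℂ} (hl : l ^ 2 = a + d)
    (hconj : (starRingEnd ℂ) l = ε * Z * l) (hZ : (starRingEnd ℂ) Z = Z⁻¹) :
    ‖l‖ ^ 4 - 2 * ‖a‖ ^ 2 = (ε ^ 2 * (Z ^ 2 * d ^ 2) + 2 * ((starRingEnd ℂ) a * d) -
      (starRingEnd ℂ) ε ^ 2 * (Z⁻¹ ^ 2 * (starRingEnd ℂ) a ^ 2)).re := by
  have h1 : ((‖l‖ ^ 4 - 2 * ‖a‖ ^ 2 : ℝ) : ℂ) = ε ^ 2 * (Z ^ 2 * d ^ 2) +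
      2 * (starRingEnd ℂ) ((starRingEnd ℂ) a * d) -
      (starRingEnd ℂ) ((starRingEnd ℂ) ε ^ 2 * (Z⁻¹ ^ 2 * (starRingEnd ℂ) a ^ 2)) := by
    have e1 : ((‖l‖ ^ 4 : ℝ) : ℂ) = (l * (starRingEnd ℂ) l) ^ 2 := by
      rw [Complex.mul_conj']; push_cast; ring
    have e2 : ((‖a‖ ^ 2 : ℝ) : ℂ) = a * (starRingEnd ℂ) a := by
      rw [Complex.mul_conj']; push_cast; ring
    have e3 : (starRingEnd ℂ) a + (starRingEnd ℂ) d = (ε * Z) ^ 2 * (a + d) := by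
      rw [← map_add, ← hl, map_pow, hconj]; ring
    have e4 : (starRingEnd ℂ) Z⁻¹ = Z := by rw [map_inv₀, hZ, inv_inv]
    have e5 : ((‖l‖ ^ 4 - 2 * ‖a‖ ^ 2 : ℝ) : ℂ) = ((‖l‖ ^ 4 : ℝ) : ℂ) - 2 * ((‖a‖ ^ 2 : ℝ) : ℂ) := by
      push_cast; ring
    rw [e5, e1, e2, hconj]
    simp only [map_mul, map_pow, e4, Complex.conj_conj]
    linear_combination (ε ^ 2 * Z ^ 2 * (l ^ 2 + a + d)) * hl - 2 * a * e3
  have h2 := congrArg Complex.re h1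
  rw [Complex.ofReal_re] at h2
  have h3 (x y z : ℂ) : (x + 2 * (starRingEnd ℂ) y - (starRingEnd ℂ) z).re =
    (x + 2 * y - z).re := by simp
  rw [h2, h3]

lemma LFunction_eq_primitive_mul {q : ℕ} [NeZero q] (χ : DirichletCharacter ℂ q) {s : ℂ}
    [NeZero χ.conductor] (hs : s ≠ 1) :
    DirichletCharacter.LFunction χ s = DirichletCharacter.LFunction χ.primitiveCharacter s *
      dirichletPoly (eulerCoeff χ.primitiveCharacter (∏ p ∈ q.primeFactors, p))
        (∏ p ∈ q.primeFactors, p) s := by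
  have h := DirichletCharacter.LFunction_changeLevel χ.conductor_dvd_level χ.primitiveCharacter
    (s := s) (Or.inr hs)
  rw [← prod_one_sub_eq_dirichletPoly, ← h, DirichletCharacter.changeLevel_primitiveCharacter]

lemma exists_norm_pow_four_sub_eq {q : ℕ} [NeZero q] (χ : DirichletCharacter ℂ q)
    [NeZero χ.conductor] : ∃ κ : ℕ, κ ≤ 1 ∧ ∃ ε : ℂ, ∀ (N : ℕ) (r : ℕ) (t : ℝ),
      r = ∏ p ∈ q.primeFactors, p → t ≠ 0 →
      ‖DirichletCharacter.LFunction χ (1 / 2 + t * I)‖ ^ 4 -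
        2 * ‖dirichletPoly (mainCoeff χ.primitiveCharacter r N) (r * (r * N)) (1 / 2 + t * I)‖ ^ 2 =
      (ε ^ 2 * (funcFactor χ.conductor κ (1 / 2 + t * I) ^ 2 *
          sqRemainder χ.primitiveCharacter N (1 / 2 + t * I) ^ 2 *
            eulerWeight χ.primitiveCharacter r (1 / 2 + t * I)) +
        2 * (reflectPoly χ.primitiveCharacter N (1 / 2 + t * I) *
          sqRemainder χ.primitiveCharacter N (1 / 2 + t * I) *
            eulerWeight χ.primitiveCharacter r (1 / 2 + t * I)) -
        (starRingEnd ℂ) ε ^ 2 * ((funcFactor χ.conductor κ (1 / 2 + t * I))⁻¹ ^ 2 *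
          reflectPoly χ.primitiveCharacter N (1 / 2 + t * I) ^ 2 *
            eulerWeight χ.primitiveCharacter r (1 / 2 + t * I))).re := by
  obtain ⟨κ, hκ, ε, h⟩ := exists_conj_LFunction_eq χ.primitiveCharacter_isPrimitive
  refine ⟨κ, hκ, ε, fun N r t hr ht ↦ ?_⟩
  set ψ := χ.primitiveCharacter
  set s : ℂ := 1 / 2 + t * I with hs
  have hs1 : s ≠ 1 := fun h' ↦ by
    have := congrArg Complex.im h'
    simp [hs] at this
    exact ht this
  set E := dirichletPoly (eulerCoeff ψ r) r s with hE
  set a := dirichletPoly (chiArith ψ * chiArith ψ : ArithmeticFunction ℂ) N s with ha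
  have ha' : (starRingEnd ℂ) a = reflectPoly ψ N s := conj_dirichletPoly_half_add_mul_I _ N t
  have hE' : (starRingEnd ℂ) E = dirichletPoly (fun n ↦ (starRingEnd ℂ) (eulerCoeff ψ r n)) r
    (1 - s) := conj_dirichletPoly_half_add_mul_I _ r t
  have hM : eulerWeight ψ r s = ((‖E‖ ^ 4 : ℝ) : ℂ) := by
    rw [eulerWeight, ← hE', ← hE, ← mul_pow, Complex.mul_conj']
    push_cast
    ring
  have hl : DirichletCharacter.LFunction ψ s ^ 2 = a + sqRemainder ψ N s := by
    rw [sqRemainder]; ring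
  have key := norm_pow_four_sub_eq hl (h t ht) (conj_funcFactor χ.conductor κ t)
  have hL : DirichletCharacter.LFunction χ s = DirichletCharacter.LFunction ψ s * E := by
    rw [LFunction_eq_primitive_mul χ hs1, hE, hr]
  rw [dirichletPoly_mainCoeff, hL, norm_mul, norm_mul, norm_pow, ← hE, ← ha]
  rw [ha'] at key
  have e2 : (‖DirichletCharacter.LFunction ψ s‖ * ‖E‖) ^ 4 - 2 * (‖E‖ ^ 2 * ‖a‖) ^ 2 =
      ‖E‖ ^ 4 * (‖DirichletCharacter.LFunction ψ s‖ ^ 4 - 2 * ‖a‖ ^ 2) := by ring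
  rw [e2, key, ← Complex.re_ofReal_mul, hM]
  congr 1
  ring

end ApproximateFunctionalEquation

section WeightedMoment

lemma abs_integral_mul_le_of_eq_re {w F : ℝ → ℝ} {g₁ g₂ g₃ : ℝ → ℂ} {c₁ c₂ c₃ : ℂ} {a b B : ℝ}
    (hab : a ≤ b) (hF : ∀ t ∈ Set.Icc a b, F t = (c₁ * g₁ t + c₂ * g₂ t - c₃ * g₃ t).re)
    (i₁ : IntervalIntegrable (fun t ↦ (w t : ℂ) * g₁ t) volume a b)
    (i₂ : IntervalIntegrable (fun t ↦ (w t : ℂ) * g₂ t) volume a b)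
    (i₃ : IntervalIntegrable (fun t ↦ (w t : ℂ) * g₃ t) volume a b)
    (h₁ : ‖∫ t in a..b, (w t : ℂ) * g₁ t‖ ≤ B) (h₂ : ‖∫ t in a..b, (w t : ℂ) * g₂ t‖ ≤ B)
    (h₃ : ‖∫ t in a..b, (w t : ℂ) * g₃ t‖ ≤ B) :
    |∫ t in a..b, w t * F t| ≤ (‖c₁‖ + ‖c₂‖ + ‖c₃‖) * B := by
  have j₁ := i₁.const_mul c₁
  have j₂ := i₂.const_mul c₂
  have j₃ := i₃.const_mul c₃
  have e1 : ∫ t in a..b, w t * F t = (∫ t in a..b, (c₁ * ((w t : ℂ) * g₁ t) +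
      c₂ * ((w t : ℂ) * g₂ t) - c₃ * ((w t : ℂ) * g₃ t))).re := by
    refine Eq.trans ?_ (intervalIntegral.intervalIntegral_re ((j₁.add j₂).sub j₃))
    refine intervalIntegral.integral_congr fun t ht ↦ ?_
    rw [Set.uIcc_of_le hab] at ht
    change w t * F t = (c₁ * ((w t : ℂ) * g₁ t) +
      c₂ * ((w t : ℂ) * g₂ t) - c₃ * ((w t : ℂ) * g₃ t)).re
    rw [hF t ht, ← Complex.re_ofReal_mul]
    congr 1
    ring
  rw [e1, intervalIntegral.integral_sub (j₁.add j₂) j₃, intervalIntegral.integral_add j₁ j₂,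
    intervalIntegral.integral_const_mul, intervalIntegral.integral_const_mul,
    intervalIntegral.integral_const_mul]
  refine (Complex.abs_re_le_norm _).trans ((norm_sub_le _ _).trans ?_)
  refine (add_le_add_left (norm_add_le _ _) _).trans ?_
  rw [norm_mul, norm_mul, norm_mul, add_mul, add_mul]
  gcongr

lemma norm_eulerWeight_three_half_le {f : ℕ} (ψ : DirichletCharacter ℂ f) (r : ℕ) (t : ℝ) :
    ‖eulerWeight ψ r (3 / 2 + t * I)‖ ≤ (r : ℝ) ^ 12 := by
  have hre : ((3 / 2 : ℂ) + t * I).re = 3 / 2 := by simp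
  exact norm_eulerWeight_le ψ r (by rw [hre]; norm_num) (by rw [hre])

section

variable {f : ℕ} [NeZero f] (ψ : DirichletCharacter ℂ f)

lemma exists_norm_factors_le {κ : ℕ} (hκ : κ ≤ 1) : ∃ C : ℝ, 0 ≤ C ∧
    ∀ (N : ℕ) (T : ℝ) (s : ℂ), 2 ≤ T → N ≤ T → 1 / 2 ≤ s.re → s.re ≤ 3 / 2 → T / 2 ≤ s.im →
      s.im ≤ 4 * T → ‖funcFactor f κ s‖ ≤ C * Real.exp (16 * T) ∧
        ‖(funcFactor f κ s)⁻¹‖ ≤ C * Real.exp (16 * T) ∧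
        ‖sqRemainder ψ N s‖ ≤ C * Real.exp (16 * T) ∧
        ‖reflectPoly ψ N s‖ ≤ C * Real.exp (16 * T) := by
  obtain ⟨CZ, hCZ, hZ⟩ := exists_norm_funcFactor_le f κ hκ
  obtain ⟨CD, hCD, hD⟩ := exists_norm_sqRemainder_le ψ
  refine ⟨CZ + CD + 1, by positivity, fun N T s hT hN a b c d ↦ ?_⟩
  have hN3 : (N : ℝ) ^ 3 ≤ Real.exp (16 * T) := by
    have : (N : ℝ) ≤ Real.exp T := by linarith [Real.add_one_le_exp T]
    calc (N : ℝ) ^ 3 ≤ Real.exp T ^ 3 := by gcongr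
      _ = Real.exp (3 * T) := by rw [← Real.exp_nat_mul]; norm_num
      _ ≤ _ := Real.exp_le_exp.2 (by linarith)
  have habs : |s.im| = s.im := abs_of_nonneg (by linarith)
  obtain ⟨e1, e2⟩ := hZ s a b (by rw [habs]; linarith)
  have e3 := hD N T s hN a b (by rw [habs]; linarith) (by rwa [habs])
  have e4 := (norm_reflectPoly_le ψ N b).trans hN3
  have e5 : CZ * Real.exp (4 * |s.im|) ≤ CZ * Real.exp (16 * T) :=
    mul_le_mul_of_nonneg_left (Real.exp_le_exp.2 (by rw [habs]; linarith)) hCZ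
  have p := Real.exp_pos (16 * T)
  refine ⟨?_, ?_, ?_, ?_⟩ <;> nlinarith

lemma differentiableAt_of_im_ne_zero (κ N r : ℕ) {s : ℂ} (hs : s.im ≠ 0) :
    DifferentiableAt ℂ (fun s ↦ funcFactor f κ s ^ 2 * sqRemainder ψ N s ^ 2 *
      eulerWeight ψ r s) s ∧
    DifferentiableAt ℂ (fun s ↦ reflectPoly ψ N s * sqRemainder ψ N s * eulerWeight ψ r s) s ∧
    DifferentiableAt ℂ (fun s ↦ (funcFactor f κ s)⁻¹ ^ 2 * reflectPoly ψ N s ^ 2 *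
      eulerWeight ψ r s) s := by
  have dA := differentiable_reflectPoly ψ N s
  have dM := differentiable_eulerWeight ψ r s
  have dD := differentiableAt_sqRemainder ψ N (s := s) fun h ↦ hs (by rw [h, Complex.one_im])
  have dZ := differentiableAt_funcFactor (f := f) (κ := κ) hs
  have dZi : DifferentiableAt ℂ (fun s ↦ (funcFactor f κ s)⁻¹) s :=
    dZ.inv (funcFactor_ne_zero hs)
  exact ⟨((dZ.fun_pow 2).fun_mul (dD.fun_pow 2)).fun_mul dM, (dA.fun_mul dD).fun_mul dM,
    ((dZi.fun_pow 2).fun_mul (dA.fun_pow 2)).fun_mul dM⟩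

lemma norm_mul_three_half_le (r N : ℕ) {T : ℝ} (t : ℝ) (hT : 0 < T) :
    ‖reflectPoly ψ N (3 / 2 + t * I) * sqRemainder ψ N (3 / 2 + t * I) *
      eulerWeight ψ r (3 / 2 + t * I)‖ ≤ (r : ℝ) ^ 12 * shiftedSquares ψ N T t := by
  rw [norm_mul, norm_mul, shiftedSquares, mul_comm ((r : ℝ) ^ 12)]
  generalize ‖reflectPoly ψ N (3 / 2 + t * I)‖ = x
  generalize ‖sqRemainder ψ N (3 / 2 + t * I)‖ = y
  have h2 : x * y = (T⁻¹ * x) * (T * y) := by field_simp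
  refine mul_le_mul ?_ (norm_eulerWeight_three_half_le ψ r t) (norm_nonneg _) (by positivity)
  rw [h2, ← mul_pow, ← mul_pow]
  nlinarith [sq_nonneg (T⁻¹ * x - T * y), sq_nonneg (T⁻¹ * x), sq_nonneg (T * y)]

lemma norm_funcFactor_mul_three_half_le {κ : ℕ} (hκ : κ ≤ 1) (r N : ℕ) {T t : ℝ} (hT : 2 ≤ T)
    (ht : T / 2 ≤ t) (ht' : t ≤ 4 * T) :
    ‖funcFactor f κ (3 / 2 + t * I) ^ 2 * sqRemainder ψ N (3 / 2 + t * I) ^ 2 *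
      eulerWeight ψ r (3 / 2 + t * I)‖ ≤
        16 * (f : ℝ) ^ 2 * (r : ℝ) ^ 12 * shiftedSquares ψ N T t := by
  have hZ : ‖funcFactor f κ (3 / 2 + t * I)‖ ≤ 4 * f * T := by
    refine (norm_funcFactor_three_half_le hκ (by linarith)).trans ?_
    nlinarith [(Nat.cast_nonneg f : (0 : ℝ) ≤ f)]
  rw [norm_mul, norm_mul, norm_pow, norm_pow]
  calc _ ≤ (4 * f * T) ^ 2 * ‖sqRemainder ψ N (3 / 2 + t * I)‖ ^ 2 * (r : ℝ) ^ 12 := by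
        gcongr
        exact norm_eulerWeight_three_half_le ψ r t
    _ = 16 * (f : ℝ) ^ 2 * (r : ℝ) ^ 12 * (T ^ 2 * ‖sqRemainder ψ N (3 / 2 + t * I)‖ ^ 2) := by
        ring
    _ ≤ _ := by
        rw [shiftedSquares]
        gcongr
        exact le_add_of_nonneg_left (by positivity)

lemma norm_inv_funcFactor_mul_three_half_le {κ : ℕ} (r N : ℕ) {T t : ℝ} (hT : 2 ≤ T)
    (ht : T / 2 ≤ t) :
    ‖(funcFactor f κ (3 / 2 + t * I))⁻¹ ^ 2 * reflectPoly ψ N (3 / 2 + t * I) ^ 2 *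
      eulerWeight ψ r (3 / 2 + t * I)‖ ≤ 256 * (r : ℝ) ^ 12 * shiftedSquares ψ N T t := by
  have hZ : ‖(funcFactor f κ (3 / 2 + t * I))⁻¹‖ ≤ 16 * T⁻¹ := by
    refine (norm_inv_funcFactor_three_half_le (by linarith)).trans ?_
    calc 8 / t ≤ 8 / (T / 2) := by gcongr
      _ = _ := by field_simp; norm_num
  rw [norm_mul, norm_mul, norm_pow, norm_pow]
  calc _ ≤ (16 * T⁻¹) ^ 2 * ‖reflectPoly ψ N (3 / 2 + t * I)‖ ^ 2 * (r : ℝ) ^ 12 := by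
        gcongr
        exact norm_eulerWeight_three_half_le ψ r t
    _ = 256 * (r : ℝ) ^ 12 * (T⁻¹ ^ 2 * ‖reflectPoly ψ N (3 / 2 + t * I)‖ ^ 2) := by ring
    _ ≤ _ := by
        rw [shiftedSquares]
        gcongr
        exact le_add_of_nonneg_right (by positivity)

lemma exists_norm_integral_gaussWindow_mul_terms_le {κ : ℕ} (hκ : κ ≤ 1) (r : ℕ) :
    ∃ C : ℝ, 0 ≤ C ∧ ∀ (N : ℕ) (T U₁ U₂ : ℝ), 2 ≤ T → T / 2 ≤ N → N ≤ T →
      3 / 4 * T ≤ U₁ → U₁ ≤ U₂ → U₂ ≤ 3 * T →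
      ‖∫ t in (T / 2)..(4 * T), (gaussWindow U₁ U₂ t : ℂ) * (funcFactor f κ (1 / 2 + t * I) ^ 2 *
        sqRemainder ψ N (1 / 2 + t * I) ^ 2 * eulerWeight ψ r (1 / 2 + t * I))‖ ≤
          C * T * (1 + Real.log T) ^ 3 ∧
      ‖∫ t in (T / 2)..(4 * T), (gaussWindow U₁ U₂ t : ℂ) * (reflectPoly ψ N (1 / 2 + t * I) *
        sqRemainder ψ N (1 / 2 + t * I) * eulerWeight ψ r (1 / 2 + t * I))‖ ≤
          C * T * (1 + Real.log T) ^ 3 ∧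
      ‖∫ t in (T / 2)..(4 * T), (gaussWindow U₁ U₂ t : ℂ) *
        ((funcFactor f κ (1 / 2 + t * I))⁻¹ ^ 2 *
          reflectPoly ψ N (1 / 2 + t * I) ^ 2 * eulerWeight ψ r (1 / 2 + t * I))‖ ≤
          C * T * (1 + Real.log T) ^ 3 := by
  obtain ⟨B, hB, hb⟩ := exists_norm_factors_le ψ hκ
  obtain ⟨C₁, hC₁, h₁⟩ := exists_norm_integral_gaussWindow_mul_le ψ
    (16 * (f : ℝ) ^ 2 * (r : ℝ) ^ 12) (B ^ 4 * (r : ℝ) ^ 12) (by positivity) (by positivity)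
  obtain ⟨C₂, hC₂, h₂⟩ := exists_norm_integral_gaussWindow_mul_le ψ
    ((r : ℝ) ^ 12) (B ^ 2 * (r : ℝ) ^ 12) (by positivity) (by positivity)
  obtain ⟨C₃, hC₃, h₃⟩ := exists_norm_integral_gaussWindow_mul_le ψ
    (256 * (r : ℝ) ^ 12) (B ^ 4 * (r : ℝ) ^ 12) (by positivity) (by positivity)
  refine ⟨C₁ + C₂ + C₃, by positivity, fun N T U₁ U₂ hT hN1 hN2 hU1 hU hU2 ↦ ?_⟩
  have hd := fun (s : ℂ) (hs : T / 2 ≤ s.im) ↦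
    differentiableAt_of_im_ne_zero ψ κ N r (s := s) (by linarith)
  have hexp : Real.exp (64 * T) = Real.exp (16 * T) ^ 4 := by
    rw [← Real.exp_nat_mul]; congr 1; push_cast; ring
  have hx1 : 1 ≤ Real.exp (16 * T) := Real.one_le_exp (by linarith)
  have hx2 : Real.exp (16 * T) ^ 2 ≤ Real.exp (16 * T) ^ 4 := pow_le_pow_right₀ hx1 (by norm_num)
  have g₁ := h₁ N T U₁ U₂ _ hT hN1 hN2 (fun s _ _ c _ ↦ (hd s c).1) (fun s a b c d ↦ by
    obtain ⟨e1, e2, e3, e4⟩ := hb N T s hT hN2 a b c d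
    rw [norm_mul, norm_mul, norm_pow, norm_pow, hexp]
    calc _ ≤ (B * Real.exp (16 * T)) ^ 2 * (B * Real.exp (16 * T)) ^ 2 * (r : ℝ) ^ 12 := by
          gcongr
          exact norm_eulerWeight_le ψ r a b
      _ = _ := by ring)
    (fun t a b ↦ norm_funcFactor_mul_three_half_le ψ hκ r N hT a b) hU1 hU hU2
  have g₂ := h₂ N T U₁ U₂ _ hT hN1 hN2 (fun s _ _ c _ ↦ (hd s c).2.1) (fun s a b c d ↦ by
    obtain ⟨e1, e2, e3, e4⟩ := hb N T s hT hN2 a b c d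
    rw [norm_mul, norm_mul, hexp]
    calc _ ≤ (B * Real.exp (16 * T)) * (B * Real.exp (16 * T)) * (r : ℝ) ^ 12 := by
          gcongr
          exact norm_eulerWeight_le ψ r a b
      _ = B ^ 2 * (r : ℝ) ^ 12 * Real.exp (16 * T) ^ 2 := by ring
      _ ≤ _ := by gcongr)
    (fun t a b ↦ norm_mul_three_half_le ψ r N t (by linarith)) hU1 hU hU2
  have g₃ := h₃ N T U₁ U₂ _ hT hN1 hN2 (fun s _ _ c _ ↦ (hd s c).2.2) (fun s a b c d ↦ by
    obtain ⟨e1, e2, e3, e4⟩ := hb N T s hT hN2 a b c d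
    rw [norm_mul, norm_mul, norm_pow, norm_pow, hexp]
    calc _ ≤ (B * Real.exp (16 * T)) ^ 2 * (B * Real.exp (16 * T)) ^ 2 * (r : ℝ) ^ 12 := by
          gcongr
          exact norm_eulerWeight_le ψ r a b
      _ = _ := by ring)
    (fun t a b ↦ norm_inv_funcFactor_mul_three_half_le ψ r N hT a) hU1 hU hU2
  have hlog : 0 ≤ T * (1 + Real.log T) ^ 3 := by
    have := Real.log_nonneg (by linarith : (1 : ℝ) ≤ T)
    positivity
  refine ⟨g₁.trans ?_, g₂.trans ?_, g₃.trans ?_⟩ <;> nlinarith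

lemma intervalIntegrable_gaussWindow_mul {G : ℂ → ℂ} {T U₁ U₂ : ℝ} (hT : 0 ≤ T)
    (hG : ∀ s : ℂ, T / 2 ≤ s.im → DifferentiableAt ℂ G s) :
    IntervalIntegrable (fun t : ℝ ↦ (gaussWindow U₁ U₂ t : ℂ) * G (1 / 2 + t * I)) volume
      (T / 2) (4 * T) := by
  refine ContinuousOn.intervalIntegrable fun t ht ↦ ?_
  rw [Set.uIcc_of_le (by linarith)] at ht
  refine ContinuousAt.continuousWithinAt (ContinuousAt.mul ?_ ?_)
  · exact (Complex.continuous_ofReal.comp (continuous_gaussWindow U₁ U₂)).continuousAt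
  · refine ContinuousAt.comp (f := fun t : ℝ ↦ (1 / 2 + t * I : ℂ)) (g := G)
      (hG _ ?_).continuousAt (by fun_prop)
    simpa using ht.1

end

end WeightedMoment

section WeightedMoment

lemma exists_abs_integral_gaussWindow_mul_sub_le {q : ℕ} [NeZero q] (χ : DirichletCharacter ℂ q)
    [NeZero χ.conductor] : ∃ C : ℝ, 0 ≤ C ∧ ∀ (N : ℕ) (T U₁ U₂ : ℝ),
      2 ≤ T → T / 2 ≤ N → N ≤ T → 3 / 4 * T ≤ U₁ → U₁ ≤ U₂ → U₂ ≤ 3 * T →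
      |∫ t in (T / 2)..(4 * T), gaussWindow U₁ U₂ t *
        (‖DirichletCharacter.LFunction χ (1 / 2 + t * I)‖ ^ 4 - 2 * ‖dirichletPoly
          (mainCoeff χ.primitiveCharacter (∏ p ∈ q.primeFactors, p) N)
          ((∏ p ∈ q.primeFactors, p) * ((∏ p ∈ q.primeFactors, p) * N)) (1 / 2 + t * I)‖ ^ 2)| ≤
        C * T * (1 + Real.log T) ^ 3 := by
  obtain ⟨κ, hκ, ε, hid⟩ := exists_norm_pow_four_sub_eq χ
  obtain ⟨r, hr⟩ : ∃ r : ℕ, r = ∏ p ∈ q.primeFactors, p := ⟨_, rfl⟩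
  rw [← hr]
  obtain ⟨C, hC, h⟩ := exists_norm_integral_gaussWindow_mul_terms_le χ.primitiveCharacter hκ r
  refine ⟨(‖ε‖ ^ 2 + 2 + ‖ε‖ ^ 2) * C, by positivity, fun N T U₁ U₂ hT hN1 hN2 hU1 hU hU2 ↦ ?_⟩
  obtain ⟨g₁, g₂, g₃⟩ := h N T U₁ U₂ hT hN1 hN2 hU1 hU hU2
  have hd := fun (s : ℂ) (hs : T / 2 ≤ s.im) ↦
    differentiableAt_of_im_ne_zero χ.primitiveCharacter κ N r (s := s) (by linarith)
  have i₁ := intervalIntegrable_gaussWindow_mul (T := T) (U₁ := U₁) (U₂ := U₂) (by linarith)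
    fun s c ↦ (hd s c).1
  have i₂ := intervalIntegrable_gaussWindow_mul (T := T) (U₁ := U₁) (U₂ := U₂) (by linarith)
    fun s c ↦ (hd s c).2.1
  have i₃ := intervalIntegrable_gaussWindow_mul (T := T) (U₁ := U₁) (U₂ := U₂) (by linarith)
    fun s c ↦ (hd s c).2.2
  have hfin := abs_integral_mul_le_of_eq_re (w := gaussWindow U₁ U₂) (by linarith)
    (fun t ht ↦ hid N r t hr (by linarith [ht.1])) i₁ i₂ i₃ g₁ g₂ g₃
  refine hfin.trans (le_of_eq ?_)
  rw [norm_pow, norm_pow, RCLike.norm_conj, Complex.norm_ofNat]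
  ring

end WeightedMoment

section Unsmoothing

lemma integral_mul_le_of_le_one {w m : ℝ → ℝ} {A a b B e : ℝ} (hw : Continuous w)
    (hm : Continuous m) (hm0 : ∀ t, 0 ≤ m t) (hAa : A ≤ a) (hab : a ≤ b) (hbB : b ≤ B)
    (he : 0 ≤ e) (h1 : ∀ t, w t ≤ 1) (h2 : ∀ t ≤ a, w t ≤ e) (h3 : ∀ t, b ≤ t → w t ≤ e) :
    ∫ t in A..B, w t * m t ≤ (∫ t in a..b, m t) + e * ∫ t in A..B, m t := by
  have i : ∀ x y : ℝ, IntervalIntegrable (fun t ↦ w t * m t) volume x y := fun x y ↦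
    (hw.mul hm).intervalIntegrable _ _
  have j : ∀ x y : ℝ, IntervalIntegrable m volume x y := fun x y ↦ hm.intervalIntegrable _ _
  rw [← intervalIntegral.integral_add_adjacent_intervals (i A a) (i a B),
    ← intervalIntegral.integral_add_adjacent_intervals (i a b) (i b B),
    ← intervalIntegral.integral_add_adjacent_intervals (j A a) (j a B),
    ← intervalIntegral.integral_add_adjacent_intervals (j a b) (j b B)]
  have k1 : ∫ t in A..a, w t * m t ≤ e * ∫ t in A..a, m t := by
    rw [← intervalIntegral.integral_const_mul]
    exact intervalIntegral.integral_mono_on hAa (i _ _) ((j _ _).const_mul e)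
      fun t ht ↦ mul_le_mul_of_nonneg_right (h2 t ht.2) (hm0 t)
  have k2 : ∫ t in a..b, w t * m t ≤ ∫ t in a..b, m t :=
    intervalIntegral.integral_mono_on hab (i _ _) (j _ _)
      fun t _ ↦ mul_le_of_le_one_left (hm0 t) (h1 t)
  have k3 : ∫ t in b..B, w t * m t ≤ e * ∫ t in b..B, m t := by
    rw [← intervalIntegral.integral_const_mul]
    exact intervalIntegral.integral_mono_on hbB (i _ _) ((j _ _).const_mul e)
      fun t ht ↦ mul_le_mul_of_nonneg_right (h3 t ht.1) (hm0 t)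
  have k4 : 0 ≤ e * ∫ t in a..b, m t :=
    mul_nonneg he (intervalIntegral.integral_nonneg hab fun t _ ↦ hm0 t)
  linarith

lemma mul_integral_le_of_le {w m : ℝ → ℝ} {A a b B c : ℝ} (hw : Continuous w)
    (hm : Continuous m) (hm0 : ∀ t, 0 ≤ m t) (hAa : A ≤ a) (hab : a ≤ b) (hbB : b ≤ B)
    (h0 : ∀ t, 0 ≤ w t) (h1 : ∀ t, a ≤ t → t ≤ b → c ≤ w t) :
    c * ∫ t in a..b, m t ≤ ∫ t in A..B, w t * m t := by
  have i : ∀ x y : ℝ, IntervalIntegrable (fun t ↦ w t * m t) volume x y := fun x y ↦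
    (hw.mul hm).intervalIntegrable _ _
  rw [← intervalIntegral.integral_add_adjacent_intervals (i A a) (i a B),
    ← intervalIntegral.integral_add_adjacent_intervals (i a b) (i b B)]
  have k1 : 0 ≤ ∫ t in A..a, w t * m t :=
    intervalIntegral.integral_nonneg hAa fun t _ ↦ mul_nonneg (h0 t) (hm0 t)
  have k3 : 0 ≤ ∫ t in b..B, w t * m t :=
    intervalIntegral.integral_nonneg hbB fun t _ ↦ mul_nonneg (h0 t) (hm0 t)
  have k2 : c * ∫ t in a..b, m t ≤ ∫ t in a..b, w t * m t := by
    rw [← intervalIntegral.integral_const_mul]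
    exact intervalIntegral.integral_mono_on hab ((hm.intervalIntegrable _ _).const_mul c) (i _ _)
      fun t ht ↦ mul_le_mul_of_nonneg_right (h1 t ht.1 ht.2) (hm0 t)
  linarith

/-- Removal of the Gaussian window from an asymptotic evaluation of a mean value. -/
lemma abs_integral_sub_le_of_gaussWindow {F m : ℝ → ℝ} {T H R V B : ℝ} (hF : Continuous F)
    (hm : Continuous m) (hF0 : ∀ t, 0 ≤ F t) (hm0 : ∀ t, 0 ≤ m t) (hH : 0 ≤ H) (hHT : 8 * H ≤ T)
    (he : 2 * Real.exp (-H ^ 2 / 2) ≤ 1 / 2) (hV : 0 ≤ V)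
    (h1 : ∀ U₁ U₂ : ℝ, 3 / 4 * T ≤ U₁ → U₁ ≤ U₂ → U₂ ≤ 3 * T →
      |∫ t in (T / 2)..(4 * T), gaussWindow U₁ U₂ t * (F t - m t)| ≤ R)
    (h2 : ∀ a b : ℝ, T / 2 ≤ a → a ≤ b → b ≤ 4 * T → |(∫ t in a..b, m t) - (b - a) * V| ≤ R)
    (h3 : ∀ t : ℝ, T / 2 ≤ t → t ≤ 4 * T → F t ≤ B) :
    |(∫ t in T..(2 * T), F t) - T * V| ≤
      9 * R + 4 * H * V + 2 * Real.exp (-H ^ 2 / 2) * (15 * T * V + 4 * T * B) := by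
  set e : ℝ := 2 * Real.exp (-H ^ 2 / 2) with hedef
  have he0 : 0 ≤ e := by positivity
  have hT : 0 ≤ T := by linarith
  have hR : 0 ≤ R := (abs_nonneg _).trans (h2 (T / 2) (4 * T) (by linarith) (by linarith) le_rfl)
  have hsub : ∀ U₁ U₂ : ℝ, ∫ t in (T / 2)..(4 * T), gaussWindow U₁ U₂ t * (F t - m t) =
      (∫ t in (T / 2)..(4 * T), gaussWindow U₁ U₂ t * F t) -
        ∫ t in (T / 2)..(4 * T), gaussWindow U₁ U₂ t * m t := fun U₁ U₂ ↦ by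
    have := intervalIntegral.integral_sub (μ := volume) (a := T / 2) (b := 4 * T)
      (f := fun t ↦ gaussWindow U₁ U₂ t * F t) (g := fun t ↦ gaussWindow U₁ U₂ t * m t)
      (((continuous_gaussWindow U₁ U₂).mul hF).intervalIntegrable _ _)
      (((continuous_gaussWindow U₁ U₂).mul hm).intervalIntegrable _ _)
    rw [← this]
    exact intervalIntegral.integral_congr fun t _ ↦ mul_sub _ _ _
  have hTV : 0 ≤ T * V := mul_nonneg hT hV
  have hHV : 0 ≤ H * V := mul_nonneg hH hV
  have hHV' : 8 * (H * V) ≤ T * V := by nlinarith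
  have hB : 0 ≤ B := (hF0 T).trans (h3 T (by linarith) (by linarith))
  have hTB : 0 ≤ T * B := mul_nonneg hT hB
  set X := ∫ t in T..(2 * T), F t with hX
  have hupper : X - T * V ≤ 9 * R + 4 * H * V + e * (15 * T * V + 4 * T * B) := by
    have hU : T - H ≤ 2 * T + H := by linarith
    have k1 := mul_integral_le_of_le (A := T / 2) (B := 4 * T) (a := T) (b := 2 * T) (c := 1 - e)
      (continuous_gaussWindow (T - H) (2 * T + H)) hF hF0 (by linarith) (by linarith)
      (by linarith) (gaussWindow_nonneg hU)
      fun t ha hb ↦ by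
        have := one_sub_gaussWindow_le (U₁ := T - H) (U₂ := 2 * T + H) (t := t) hH (by linarith)
          (by linarith)
        linarith
    have k2 := integral_mul_le_of_le_one (A := T / 2) (B := 4 * T) (a := T - 2 * H)
      (b := 2 * T + 2 * H) (e := e)
      (continuous_gaussWindow (T - H) (2 * T + H)) hm hm0 (by linarith) (by linarith)
      (by linarith) he0 (gaussWindow_le_one hU)
      (fun t ht ↦ gaussWindow_le_of_le hU hH (by linarith))
      (fun t ht ↦ gaussWindow_le_of_ge hU hH (by linarith))
    have k3 := (abs_le.1 (h1 (T - H) (2 * T + H) (by linarith) hU (by linarith))).2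
    rw [hsub] at k3
    have k4 := (abs_le.1 (h2 (T - 2 * H) (2 * T + 2 * H) (by linarith) (by linarith)
      (by linarith))).2
    have k5 := (abs_le.1 (h2 (T / 2) (4 * T) (by linarith) (by linarith) le_rfl)).2
    have k6 : e * ∫ t in (T / 2)..(4 * T), m t ≤ e * (R + 7 / 2 * (T * V)) :=
      mul_le_mul_of_nonneg_left (by linarith) he0
    have k7 : (1 - e) * X ≤ 2 * R + T * V + 4 * (H * V) + e * (R + 7 / 2 * (T * V)) := by
      linarith
    have k8 : X ≤ 2 * (3 * R + 4 * (T * V)) := by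
      have : e * (R + 7 / 2 * (T * V)) ≤ 1 / 2 * (R + 7 / 2 * (T * V)) :=
        mul_le_mul_of_nonneg_right he (by positivity)
      have hX0 : 0 ≤ X := intervalIntegral.integral_nonneg (by linarith) fun t _ ↦ hF0 t
      nlinarith
    have k9 : e * X ≤ e * (2 * (3 * R + 4 * (T * V))) := mul_le_mul_of_nonneg_left k8 he0
    have k10 : e * R ≤ 1 / 2 * R := mul_le_mul_of_nonneg_right he hR
    have k11 : 0 ≤ e * (T * V) := by positivity
    have k12 : 0 ≤ e * (T * B) := by positivity
    linarith
  have hlower : T * V - X ≤ 9 * R + 4 * H * V + e * (15 * T * V + 4 * T * B) := by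
    have hU : T + H ≤ 2 * T - H := by linarith
    have k1 := mul_integral_le_of_le (A := T / 2) (B := 4 * T) (a := T + 2 * H)
      (b := 2 * T - 2 * H) (c := 1 - e)
      (continuous_gaussWindow (T + H) (2 * T - H)) hm hm0 (by linarith) (by linarith)
      (by linarith) (gaussWindow_nonneg hU)
      fun t ha hb ↦ by
        have := one_sub_gaussWindow_le (U₁ := T + H) (U₂ := 2 * T - H) (t := t) hH (by linarith)
          (by linarith)
        linarith
    have k2 := integral_mul_le_of_le_one (A := T / 2) (B := 4 * T) (a := T)
      (b := 2 * T) (e := e)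
      (continuous_gaussWindow (T + H) (2 * T - H)) hF hF0 (by linarith) (by linarith)
      (by linarith) he0 (gaussWindow_le_one hU)
      (fun t ht ↦ gaussWindow_le_of_le hU hH (by linarith))
      (fun t ht ↦ gaussWindow_le_of_ge hU hH (by linarith))
    have k3 := (abs_le.1 (h1 (T + H) (2 * T - H) (by linarith) hU (by linarith))).1
    rw [hsub] at k3
    have k4 := (abs_le.1 (h2 (T + 2 * H) (2 * T - 2 * H) (by linarith) (by linarith)
      (by linarith))).1
    have k5 : ∫ t in (T / 2)..(4 * T), F t ≤ 4 * (T * B) := by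
      have := intervalIntegral.integral_mono_on (by linarith : T / 2 ≤ 4 * T)
        (hF.intervalIntegrable (μ := volume) _ _) (continuous_const.intervalIntegrable _ _)
        fun t ht ↦ h3 t ht.1 ht.2
      rw [intervalIntegral.integral_const, smul_eq_mul] at this
      linarith
    have k6 : e * ∫ t in (T / 2)..(4 * T), F t ≤ e * (4 * (T * B)) :=
      mul_le_mul_of_nonneg_left k5 he0
    have k7 : (1 - e) * (T * V - 4 * (H * V) - R) ≤
        (1 - e) * ∫ t in (T + 2 * H)..(2 * T - 2 * H), m t :=
      mul_le_mul_of_nonneg_left (by linarith) (by linarith)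
    have k8 : 0 ≤ e * (T * V) := by positivity
    have k9 : 0 ≤ e * (H * V) := by positivity
    have k10 : 0 ≤ e * R := by positivity
    linarith
  exact abs_le.2 ⟨by linarith, hupper⟩

end Unsmoothing

section FourthMoment

lemma continuous_LFunction_half_add_mul_I {q : ℕ} [NeZero q] (χ : DirichletCharacter ℂ q) :
    Continuous fun t : ℝ ↦ DirichletCharacter.LFunction χ (1 / 2 + t * I) := by
  refine continuous_iff_continuousAt.2 fun t ↦ ?_
  refine ContinuousAt.comp (f := fun t : ℝ ↦ (1 / 2 + t * I : ℂ))
    (g := DirichletCharacter.LFunction χ)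
    (DirichletCharacter.differentiableAt_LFunction χ _ (Or.inl fun h ↦ ?_)).continuousAt
    (by fun_prop)
  have := congrArg Complex.re h
  norm_num at this

lemma prod_one_sub_two_div_nonneg (q : ℕ) :
    0 ≤ ∏ p ∈ q.primeFactors, (1 - 2 / ((p : ℝ) + 1)) := by
  refine Finset.prod_nonneg fun p hp ↦ ?_
  have : (1 : ℝ) ≤ p := by exact_mod_cast (Nat.prime_of_mem_primeFactors hp).one_le
  rw [sub_nonneg, div_le_one (by linarith)]
  linarith

lemma eventually_sq_log_le {c : ℝ} (hc : 0 < c) : ∀ᶠ T : ℝ in atTop, Real.log T ^ 2 ≤ c * T := by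
  have h := (Real.isLittleO_pow_log_id_atTop (n := 2)).bound hc
  filter_upwards [h, eventually_ge_atTop 0] with T hT hT0
  simpa [abs_of_nonneg hT0] using hT

lemma two_mul_exp_mul_exp_le {T : ℝ} (hT : 1 ≤ T) (hlog : 0 < Real.log T)
    (h : Real.log T ^ 2 ≤ 1 / 66 * T) :
    2 * Real.exp (-(T / Real.log T) ^ 2 / 2) * Real.exp (32 * T) ≤ 1 := by
  have h1 : 66 * T ≤ (T / Real.log T) ^ 2 := by
    rw [div_pow, le_div_iff₀ (by positivity)]
    nlinarith
  have h2 : (2 : ℝ) ≤ Real.exp T := by linarith [Real.add_one_le_exp T]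
  have h3 : -(T / Real.log T) ^ 2 / 2 + 32 * T ≤ -T := by linarith
  rw [mul_assoc, ← Real.exp_add]
  calc 2 * Real.exp (-(T / Real.log T) ^ 2 / 2 + 32 * T) ≤ Real.exp T * Real.exp (-T) := by
        gcongr
    _ = 1 := by rw [← Real.exp_add, add_neg_cancel, Real.exp_zero]

lemma log_pow_four_sub_log_floor_le {T : ℝ} (hT : 2 ≤ T) :
    Real.log T ^ 4 - Real.log ⌊T⌋₊ ^ 4 ≤ 4 * Real.log T ^ 3 := by
  have hN : T / 2 ≤ ⌊T⌋₊ := by linarith [Nat.lt_floor_add_one T]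
  have hN' : (⌊T⌋₊ : ℝ) ≤ T := Nat.floor_le (by linarith)
  have h0 : 0 ≤ Real.log ⌊T⌋₊ := Real.log_natCast_nonneg _
  have h1 : Real.log ⌊T⌋₊ ≤ Real.log T := Real.log_le_log (by linarith) hN'
  have h2 : Real.log T ≤ Real.log ⌊T⌋₊ + 1 := by
    have := Real.log_le_log (by linarith) hN
    rw [Real.log_div (by linarith) (by norm_num)] at this
    linarith [Real.log_two_lt_d9]
  generalize Real.log T = x at *
  generalize Real.log (⌊T⌋₊ : ℝ) = y at *
  have h3 : x ^ 4 - y ^ 4 = (x - y) * (x ^ 3 + x ^ 2 * y + x * y ^ 2 + y ^ 3) := by ring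
  have h4 : x ^ 3 + x ^ 2 * y + x * y ^ 2 + y ^ 3 ≤ x ^ 3 + x ^ 2 * x + x * x ^ 2 + x ^ 3 := by
    have : 0 ≤ x := h0.trans h1
    gcongr
  calc _ ≤ 1 * (x ^ 3 + x ^ 2 * x + x * x ^ 2 + x ^ 3) := by
        rw [h3]
        have : 0 ≤ x := h0.trans h1
        exact mul_le_mul (by linarith) h4 (by positivity) (by norm_num)
    _ = _ := by ring

lemma exists_norm_LFunction_pow_four_le {q : ℕ} [NeZero q] (χ : DirichletCharacter ℂ q) :
    ∃ C : ℝ, 0 ≤ C ∧ ∀ T t : ℝ, 2 ≤ T → T / 2 ≤ t → t ≤ 4 * T →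
      ‖DirichletCharacter.LFunction χ (1 / 2 + t * I)‖ ^ 4 ≤ C * Real.exp (32 * T) := by
  obtain ⟨C, hC, h⟩ := exists_norm_LFunction_le χ
  refine ⟨C ^ 4, by positivity, fun T t hT h1 h2 ↦ ?_⟩
  have him : ((1 / 2 : ℂ) + t * I).im = t := by simp
  have hre : ((1 / 2 : ℂ) + t * I).re = 1 / 2 := by simp
  have habs : |t| = t := abs_of_nonneg (by linarith)
  have e := h (1 / 2 + t * I) (by rw [hre]) (by rw [hre]; norm_num)
    (by rw [him, habs]; linarith)
  rw [him, habs] at e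
  calc _ ≤ (C * Real.exp (8 * T)) ^ 4 := by
        exact pow_le_pow_left₀ (norm_nonneg _) (e.trans
          (mul_le_mul_of_nonneg_left (Real.exp_le_exp.2 (by linarith)) hC)) 4
    _ = _ := by
        rw [mul_pow, ← Real.exp_nat_mul]
        congr 2
        push_cast
        ring

lemma exists_abs_fourthMoment_sub_le {q : ℕ} [NeZero q] (χ : DirichletCharacter ℂ q) :
    ∃ C : ℝ, 0 ≤ C ∧ ∀ T : ℝ, 2 ≤ T → 8 ≤ Real.log T → Real.log T ^ 2 ≤ 1 / 66 * T →
      |(∫ t in T..(2 * T), ‖DirichletCharacter.LFunction χ (1 / 2 + t * I)‖ ^ 4) -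
        T * (2 * (1 / (4 * π ^ 2) * ((q.totient : ℝ) / q) ^ 2 *
          (∏ p ∈ q.primeFactors, (1 - 2 / ((p : ℝ) + 1)))) * Real.log ⌊T⌋₊ ^ 4)| ≤
        C * T * Real.log T ^ 3 := by
  have : NeZero χ.conductor := ⟨χ.conductor_ne_zero⟩
  obtain ⟨CA, hCA, hA⟩ := exists_abs_integral_gaussWindow_mul_sub_le χ
  obtain ⟨CB, hCB, hB⟩ := exists_abs_integral_norm_sq_mainCoeff_sub_le χ.primitiveCharacter
    χ.conductor_dvd_level
  obtain ⟨CL, hCL, hL⟩ := exists_norm_LFunction_pow_four_le χ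
  set c : ℝ := 1 / (4 * π ^ 2) * ((q.totient : ℝ) / q) ^ 2 *
    (∏ p ∈ q.primeFactors, (1 - 2 / ((p : ℝ) + 1))) with hc
  have hc0 : 0 ≤ c := mul_nonneg (by positivity) (prod_one_sub_two_div_nonneg q)
  refine ⟨72 * (CA + 10 * CB) + 38 * c + 4 * CL, by positivity, fun T hT hlog hlog2 ↦ ?_⟩
  set N := ⌊T⌋₊ with hN
  set ℓ := Real.log T with hℓ
  have hN1 : T / 2 ≤ N := by linarith [Nat.lt_floor_add_one T]
  have hN2 : (N : ℝ) ≤ T := Nat.floor_le (by linarith)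
  have hNpos : 0 < N := Nat.floor_pos.2 (by linarith)
  have hlogN : Real.log N ≤ ℓ := Real.log_le_log (by exact_mod_cast hNpos) hN2
  have hlogN0 : 0 ≤ Real.log N := Real.log_natCast_nonneg _
  have hexp := two_mul_exp_mul_exp_le (by linarith : 1 ≤ T) (by linarith) hlog2
  have hexp' : 2 * Real.exp (-(T / ℓ) ^ 2 / 2) ≤ 1 / 2 := by
    have h2 : (2 : ℝ) ≤ Real.exp (32 * T) := by linarith [Real.add_one_le_exp (32 * T)]
    have h3 := Real.exp_pos (-(T / ℓ) ^ 2 / 2)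
    nlinarith
  have hmc : Continuous fun t : ℝ ↦ 2 * ‖dirichletPoly (mainCoeff χ.primitiveCharacter
      (∏ p ∈ q.primeFactors, p) N) ((∏ p ∈ q.primeFactors, p) * ((∏ p ∈ q.primeFactors, p) * N))
      (1 / 2 + t * I)‖ ^ 2 :=
    (((differentiable_dirichletPoly _ _).continuous.comp (by fun_prop)).norm.pow 2).const_mul 2
  have hT0 : 0 < T := by linarith
  have hℓ0 : 0 < ℓ := by linarith
  have hR0 : 0 ≤ T * (1 + ℓ) ^ 3 := by positivity
  have key := abs_integral_sub_le_of_gaussWindow (T := T) (H := T / ℓ)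
    (R := (CA + 10 * CB) * T * (1 + ℓ) ^ 3) (V := 2 * c * Real.log N ^ 4)
    (B := CL * Real.exp (32 * T))
    ((continuous_LFunction_half_add_mul_I χ).norm.pow 4) hmc
    (fun t ↦ pow_nonneg (norm_nonneg _) 4) (fun t ↦ mul_nonneg zero_le_two (sq_nonneg _))
    (by positivity)
    (by rw [mul_div_assoc', div_le_iff₀ (by linarith)]; nlinarith) hexp' (by positivity)
    (fun U₁ U₂ h1 h2 h3 ↦ (hA N T U₁ U₂ hT hN1 hN2 h1 h2 h3).trans (by nlinarith))
    (fun a b h1 h2 h3 ↦ by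
      have h4 := hB N hNpos a b h2
      rw [intervalIntegral.integral_const_mul]
      calc _ = 2 * |(∫ t in a..b, ‖dirichletPoly (mainCoeff χ.primitiveCharacter
            (∏ p ∈ q.primeFactors, p) N) ((∏ p ∈ q.primeFactors, p) *
              ((∏ p ∈ q.primeFactors, p) * N)) (1 / 2 + t * I)‖ ^ 2) -
              (b - a) * (c * Real.log N ^ 4)| := by
            rw [← abs_of_pos (by norm_num : (0 : ℝ) < 2), ← abs_mul,
              abs_of_pos (by norm_num : (0 : ℝ) < 2)]
            congr 1
            ring
        _ ≤ 2 * (CB * ((b - a) + N) * (1 + Real.log N) ^ 3) :=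
            mul_le_mul_of_nonneg_left h4 (by norm_num)
        _ ≤ 2 * (CB * (5 * T) * (1 + ℓ) ^ 3) := by
            gcongr
            linarith
        _ ≤ _ := by nlinarith)
    (fun t h1 h2 ↦ hL T t hT h1 h2)
  refine key.trans ?_
  have k1 : 9 * ((CA + 10 * CB) * T * (1 + ℓ) ^ 3) ≤ 72 * (CA + 10 * CB) * (T * ℓ ^ 3) := by
    have : (1 + ℓ) ^ 3 ≤ (2 * ℓ) ^ 3 := pow_le_pow_left₀ (by linarith) (by linarith) 3
    calc _ ≤ 9 * ((CA + 10 * CB) * T * (2 * ℓ) ^ 3) := by gcongr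
      _ = _ := by ring
  have k2 : 4 * (T / ℓ) * (2 * c * Real.log N ^ 4) ≤ 8 * c * (T * ℓ ^ 3) := by
    calc _ ≤ 4 * (T / ℓ) * (2 * c * ℓ ^ 4) := by gcongr
      _ = _ := by field_simp; ring
  have hel : 2 * Real.exp (-(T / ℓ) ^ 2 / 2) * ℓ ≤ 1 := by
    refine le_trans ?_ hexp
    gcongr
    have := Real.log_le_sub_one_of_pos (by linarith : 0 < T)
    linarith [Real.add_one_le_exp (32 * T)]
  have k3 : 2 * Real.exp (-(T / ℓ) ^ 2 / 2) * (15 * T * (2 * c * Real.log N ^ 4)) ≤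
      30 * c * (T * ℓ ^ 3) := by
    calc _ ≤ 2 * Real.exp (-(T / ℓ) ^ 2 / 2) * (15 * T * (2 * c * ℓ ^ 4)) := by gcongr
      _ = (2 * Real.exp (-(T / ℓ) ^ 2 / 2) * ℓ) * (30 * c * (T * ℓ ^ 3)) := by ring
      _ ≤ 1 * (30 * c * (T * ℓ ^ 3)) := mul_le_mul_of_nonneg_right hel (by positivity)
      _ = _ := one_mul _
  have k4 : 2 * Real.exp (-(T / ℓ) ^ 2 / 2) * (4 * T * (CL * Real.exp (32 * T))) ≤
      4 * CL * (T * ℓ ^ 3) := by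
    calc _ = (2 * Real.exp (-(T / ℓ) ^ 2 / 2) * Real.exp (32 * T)) * (4 * CL * (T * 1)) := by ring
      _ ≤ 1 * (4 * CL * (T * ℓ ^ 3)) := by
          gcongr
          exact one_le_pow₀ (by linarith)
      _ = _ := one_mul _
  linarith

end FourthMoment

/-- Fourth moment of a Dirichlet `L`-function in the `t`-aspect:
`∫_T^{2T} |L(1/2+it,χ)|⁴ dt = C(χ) T (log T)⁴ + O_q(T (log T)³)` with
`C(χ) = (1/(2π²)) (φ(q)/q)² ∏_{p ∣ q} (1 − 2/(p+1))`. -/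
theorem fourth_moment_L (q : ℕ) [NeZero q] (χ : DirichletCharacter ℂ q) :
    ∃ C T₀ : ℝ, ∀ T : ℝ, T₀ ≤ T →
      |(∫ t in T..(2*T), ‖DirichletCharacter.LFunction χ (1/2 + t * Complex.I)‖ ^ 4)
        - (1 / (2 * π ^ 2)) * ((q.totient : ℝ) / (q : ℝ)) ^ 2 *
            (∏ p ∈ q.primeFactors, (1 - 2 / ((p : ℝ) + 1))) * T * Real.log T ^ 4|
      ≤ C * T * Real.log T ^ 3 := by
  obtain ⟨C, hC, h⟩ := exists_abs_fourthMoment_sub_le χ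
  set c : ℝ := 1 / (4 * π ^ 2) * ((q.totient : ℝ) / q) ^ 2 *
    (∏ p ∈ q.primeFactors, (1 - 2 / ((p : ℝ) + 1))) with hc
  have hc0 : 0 ≤ c := mul_nonneg (by positivity) (prod_one_sub_two_div_nonneg q)
  obtain ⟨T₀, hT₀⟩ := eventually_atTop.1 (((eventually_ge_atTop (2 : ℝ)).and
    (Real.tendsto_log_atTop.eventually_ge_atTop 8)).and
    (eventually_sq_log_le (by norm_num : (0 : ℝ) < 1 / 66)))
  refine ⟨C + 8 * c, T₀, fun T hT ↦ ?_⟩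
  obtain ⟨⟨h2, h8⟩, hlog⟩ := hT₀ T hT
  have h1 := h T h2 h8 hlog
  have hfloor := log_pow_four_sub_log_floor_le h2
  have hfloor' : Real.log ⌊T⌋₊ ^ 4 ≤ Real.log T ^ 4 := by
    have h3 : (⌊T⌋₊ : ℝ) ≤ T := Nat.floor_le (by linarith)
    have h4 : (0 : ℝ) < ⌊T⌋₊ := by exact_mod_cast Nat.floor_pos.2 (by linarith)
    exact pow_le_pow_left₀ (Real.log_natCast_nonneg _) (Real.log_le_log h4 h3) 4
  have hconst : (1 / (2 * π ^ 2)) * ((q.totient : ℝ) / (q : ℝ)) ^ 2 *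
      (∏ p ∈ q.primeFactors, (1 - 2 / ((p : ℝ) + 1))) * T * Real.log T ^ 4 =
      T * (2 * c * Real.log T ^ 4) := by
    rw [hc]
    ring
  have hcT : 0 ≤ 2 * c * T := by positivity
  rw [hconst]
  have e1 : |T * (2 * c * Real.log ⌊T⌋₊ ^ 4) - T * (2 * c * Real.log T ^ 4)| ≤
      8 * c * T * Real.log T ^ 3 := by
    rw [abs_sub_comm, show T * (2 * c * Real.log T ^ 4) - T * (2 * c * Real.log ⌊T⌋₊ ^ 4) =
      2 * c * T * (Real.log T ^ 4 - Real.log ⌊T⌋₊ ^ 4) by ring,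
      abs_of_nonneg (mul_nonneg hcT (by linarith))]
    nlinarith [mul_le_mul_of_nonneg_left hfloor hcT]
  refine (abs_sub_le _ (T * (2 * c * Real.log ⌊T⌋₊ ^ 4)) _).trans ?_
  linarith
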